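/- Let 2 < p < ∞, let I ⊂ ℝ be compact and K₁, K₂ ⊂ ℝ∖{0} be compact, and for each k ∈ ℤ let a_k ∈ C^∞(ℝ³) be supported in I × K₁ × K₂. Fix v ∈ ℤ and l ∈ ℕ, and for each k ∈ ℤ fix l₀ = l₀(v,k) ∈ ℤ with 2^{k+v} γ(2^{−l₀}) ≃ 1; define m_k(u,ξ) = a_k(u, 2^{−l₀} γ_{l₀}(2^l)^{−1} ξ₁, 2^{−k} ξ₂). Suppose F, G > 0 with G ≥ F are constants such that ‖sup_{u∈I} |a_k(u,D)f|‖_{L^q(ℝ²)} ≤ F ‖f‖_{L^q(ℝ²)} for q ∈ {2, ∞}, all k ∈ ℤ, and all Schwartz f, and |∂_ξ^α a_k(u,ξ)| ≤ G for all u ∈ I, ξ ∈ K₁ × K₂, all multi-indices α with |α| ≤ 6, and all k ∈ ℤ. Then ‖sup_{u∈I} (∑_{k∈ℤ} |m_k(u,D)f|²)^{1/2}‖_{L^p(ℝ²)} ≤ C (1 + (log₂(C_{0,U}^l G/F))^{1/2−1/p}) F ‖f‖_{L^p(ℝ²)} for every Schwartz f, with C independent of l, v, F, G, f. -/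

import Mathlib

open MeasureTheory Set Filter ENNReal NNReal

/-- The rescaled curve `γ_l(t) = γ(2^{-l} t)/γ(2^{-l})`. -/
noncomputable def gammaZ (γ : ℝ → ℝ) (l : ℤ) (t : ℝ) : ℝ :=
  γ ((2 : ℝ) ^ (-l) * t) / γ ((2 : ℝ) ^ (-l))

/-- The Fourier transform on `ℝ²`. -/
noncomputable def ft (f : ℝ × ℝ → ℂ) (ξ : ℝ × ℝ) : ℂ :=
  ∫ x : ℝ × ℝ, Complex.exp (-2 * Real.pi * Complex.I * (x.1 * ξ.1 + x.2 * ξ.2)) * f x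

/-- The inverse Fourier transform on `ℝ²`. -/
noncomputable def ftInv (f : ℝ × ℝ → ℂ) (x : ℝ × ℝ) : ℂ :=
  ∫ ξ : ℝ × ℝ, Complex.exp (2 * Real.pi * Complex.I * (x.1 * ξ.1 + x.2 * ξ.2)) * f ξ

/-- The Fourier multiplier operator `a(D)f = (a f̂)^∨` with symbol `a`. -/
noncomputable def op (a : ℝ × ℝ → ℂ) (f : ℝ × ℝ → ℂ) : ℝ × ℝ → ℂ :=
  ftInv (fun ξ => a ξ * ft f ξ)

noncomputable def gX (A : ℝ) (s : ℤ) : ℝ := A * 2 ^ s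
noncomputable def gY (d : ℕ) (s : ℤ) : ℝ := ((2 : ℝ) ^ d) ^ s
noncomputable def gp (A : ℝ) (d : ℕ) (s : ℤ) (x : ℝ × ℝ) : ℤ × ℤ :=
  (⌊gX A s * x.1⌋, ⌊gY d s * x.2⌋)
noncomputable def gv (A : ℝ) (d : ℕ) (s : ℤ) : ℝ≥0∞ := ENNReal.ofReal ((gX A s * gY d s)⁻¹)
noncomputable def gE (A : ℝ) (d : ℕ) (s : ℤ) (w : ℝ × ℝ → ℝ≥0∞) (x : ℝ × ℝ) : ℝ≥0∞ :=
  (gv A d s)⁻¹ * ∫⁻ y in gp A d s ⁻¹' {gp A d s x}, w y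
noncomputable def gT (A : ℝ) (d : ℕ) (s : ℤ) (m : ℤ × ℤ) (x : ℝ × ℝ) : ℝ × ℝ :=
  (x.1 + m.1 / gX A s, x.2 + m.2 / gY d s)

theorem gX_pos {A : ℝ} (hA : 0 < A) (s : ℤ) : 0 < gX A s := by unfold gX; positivity
theorem gY_pos (d : ℕ) (s : ℤ) : 0 < gY d s := by unfold gY; positivity

theorem gv_ne_zero {A : ℝ} (hA : 0 < A) (d : ℕ) (s : ℤ) : gv A d s ≠ 0 := by
  have := gX_pos hA s
  have := gY_pos d s
  unfold gv
  simp only [ne_eq, ENNReal.ofReal_eq_zero, not_le]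
  positivity

theorem gv_ne_top (A : ℝ) (d : ℕ) (s : ℤ) : gv A d s ≠ ⊤ := ENNReal.ofReal_ne_top

theorem gp_meas (A : ℝ) (d : ℕ) (s : ℤ) : Measurable (gp A d s) := by
  unfold gp; fun_prop

theorem floor_mul_eq_iff {c : ℝ} (hc : 0 < c) (t : ℝ) (m : ℤ) :
    ⌊c * t⌋ = m ↔ t ∈ Set.Ico ((m : ℝ) / c) ((m + 1) / c) := by
  rw [Int.floor_eq_iff, Set.mem_Ico, div_le_iff₀ hc, lt_div_iff₀ hc, mul_comm]

theorem gp_preimage {A : ℝ} (hA : 0 < A) (d : ℕ) (s : ℤ) (m : ℤ × ℤ) :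
    gp A d s ⁻¹' {m} = Set.Ico ((m.1 : ℝ) / gX A s) ((m.1 + 1) / gX A s) ×ˢ
      Set.Ico ((m.2 : ℝ) / gY d s) ((m.2 + 1) / gY d s) := by
  ext x
  rw [Set.mem_preimage, Set.mem_singleton_iff, Set.mem_prod, ← floor_mul_eq_iff (gX_pos hA s),
    ← floor_mul_eq_iff (gY_pos d s), gp, Prod.ext_iff]

theorem gp_volume {A : ℝ} (hA : 0 < A) (d : ℕ) (s : ℤ) (m : ℤ × ℤ) :
    volume (gp A d s ⁻¹' {m}) = gv A d s := by
  have h1 := gX_pos hA s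
  have h2 := gY_pos d s
  rw [gp_preimage hA, Measure.volume_eq_prod, Measure.prod_prod, Real.volume_Ico, Real.volume_Ico,
    ← ENNReal.ofReal_mul, gv]
  · congr 1; field_simp; ring
  · have : (↑m.1 + 1) / gX A s - ↑m.1 / gX A s = 1 / gX A s := by ring
    rw [this]; positivity

theorem gp_meas_set (A : ℝ) (d : ℕ) (s : ℤ) (Z : Set (ℤ × ℤ)) :
    MeasurableSet (gp A d s ⁻¹' Z) := gp_meas A d s (measurableSet_of_countable_aux Z)
where measurableSet_of_countable_aux (Z : Set (ℤ × ℤ)) : MeasurableSet Z := Z.to_countable.measurableSet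

theorem floor_nest (N : ℕ) (hN : 0 < N) {y z : ℝ} (h : ⌊(N : ℝ) * y⌋ = ⌊(N : ℝ) * z⌋) :
    ⌊y⌋ = ⌊z⌋ := by
  have hN' : (N : ℝ) ≠ 0 := by positivity
  have e : ∀ t : ℝ, ⌊t⌋ = ⌊(N : ℝ) * t⌋ / N := by
    intro t
    rw [← Int.floor_div_natCast]; congr 1; field_simp
  rw [e y, e z, h]

theorem gX_shift (A : ℝ) {s s' : ℤ} (h : s' ≤ s) :
    gX A s = ((2 ^ (s - s').toNat : ℕ) : ℝ) * gX A s' := by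
  unfold gX
  push_cast
  rw [← zpow_natCast, Int.toNat_of_nonneg (by omega), mul_left_comm, ← zpow_add₀ (by norm_num)]
  congr 2; ring

theorem gY_shift (d : ℕ) {s s' : ℤ} (h : s' ≤ s) :
    gY d s = (((2 ^ d) ^ (s - s').toNat : ℕ) : ℝ) * gY d s' := by
  unfold gY
  push_cast
  rw [← zpow_natCast ((2 : ℝ) ^ d) _, Int.toNat_of_nonneg (by omega), ← zpow_add₀ (by positivity)]
  congr 1; ring

theorem gp_nest (A : ℝ) (d : ℕ) {s s' : ℤ} (h : s' ≤ s) {x y : ℝ × ℝ}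
    (hxy : gp A d s x = gp A d s y) : gp A d s' x = gp A d s' y := by
  unfold gp at *
  rw [Prod.ext_iff] at *
  simp only at *
  rw [gX_shift A h, gY_shift d h, mul_assoc, mul_assoc, mul_assoc, mul_assoc] at hxy
  exact ⟨floor_nest _ (by positivity) hxy.1, floor_nest _ (by positivity) hxy.2⟩

theorem gv_step {A : ℝ} (hA : 0 < A) (d : ℕ) (s : ℤ) :
    gv A d (s - 1) = ENNReal.ofReal (2 * 2 ^ d) * gv A d s := by
  unfold gv
  rw [← ENNReal.ofReal_mul (by positivity)]
  congr 1
  have h1 := gX_pos hA (s - 1)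
  have h2 := gY_pos d (s - 1)
  rw [gX_shift A (show s - 1 ≤ s by omega), gY_shift d (show s - 1 ≤ s by omega)]
  simp
  field_simp

theorem gE_congr (A : ℝ) (d : ℕ) (s : ℤ) (w : ℝ × ℝ → ℝ≥0∞) {x y : ℝ × ℝ}
    (h : gp A d s x = gp A d s y) : gE A d s w x = gE A d s w y := by
  unfold gE; rw [h]

theorem gE_factor (A : ℝ) (d : ℕ) (s : ℤ) (w : ℝ × ℝ → ℝ≥0∞) :
    gE A d s w = (fun m => (gv A d s)⁻¹ * ∫⁻ y in gp A d s ⁻¹' {m}, w y) ∘ gp A d s := rfl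

theorem gE_meas (A : ℝ) (d : ℕ) (s : ℤ) (w : ℝ × ℝ → ℝ≥0∞) : Measurable (gE A d s w) := by
  rw [gE_factor]
  exact (measurable_of_countable _).comp (gp_meas A d s)

theorem gE_mono (A : ℝ) (d : ℕ) (s : ℤ) {w w' : ℝ × ℝ → ℝ≥0∞} (h : ∀ x, w x ≤ w' x) (x) :
    gE A d s w x ≤ gE A d s w' x := by
  unfold gE; gcongr; exact h _

theorem lintegral_cells (A : ℝ) (d : ℕ) (s : ℤ) (Z : Set (ℤ × ℤ)) (w : ℝ × ℝ → ℝ≥0∞) :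
    ∫⁻ y in gp A d s ⁻¹' Z, w y = ∑' m : Z, ∫⁻ y in gp A d s ⁻¹' {(m : ℤ × ℤ)}, w y := by
  rw [← lintegral_iUnion (fun m => gp_meas_set A d s _)]
  · congr 2
    ext x; simp
  · intro m m' hm
    rw [Function.onFun, Set.disjoint_left]
    intro x hx hx'
    simp only [Set.mem_preimage, Set.mem_singleton_iff] at hx hx'
    exact hm (Subtype.ext (hx.symm.trans hx'))

theorem lintegral_gE {A : ℝ} (hA : 0 < A) (d : ℕ) (s : ℤ) (Z : Set (ℤ × ℤ)) (w : ℝ × ℝ → ℝ≥0∞) :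
    ∫⁻ y in gp A d s ⁻¹' Z, gE A d s w y = ∫⁻ y in gp A d s ⁻¹' Z, w y := by
  rw [lintegral_cells, lintegral_cells]
  congr 1; ext m
  have : ∀ y ∈ gp A d s ⁻¹' {(m : ℤ × ℤ)}, gE A d s w y =
      (gv A d s)⁻¹ * ∫⁻ y in gp A d s ⁻¹' {(m : ℤ × ℤ)}, w y := by
    intro y hy
    simp only [Set.mem_preimage, Set.mem_singleton_iff] at hy
    rw [gE, hy]
  rw [setLIntegral_congr_fun (gp_meas_set A d s _) this, setLIntegral_const, gp_volume hA,
    mul_right_comm, ENNReal.inv_mul_cancel (gv_ne_zero hA d s) (gv_ne_top A d s), one_mul]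

theorem gE_le_total {A : ℝ} (d : ℕ) (s : ℤ) (w : ℝ × ℝ → ℝ≥0∞) (x) :
    gE A d s w x ≤ (gv A d s)⁻¹ * ∫⁻ y, w y := by
  unfold gE; gcongr; exact Measure.restrict_le_self

theorem gE_add_const_le {A : ℝ} (hA : 0 < A) (d : ℕ) (s : ℤ) (w : ℝ × ℝ → ℝ≥0∞) (c : ℝ≥0∞) (x) :
    gE A d s (fun y => c + w y) x = c + gE A d s w x := by
  unfold gE
  rw [lintegral_add_left measurable_const, setLIntegral_const, gp_volume hA, mul_add, mul_left_comm,
    ENNReal.inv_mul_cancel (gv_ne_zero hA d s) (gv_ne_top A d s), mul_one]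

theorem gp_gT {A : ℝ} (hA : 0 < A) (d : ℕ) (s : ℤ) (m : ℤ × ℤ) (x : ℝ × ℝ) :
    gp A d s (gT A d s m x) = gp A d s x + m := by
  have h1 := (gX_pos hA s).ne'
  have h2 := (gY_pos d s).ne'
  unfold gp gT
  ext
  · simp only [mul_add, mul_div_cancel₀ _ h1, Int.floor_add_intCast, Prod.fst_add]
  · simp only [mul_add, mul_div_cancel₀ _ h2, Int.floor_add_intCast, Prod.snd_add]

theorem gT_mp (A : ℝ) (d : ℕ) (s : ℤ) (m : ℤ × ℤ) :
    MeasurePreserving (gT A d s m) volume volume := by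
  have := measurePreserving_add_right (volume : Measure (ℝ × ℝ))
    ((m.1 / gX A s, m.2 / gY d s) : ℝ × ℝ)
  exact this

def gS (A : ℝ) (d : ℕ) (w : ℝ × ℝ → ℝ≥0∞) (t : ℝ≥0∞) (s : ℤ) : Set (ℝ × ℝ) :=
  {x | t < gE A d s w x ∧ ∀ s' < s, gE A d s' w x ≤ t}

theorem gS_congr {A : ℝ} {d : ℕ} {w : ℝ × ℝ → ℝ≥0∞} {t : ℝ≥0∞} {s : ℤ} {x y : ℝ × ℝ}
    (h : gp A d s x = gp A d s y) (hx : x ∈ gS A d w t s) : y ∈ gS A d w t s := by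
  refine ⟨(gE_congr A d s w h) ▸ hx.1, fun s' hs' => ?_⟩
  rw [← gE_congr A d s' w (gp_nest A d hs'.le h)]
  exact hx.2 s' hs'

theorem gS_sat (A : ℝ) (d : ℕ) (w : ℝ × ℝ → ℝ≥0∞) (t : ℝ≥0∞) (s : ℤ) :
    gp A d s ⁻¹' (gp A d s '' gS A d w t s) = gS A d w t s := by
  apply Set.Subset.antisymm
  · rintro y ⟨x, hx, hxy⟩
    exact gS_congr hxy hx
  · exact Set.subset_preimage_image _ _

theorem gS_meas (A : ℝ) (d : ℕ) (w : ℝ × ℝ → ℝ≥0∞) (t : ℝ≥0∞) (s : ℤ) :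
    MeasurableSet (gS A d w t s) := by
  rw [← gS_sat]; exact gp_meas_set _ _ _ _

theorem gS_disj (A : ℝ) (d : ℕ) (w : ℝ × ℝ → ℝ≥0∞) (t : ℝ≥0∞) :
    Pairwise (Function.onFun Disjoint (gS A d w t)) := by
  intro s s' hs
  rw [Function.onFun, Set.disjoint_left]
  intro x hx hx'
  rcases lt_or_gt_of_ne hs with h | h
  · exact absurd hx.1 (not_lt.2 (hx'.2 s h))
  · exact absurd hx'.1 (not_lt.2 (hx.2 s' h))

theorem gS_exists {A : ℝ} {d : ℕ} {w : ℝ × ℝ → ℝ≥0∞} {t : ℝ≥0∞}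
    (hb : ∃ s0 : ℤ, ∀ s < s0, ∀ x, gE A d s w x ≤ t) {s : ℤ} {x : ℝ × ℝ}
    (h : t < gE A d s w x) : ∃ s' ≤ s, x ∈ gS A d w t s' := by
  obtain ⟨s0, hs0⟩ := hb
  obtain ⟨s', h1, h2⟩ := Int.exists_least_of_bdd (P := fun s => t < gE A d s w x)
    ⟨s0, fun z hz => by
      by_contra hlt
      exact absurd hz (not_lt.2 (hs0 z (not_le.1 hlt) x))⟩ ⟨s, h⟩
  refine ⟨s', h2 s h, h1, fun s'' hs'' => ?_⟩
  by_contra hlt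
  have := h2 s'' (not_le.1 hlt)
  omega

theorem gS_iUnion {A : ℝ} {d : ℕ} {w : ℝ × ℝ → ℝ≥0∞} {t : ℝ≥0∞}
    (hb : ∃ s0 : ℤ, ∀ s < s0, ∀ x, gE A d s w x ≤ t) :
    {x | ∃ s, t < gE A d s w x} = ⋃ s, gS A d w t s := by
  ext x
  simp only [Set.mem_ofPred_eq, Set.mem_iUnion]
  constructor
  · rintro ⟨s, hs⟩
    obtain ⟨s', _, h⟩ := gS_exists hb hs
    exact ⟨s', h⟩
  · rintro ⟨s, hs⟩
    exact ⟨s, hs.1⟩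

theorem gv_inv_small {A : ℝ} (hA : 0 < A) (d : ℕ) {ε : ℝ≥0∞} (hε : ε ≠ 0) :
    ∃ s0 : ℤ, ∀ s < s0, (gv A d s)⁻¹ ≤ ε := by
  rcases eq_or_ne ε ⊤ with rfl | hε'
  · exact ⟨0, fun _ _ => le_top⟩
  have hr : 0 < ε.toReal := ENNReal.toReal_pos hε hε'
  obtain ⟨n, hn⟩ := exists_pow_lt_of_lt_one (div_pos hr hA) (show (1 / 2 : ℝ) < 1 by norm_num)
  refine ⟨-n, fun s hs => ?_⟩
  have h1 := gX_pos hA s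
  have h2 := gY_pos d s
  rw [gv, ← ENNReal.ofReal_inv_of_pos (by positivity), inv_inv]
  apply ENNReal.ofReal_le_of_le_toReal
  have h3 : gY d s ≤ 1 := by
    unfold gY
    apply zpow_le_one_of_nonpos₀ (one_le_pow₀ (by norm_num)) (by omega)
  have h4 : (2 : ℝ) ^ s ≤ (1 / 2) ^ n := by
    calc (2 : ℝ) ^ s ≤ 2 ^ (-(n : ℤ)) := zpow_le_zpow_right₀ (by norm_num) (by omega)
      _ = (1 / 2) ^ n := by rw [zpow_neg, zpow_natCast, one_div, inv_pow]
  calc gX A s * gY d s ≤ gX A s * 1 := by gcongr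
    _ ≤ A * (1 / 2) ^ n := by rw [mul_one]; unfold gX; gcongr
    _ ≤ A * (ε.toReal / A) := by gcongr
    _ = ε.toReal := by field_simp

theorem gE_low {A : ℝ} (hA : 0 < A) (d : ℕ) {w : ℝ × ℝ → ℝ≥0∞} {t : ℝ≥0∞} (ht : t ≠ 0)
    (hw : ∫⁻ y, w y ≠ ⊤) : ∃ s0 : ℤ, ∀ s < s0, ∀ x, gE A d s w x ≤ t := by
  have : t / (∫⁻ y, w y) ≠ 0 := ENNReal.div_ne_zero.2 ⟨ht, hw⟩
  obtain ⟨s0, h⟩ := gv_inv_small hA d this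
  refine ⟨s0, fun s hs x => (gE_le_total d s w x).trans ?_⟩
  calc (gv A d s)⁻¹ * ∫⁻ y, w y ≤ t / (∫⁻ y, w y) * ∫⁻ y, w y := by gcongr; exact h s hs
    _ ≤ t := by rw [div_eq_mul_inv, mul_assoc]; exact mul_le_of_le_one_right' (ENNReal.inv_mul_le_one _)

theorem gweak0 {A : ℝ} (hA : 0 < A) (d : ℕ) {w : ℝ × ℝ → ℝ≥0∞} {t : ℝ≥0∞} 
    (hb : ∃ s0 : ℤ, ∀ s < s0, ∀ x, gE A d s w x ≤ t) :
    t * volume {x | ∃ s, t < gE A d s w x} ≤ ∫⁻ y, w y := by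
  rw [gS_iUnion hb, measure_iUnion (gS_disj A d w t) (gS_meas A d w t), ← ENNReal.tsum_mul_left]
  calc ∑' s, t * volume (gS A d w t s) ≤ ∑' s, ∫⁻ y in gS A d w t s, w y := by
        apply ENNReal.tsum_le_tsum
        intro s
        rw [← gS_sat, ← lintegral_gE hA, gS_sat, ← setLIntegral_const]
        exact setLIntegral_mono (gE_meas A d s w) (fun x hx => hx.1.le)
    _ = ∫⁻ y in ⋃ s, gS A d w t s, w y := by
        rw [lintegral_iUnion (gS_meas A d w t) (gS_disj A d w t)]
    _ ≤ _ := setLIntegral_le_lintegral _ _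

noncomputable def gN (m : ℤ × ℤ) : ℝ≥0∞ := ((2 * m.1.natAbs + 1) * (2 * m.2.natAbs + 1) : ℕ)

theorem floor_shift_bound (a b : ℝ) (n : ℤ) (hb : |b| ≤ |(n : ℝ)|) :
    ⌊a + b⌋ - ⌊a⌋ ∈ Finset.Icc (-|n|) |n| := by
  have h := abs_le.1 hb
  rw [← Int.cast_abs] at h
  rw [Finset.mem_Icc]
  constructor
  · have : ⌊a⌋ + -|n| ≤ ⌊a + b⌋ := by
      rw [Int.le_floor]; push_cast; push_cast at h; linarith [Int.floor_le a]
    linarith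
  · have : ⌊a + b⌋ ≤ ⌊a⌋ + |n| := by
      rw [← Int.floor_add_intCast]; apply Int.floor_le_floor; push_cast; push_cast at h; linarith
    linarith

theorem gweak_shift {A : ℝ} (hA : 0 < A) (d : ℕ) {w : ℝ × ℝ → ℝ≥0∞} {t : ℝ≥0∞} 
    (hb : ∃ s0 : ℤ, ∀ s < s0, ∀ x, gE A d s w x ≤ t) (m : ℤ × ℤ) :
    volume {x | ∃ s, t < gE A d s w (gT A d s m x)} ≤
      gN m * volume {x | ∃ s, t < gE A d s w x} := by
  set bx : Finset (ℤ × ℤ) := Finset.Icc (-|m.1|) |m.1| ×ˢ Finset.Icc (-|m.2|) |m.2| with hbx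
  have hcard : (bx.card : ℝ≥0∞) = gN m := by
    rw [hbx, Finset.card_product, Int.card_Icc, Int.card_Icc, gN]
    rw [Int.abs_eq_natAbs, Int.abs_eq_natAbs]
    congr 2 <;> omega
  have hsub : {x | ∃ s, t < gE A d s w (gT A d s m x)} ⊆
      ⋃ s, ⋃ m' ∈ bx, gT A d s m' ⁻¹' gS A d w t s := by
    rintro x ⟨s, hs⟩
    obtain ⟨s', hs', hy⟩ := gS_exists hb hs
    set y := gT A d s m x with hydef
    simp only [Set.mem_iUnion]
    refine ⟨s', gp A d s' y - gp A d s' x, ?_, ?_⟩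
    · rw [hbx, Finset.mem_product]
      have hX := gX_pos hA s'
      have hY := gY_pos d s'
      constructor
      · simp only [gp, Prod.fst_sub, hydef, gT, mul_add]
        apply floor_shift_bound
        rw [gX_shift A hs', abs_mul, abs_div, abs_mul, abs_of_pos hX]
        have : (1 : ℝ) ≤ |((2 ^ (s - s').toNat : ℕ) : ℝ)| := by
          rw [Nat.abs_cast]; exact_mod_cast Nat.one_le_two_pow
        rw [mul_div_assoc', div_le_iff₀ (by positivity)]
        nlinarith [mul_le_mul_of_nonneg_left this (mul_nonneg hX.le (abs_nonneg (m.1 : ℝ)))]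
      · simp only [gp, Prod.snd_sub, hydef, gT, mul_add]
        apply floor_shift_bound
        rw [gY_shift d hs', abs_mul, abs_div, abs_mul, abs_of_pos hY]
        have : (1 : ℝ) ≤ |(((2 ^ d) ^ (s - s').toNat : ℕ) : ℝ)| := by
          rw [Nat.abs_cast]; exact_mod_cast Nat.one_le_pow _ _ (by positivity)
        rw [mul_div_assoc', div_le_iff₀ (by positivity)]
        nlinarith [mul_le_mul_of_nonneg_left this (mul_nonneg hY.le (abs_nonneg (m.2 : ℝ)))]
    · rw [Set.mem_preimage]
      refine gS_congr ?_ hy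
      rw [gp_gT hA]; abel
  calc _ ≤ volume (⋃ s, ⋃ m' ∈ bx, gT A d s m' ⁻¹' gS A d w t s) := measure_mono hsub
    _ ≤ ∑' s, volume (⋃ m' ∈ bx, gT A d s m' ⁻¹' gS A d w t s) := measure_iUnion_le _
    _ ≤ ∑' s, gN m * volume (gS A d w t s) := by
        apply ENNReal.tsum_le_tsum
        intro s
        refine (measure_biUnion_finset_le _ _).trans ?_
        rw [← hcard, ← nsmul_eq_mul, ← Finset.sum_const]
        apply Finset.sum_le_sum
        intro m' _
        rw [(gT_mp A d s m').measure_preimage (gS_meas A d w t s).nullMeasurableSet]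
    _ = _ := by
        rw [ENNReal.tsum_mul_left, gS_iUnion hb, measure_iUnion (gS_disj A d w t) (gS_meas A d w t)]

theorem gweak {A : ℝ} (hA : 0 < A) (d : ℕ) (w : ℝ × ℝ → ℝ≥0∞) {t : ℝ≥0∞} (ht : t ≠ 0) (m : ℤ × ℤ) :
    t * volume {x | ∃ s, t < gE A d s w (gT A d s m x)} ≤ gN m * ∫⁻ y, w y := by
  rcases eq_or_ne (∫⁻ y, w y) ⊤ with h | h
  · rw [h, ENNReal.mul_top]; exact le_top
    unfold gN; simp only [ne_eq, Nat.cast_eq_zero]; positivity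
  · have hb := gE_low hA d ht h
    calc _ ≤ t * (gN m * volume {x | ∃ s, t < gE A d s w x}) := by gcongr; exact gweak_shift hA d hb m
      _ = gN m * (t * volume {x | ∃ s, t < gE A d s w x}) := by ring
      _ ≤ _ := by gcongr; exact gweak0 hA d hb

theorem lc_fin {r : ℝ} (hr : 0 < r) {b : ℝ} (hb : 0 ≤ b) :
    ∫⁻ t in Ioo (0 : ℝ) b, ENNReal.ofReal (t ^ (r - 1)) = (ENNReal.ofReal r)⁻¹ * ENNReal.ofReal b ^ r := by
  rw [restrict_Ioo_eq_restrict_Ioc]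
  rw [← ofReal_integral_eq_lintegral_ofReal]
  · rw [← intervalIntegral.integral_of_le hb, integral_rpow (Or.inl (by linarith)),
      ← ENNReal.ofReal_inv_of_pos hr, ENNReal.ofReal_rpow_of_nonneg hb hr.le, ← ENNReal.ofReal_mul (by positivity)]
    congr 1
    rw [sub_add_cancel, Real.zero_rpow hr.ne']
    ring
  · have := intervalIntegral.intervalIntegrable_rpow' (a := 0) (b := b) (show -1 < r - 1 by linarith)
    rwa [intervalIntegrable_iff_integrableOn_Ioc_of_le hb] at this
  · filter_upwards [self_mem_ae_restrict measurableSet_Ioc] with t ht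
    exact Real.rpow_nonneg ht.1.le _

theorem lc_one {r : ℝ} (hr : 0 < r) (a : ℝ≥0∞) :
    ∫⁻ t in Ioi (0 : ℝ), (if ENNReal.ofReal t < a then ENNReal.ofReal (t ^ (r - 1)) else 0) =
      (ENNReal.ofReal r)⁻¹ * a ^ r := by
  have key : ∀ b : ℝ, 0 ≤ b → ∫⁻ t in Ioi (0 : ℝ), (if ENNReal.ofReal t < ENNReal.ofReal b then ENNReal.ofReal (t ^ (r - 1)) else 0) =
      (ENNReal.ofReal r)⁻¹ * ENNReal.ofReal b ^ r := by
    intro b hb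
    rw [← lc_fin hr hb, ← lintegral_indicator measurableSet_Ioi, ← lintegral_indicator measurableSet_Ioo]
    congr 1; ext t
    simp only [Set.indicator_apply, Set.mem_Ioi, Set.mem_Ioo]
    by_cases h : 0 < t
    · simp only [h, true_and, if_true]
      congr 1
      simp only [eq_iff_iff, ENNReal.ofReal_lt_ofReal_iff']
      constructor
      · exact fun h => h.1
      · exact fun h' => ⟨h', h.trans h'⟩
    · simp [h]
  rcases eq_or_ne a ⊤ with rfl | ha
  · have hmono : ∀ n : ℕ, (ENNReal.ofReal r)⁻¹ * (n : ℝ≥0∞) ^ r ≤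
       ∫⁻ t in Ioi (0 : ℝ), (if ENNReal.ofReal t < ⊤ then ENNReal.ofReal (t ^ (r - 1)) else 0) := by
      intro n
      have := key n (by positivity)
      rw [ENNReal.ofReal_natCast] at this
      rw [← this]
      apply lintegral_mono
      intro t
      dsimp only
      split_ifs with h1 h2
      · exact le_rfl
      · exact absurd ENNReal.ofReal_lt_top h2
      · exact zero_le
      · exact le_rfl
    have hlim : Tendsto (fun n : ℕ => (ENNReal.ofReal r)⁻¹ * (n : ℝ≥0∞) ^ r) atTop
        (nhds ((ENNReal.ofReal r)⁻¹ * ⊤ ^ r)) := by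
      apply ENNReal.Tendsto.const_mul
      · exact (ENNReal.continuous_rpow_const.tendsto _).comp ENNReal.tendsto_nat_nhds_top
      · left; rw [ENNReal.top_rpow_of_pos hr]; simp
    have := le_of_tendsto' hlim hmono
    refine le_antisymm ?_ this
    rw [ENNReal.top_rpow_of_pos hr, ENNReal.mul_top (by simp)]
    exact le_top
  · have := key a.toReal ENNReal.toReal_nonneg
    rwa [ENNReal.ofReal_toReal ha] at this

theorem lcG {α : Type*} [MeasurableSpace α] (μ : Measure α) [SFinite μ] {r : ℝ} (hr : 0 < r)
    {V W : α → ℝ≥0∞} (hV : Measurable V) (hW : Measurable W) :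
    ∫⁻ t in Ioi (0 : ℝ), ENNReal.ofReal (t ^ (r - 1)) * ∫⁻ x in {x | ENNReal.ofReal t < W x}, V x ∂μ =
      (ENNReal.ofReal r)⁻¹ * ∫⁻ x, V x * W x ^ r ∂μ := by
  have h1 : ∀ t : ℝ, ENNReal.ofReal (t ^ (r - 1)) * ∫⁻ x in {x | ENNReal.ofReal t < W x}, V x ∂μ =
      ∫⁻ x, V x * (if ENNReal.ofReal t < W x then ENNReal.ofReal (t ^ (r - 1)) else 0) ∂μ := by
    intro t
    rw [← lintegral_indicator (measurableSet_lt measurable_const hW), ← lintegral_const_mul' _ _ ENNReal.ofReal_ne_top]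
    congr 1; ext x
    simp only [Set.indicator_apply, Set.mem_ofPred_eq]
    split_ifs
    · ring
    · simp
  simp_rw [h1]
  rw [lintegral_lintegral_swap, ← lintegral_const_mul]
  · congr 1; ext x
    rw [lintegral_const_mul, lc_one hr]
    · ring
    · apply Measurable.ite
      · exact measurableSet_lt ENNReal.measurable_ofReal measurable_const
      · fun_prop
      · fun_prop
  · fun_prop
  · apply Measurable.aemeasurable
    apply Measurable.mul (by fun_prop)
    apply Measurable.ite
    · exact measurableSet_lt (by fun_prop) (by fun_prop)
    · fun_prop
    · fun_prop

theorem layercake {α : Type*} [MeasurableSpace α] (μ : Measure α) [SFinite μ] {r : ℝ} (hr : 0 < r)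
    {W : α → ℝ≥0∞} (hW : Measurable W) :
    ∫⁻ x, W x ^ r ∂μ = ENNReal.ofReal r *
      ∫⁻ t in Ioi (0 : ℝ), ENNReal.ofReal (t ^ (r - 1)) * μ {x | ENNReal.ofReal t < W x} := by
  have := lcG μ hr (V := fun _ => 1) measurable_const hW
  simp only [lintegral_const, one_mul, Measure.restrict_apply, MeasurableSet.univ, Set.univ_inter] at this
  rw [this, ← mul_assoc, ENNReal.mul_inv_cancel (by simpa using hr) ENNReal.ofReal_ne_top, one_mul]

noncomputable def gMm (A : ℝ) (d : ℕ) (m : ℤ × ℤ) (w : ℝ × ℝ → ℝ≥0∞) (x : ℝ × ℝ) : ℝ≥0∞ :=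
  ⨆ s, gE A d s w (gT A d s m x)

theorem gMm_meas (A : ℝ) (d : ℕ) (m : ℤ × ℤ) (w : ℝ × ℝ → ℝ≥0∞) : Measurable (gMm A d m w) := by
  unfold gMm
  exact Measurable.iSup fun s => (gE_meas A d s w).comp (gT_mp A d s m).measurable

noncomputable def KM (q : ℝ) : ℝ≥0∞ := ENNReal.ofReal q * 2 * (ENNReal.ofReal (q - 1))⁻¹ * 2 ^ (q - 1)

theorem KM_ne_top {q : ℝ} (hq : 1 < q) : KM q ≠ ⊤ := by
  unfold KM
  refine ENNReal.mul_ne_top (ENNReal.mul_ne_top (ENNReal.mul_ne_top ?_ ?_) ?_) ?_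
  · simp
  · simp
  · simpa using hq
  · exact ENNReal.rpow_ne_top_of_nonneg (by linarith) (by simp)

theorem gMm_strong {A : ℝ} (hA : 0 < A) (d : ℕ) (m : ℤ × ℤ) {w : ℝ × ℝ → ℝ≥0∞} (hw : Measurable w)
    {q : ℝ} (hq : 1 < q) :
    ∫⁻ x, gMm A d m w x ^ q ≤ KM q * gN m * ∫⁻ x, w x ^ q := by
  rw [layercake _ (by linarith) (gMm_meas A d m w)]
  have hbound : ∀ t ∈ Ioi (0 : ℝ), ENNReal.ofReal (t ^ (q - 1)) * volume {x | ENNReal.ofReal t < gMm A d m w x} ≤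
      2 * gN m * (ENNReal.ofReal (t ^ (q - 1 - 1)) * ∫⁻ x in {x | ENNReal.ofReal t < 2 * w x}, w x) := by
    intro t ht
    rw [Set.mem_Ioi] at ht
    set S := {x | ENNReal.ofReal t < 2 * w x} with hS
    have hSm : MeasurableSet S := measurableSet_lt measurable_const (by fun_prop)
    have hhalf : ENNReal.ofReal t = ENNReal.ofReal (t / 2) + ENNReal.ofReal (t / 2) := by
      rw [← ENNReal.ofReal_add (by positivity) (by positivity)]; congr 1; ring
    have hsub : {x | ENNReal.ofReal t < gMm A d m w x} ⊆
        {x | ∃ s, ENNReal.ofReal (t / 2) < gE A d s (S.indicator w) (gT A d s m x)} := by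
      intro x hx
      simp only [Set.mem_ofPred_eq, gMm, lt_iSup_iff] at hx ⊢
      obtain ⟨s, hs⟩ := hx
      refine ⟨s, ?_⟩
      by_contra hcon
      rw [not_lt] at hcon
      have h1 : gE A d s w (gT A d s m x) ≤ gE A d s (fun y => ENNReal.ofReal (t / 2) + S.indicator w y) (gT A d s m x) := by
        apply gE_mono
        intro y
        by_cases hy : y ∈ S
        · rw [Set.indicator_of_mem hy]; exact le_add_self
        · rw [Set.indicator_of_notMem hy, add_zero]
          rw [hS, Set.mem_ofPred_eq, not_lt] at hy
          rw [hhalf, ← two_mul] at hy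
          exact (ENNReal.mul_le_mul_iff_right (by simp) (by simp)).1 hy
      rw [gE_add_const_le hA] at h1
      have h2 : gE A d s w (gT A d s m x) ≤ ENNReal.ofReal t := by
        rw [hhalf]; exact h1.trans (by gcongr)
      exact absurd hs (not_lt.2 h2)
    have hwk := gweak hA d (S.indicator w) (t := ENNReal.ofReal (t / 2)) (by simp; linarith) m
    rw [lintegral_indicator hSm] at hwk
    have hsplit : ENNReal.ofReal (t ^ (q - 1)) = ENNReal.ofReal (t ^ (q - 1 - 1)) * 2 * ENNReal.ofReal (t / 2) := by
      rw [show (2 : ℝ≥0∞) = ENNReal.ofReal 2 by simp, ← ENNReal.ofReal_mul (by positivity), ← ENNReal.ofReal_mul (by positivity)]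
      congr 1
      rw [Real.rpow_sub_one ht.ne' (q - 1)]
      field_simp
    calc _ ≤ ENNReal.ofReal (t ^ (q - 1)) * volume {x | ∃ s, ENNReal.ofReal (t / 2) < gE A d s (S.indicator w) (gT A d s m x)} := by
          gcongr
      _ = ENNReal.ofReal (t ^ (q - 1 - 1)) * 2 * (ENNReal.ofReal (t / 2) * volume {x | ∃ s, ENNReal.ofReal (t / 2) < gE A d s (S.indicator w) (gT A d s m x)}) := by
          rw [hsplit]; ring
      _ ≤ ENNReal.ofReal (t ^ (q - 1 - 1)) * 2 * (gN m * ∫⁻ x in S, w x) := by gcongr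
      _ = _ := by ring
  have hfin : gN m ≠ ⊤ := by unfold gN; exact ENNReal.natCast_ne_top _
  calc _ ≤ ENNReal.ofReal q * ∫⁻ t in Ioi (0 : ℝ), 2 * gN m * (ENNReal.ofReal (t ^ (q - 1 - 1)) * ∫⁻ x in {x | ENNReal.ofReal t < 2 * w x}, w x) := by
        gcongr ENNReal.ofReal q * ?_
        exact setLIntegral_mono' measurableSet_Ioi hbound
    _ = ENNReal.ofReal q * (2 * gN m * ((ENNReal.ofReal (q - 1))⁻¹ * ∫⁻ x, w x * (2 * w x) ^ (q - 1))) := by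
        rw [lintegral_const_mul' _ _ (ENNReal.mul_ne_top (by simp) hfin), lcG _ (by linarith) hw (by fun_prop)]
    _ = KM q * gN m * ∫⁻ x, w x ^ q := by
        have : ∀ x, w x * (2 * w x) ^ (q - 1) = 2 ^ (q - 1) * w x ^ q := by
          intro x
          rw [ENNReal.mul_rpow_of_nonneg _ _ (by linarith)]
          have : w x ^ q = w x * w x ^ (q - 1) := by
            conv_lhs => rw [show q = 1 + (q - 1) by ring]
            rw [ENNReal.rpow_add_of_nonneg _ _ (by norm_num) (by linarith), ENNReal.rpow_one]
          rw [this]; ring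
        simp_rw [this]
        rw [lintegral_const_mul' _ _ (ENNReal.rpow_ne_top_of_nonneg (by linarith) (by simp)), KM]
        ring

noncomputable def gw (n : ℤ) : ℝ≥0∞ := ENNReal.ofReal ((1 + |(n : ℝ)|) ^ (-(5 / 2) : ℝ))
noncomputable def gW (m : ℤ × ℤ) : ℝ≥0∞ := gw m.1 * gw m.2

theorem gw_sum : ∑' n : ℤ, gw n * (2 * n.natAbs + 1 : ℕ) ≠ ⊤ := by
  have h1 : Summable (fun n : ℤ => 2 * |(n : ℝ)| ^ (-(3 / 2) : ℝ) ) :=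
    (Real.summable_abs_int_rpow (by norm_num)).mul_left 2
  have h2 : ∀ n : ℤ, gw n * (2 * n.natAbs + 1 : ℕ) ≤ ENNReal.ofReal (2 * |(n : ℝ)| ^ (-(3 / 2) : ℝ)) + (if n = 0 then 1 else 0) := by
    intro n
    by_cases hn : n = 0
    · subst hn; simp [gw]
    rw [if_neg hn, add_zero, gw, ← ENNReal.ofReal_natCast, ← ENNReal.ofReal_mul (by positivity)]
    apply ENNReal.ofReal_le_ofReal
    push_cast
    rw [Nat.cast_natAbs, Int.cast_abs]
    have hpos : 0 < |(n : ℝ)| := by positivity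
    calc (1 + |(n : ℝ)|) ^ (-(5 / 2) : ℝ) * (2 * |(n : ℝ)| + 1) ≤ (1 + |(n : ℝ)|) ^ (-(5 / 2) : ℝ) * (2 * (1 + |(n : ℝ)|)) := by
          gcongr; linarith
      _ = 2 * (1 + |(n : ℝ)|) ^ (-(3 / 2) : ℝ) := by
          rw [show (-(3 / 2) : ℝ) = -(5 / 2) + 1 by norm_num, Real.rpow_add_one (by positivity)]; ring
      _ ≤ _ := by
          gcongr 2 * ?_
          exact Real.rpow_le_rpow_of_nonpos hpos (by linarith) (by norm_num)
  refine ne_top_of_le_ne_top ?_ (ENNReal.tsum_le_tsum h2)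
  rw [ENNReal.tsum_add]
  refine ENNReal.add_ne_top.2 ⟨h1.tsum_ofReal_ne_top, ?_⟩
  simp

theorem gW_sum : ∑' m, gW m * gN m ≠ ⊤ := by
  have : ∀ m : ℤ × ℤ, gW m * gN m = (gw m.1 * (2 * m.1.natAbs + 1 : ℕ)) * (gw m.2 * (2 * m.2.natAbs + 1 : ℕ)) := by
    intro m; unfold gW gN; push_cast; ring
  simp_rw [this]
  rw [ENNReal.tsum_prod' (f := fun m : ℤ × ℤ => _)]
  simp_rw [ENNReal.tsum_mul_left, ENNReal.tsum_mul_right]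
  exact ENNReal.mul_ne_top gw_sum gw_sum

theorem gN_ge (m) : 1 ≤ gN m := by
  unfold gN
  exact_mod_cast Nat.succ_le_of_lt (by positivity)

theorem gW_sum' : ∑' m, gW m ≠ ⊤ :=
  ne_top_of_le_ne_top gW_sum (ENNReal.tsum_le_tsum fun m => le_mul_of_one_le_right zero_le (gN_ge m))

noncomputable def gM (A : ℝ) (d : ℕ) (w : ℝ × ℝ → ℝ≥0∞) (x : ℝ × ℝ) : ℝ≥0∞ :=
  ⨆ s, ∑' m, gW m * gE A d s w (gT A d s m x)

theorem gM_meas (A : ℝ) (d : ℕ) (w : ℝ × ℝ → ℝ≥0∞) : Measurable (gM A d w) := by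
  unfold gM
  refine Measurable.iSup fun s => Measurable.tsum fun m => Measurable.const_mul ?_ _
  exact (gE_meas A d s w).comp (gT_mp A d s m).measurable

theorem tsum_jensen {ι : Type*} {q : ℝ} (hq : 1 ≤ q) (W f : ι → ℝ≥0∞) :
    (∑' i, W i * f i) ^ q ≤ (∑' i, W i) ^ (q - 1) * ∑' i, W i * f i ^ q := by
  have hq0 : 0 < q := by linarith
  have : ∑' i, W i * f i ≤ ((∑' i, W i) ^ (q - 1) * ∑' i, W i * f i ^ q) ^ q⁻¹ := by
    refine ENNReal.tsum_eq_iSup_sum.trans_le (iSup_le fun s => ?_)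
    refine (ENNReal.inner_le_weight_mul_Lp_of_nonneg s hq W f).trans ?_
    rw [ENNReal.mul_rpow_of_nonneg _ _ (by positivity), ← ENNReal.rpow_mul]
    have e : (q - 1) * q⁻¹ = 1 - q⁻¹ := by field_simp
    rw [e]
    have : 0 ≤ 1 - q⁻¹ := by rw [← e]; exact mul_nonneg (by linarith) (by positivity)
    gcongr
    · exact ENNReal.sum_le_tsum s
    · exact ENNReal.sum_le_tsum s
  calc _ ≤ (((∑' i, W i) ^ (q - 1) * ∑' i, W i * f i ^ q) ^ q⁻¹) ^ q := by gcongr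
    _ = _ := by rw [← ENNReal.rpow_mul, inv_mul_cancel₀ hq0.ne', ENNReal.rpow_one]

theorem gM_strong {q : ℝ} (hq : 1 < q) : ∃ C : ℝ≥0∞, C ≠ ⊤ ∧ ∀ {A : ℝ} (_hA : 0 < A) (d : ℕ)
    {w : ℝ × ℝ → ℝ≥0∞} (_hw : Measurable w),
    ∫⁻ x, gM A d w x ^ q ≤ C * ∫⁻ x, w x ^ q := by
  refine ⟨(∑' m, gW m) ^ (q - 1) * (KM q * ∑' m, gW m * gN m), ?_, ?_⟩
  · exact ENNReal.mul_ne_top (ENNReal.rpow_ne_top_of_nonneg (by linarith) gW_sum')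
      (ENNReal.mul_ne_top (KM_ne_top hq) gW_sum)
  intro A hA d w hw
  have h1 : ∀ x, gM A d w x ^ q ≤ (∑' m, gW m) ^ (q - 1) * ∑' m, gW m * gMm A d m w x ^ q := by
    intro x
    refine le_trans ?_ (tsum_jensen hq.le _ _)
    gcongr
    refine iSup_le fun s => ENNReal.tsum_le_tsum fun m => ?_
    gcongr
    exact le_iSup (fun s => gE A d s w (gT A d s m x)) s
  calc _ ≤ ∫⁻ x, (∑' m, gW m) ^ (q - 1) * ∑' m, gW m * gMm A d m w x ^ q := lintegral_mono h1
    _ = (∑' m, gW m) ^ (q - 1) * ∑' m, gW m * ∫⁻ x, gMm A d m w x ^ q := by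
        rw [lintegral_const_mul' _ _ (ENNReal.rpow_ne_top_of_nonneg (by linarith) gW_sum'), lintegral_tsum]
        · congr 2; ext m
          rw [lintegral_const_mul _ ((gMm_meas A d m w).pow_const q)]
        · exact fun m => (((gMm_meas A d m w).pow_const q).const_mul _).aemeasurable
    _ ≤ (∑' m, gW m) ^ (q - 1) * ∑' m, gW m * (KM q * gN m * ∫⁻ x, w x ^ q) := by
        gcongr; exact gMm_strong hA d _ hw hq
    _ = _ := by
        have : ∀ m, gW m * (KM q * gN m * ∫⁻ x, w x ^ q) = gW m * gN m * (KM q * ∫⁻ x, w x ^ q) := fun m => by ring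
        simp_rw [this]
        rw [ENNReal.tsum_mul_right]; ring

theorem gE_le_gM {A : ℝ} (d : ℕ) (s : ℤ) (w : ℝ × ℝ → ℝ≥0∞) (x : ℝ × ℝ) :
    gE A d s w x ≤ gM A d w x := by
  refine le_trans ?_ (le_iSup (fun s => ∑' m, gW m * gE A d s w (gT A d s m x)) s)
  refine le_trans ?_ (ENNReal.le_tsum (0 : ℤ × ℤ))
  simp [gW, gw, gT]

theorem gE_sq {A : ℝ} (hA : 0 < A) (d : ℕ) (s : ℤ) {w : ℝ × ℝ → ℝ≥0∞} (hw : Measurable w) (x) :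
    gE A d s w x ^ (2 : ℝ) ≤ gE A d s (fun y => w y ^ (2 : ℝ)) x := by
  set Q := gp A d s ⁻¹' {gp A d s x} with hQ
  have hvol : volume Q = gv A d s := gp_volume hA d s _
  have h0 := gv_ne_zero hA d s
  have ht := gv_ne_top A d s
  have := ENNReal.lintegral_mul_le_Lp_mul_Lq (volume.restrict Q) (p := 2) (q := 2)
    (by constructor <;> norm_num) (f := w) (g := fun _ => 1) hw.aemeasurable aemeasurable_const
  simp only [Pi.mul_apply, mul_one, ENNReal.one_rpow, lintegral_const, Measure.restrict_apply, MeasurableSet.univ,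
    Set.univ_inter, one_mul, hvol] at this
  unfold gE
  rw [ENNReal.mul_rpow_of_nonneg _ _ (by norm_num)]
  calc (gv A d s)⁻¹ ^ (2 : ℝ) * (∫⁻ y in Q, w y) ^ (2 : ℝ) ≤
      (gv A d s)⁻¹ ^ (2 : ℝ) * ((∫⁻ y in Q, w y ^ (2 : ℝ)) ^ (1 / 2 : ℝ) * gv A d s ^ (1 / 2 : ℝ)) ^ (2 : ℝ) := by
        gcongr
    _ = _ := by
        rw [ENNReal.mul_rpow_of_nonneg _ _ (by norm_num), ← ENNReal.rpow_mul, ← ENNReal.rpow_mul]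
        norm_num
        rw [mul_left_comm, ← mul_assoc, mul_comm (∫⁻ y in Q, w y ^ 2), sq, mul_right_comm, mul_assoc _ _ (gv A d s),
          ENNReal.inv_mul_cancel h0 ht, mul_one]

theorem gT_zero (A : ℝ) (d : ℕ) (s : ℤ) (x : ℝ × ℝ) : gT A d s 0 x = x := by simp [gT]
theorem gN_zero : gN 0 = 1 := by simp [gN]

theorem goodlam {A : ℝ} (hA : 0 < A) (d : ℕ) {h Φ : ℝ × ℝ → ℝ≥0∞} (hh : Measurable h)
    (hh2 : ∫⁻ x, h x ^ (2 : ℝ) ≠ ⊤)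
    (hloc : ∀ s m, ∃ (c : ℝ≥0∞) (e : ℝ × ℝ → ℝ≥0∞), Measurable e ∧
      (∀ x, gp A d s x = m → h x ≤ c + e x ∧ c ≤ h x + e x) ∧
      (∀ x, gp A d s x = m → gE A d s e x ≤ Φ x))
    {t ε : ℝ≥0∞} (ht0 : t ≠ 0) (ht : t ≠ ⊤) (hε : ε ≤ 1) :
    volume {x | (∃ s, 3 * t < gE A d s h x) ∧ Φ x ≤ ε * t} ≤
      ε * ENNReal.ofReal (2 * 2 ^ d) * volume {x | ∃ s, t < gE A d s h x} := by
  have hb : ∃ s0 : ℤ, ∀ s < s0, ∀ x, gE A d s h x ≤ t := by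
    obtain ⟨s0, hs0⟩ := gE_low hA d (t := t ^ (2 : ℝ)) (by simpa using ht0) hh2
    refine ⟨s0, fun s hs x => ?_⟩
    exact (ENNReal.rpow_le_rpow_iff (by norm_num : (0 : ℝ) < 2)).1 ((gE_sq hA d s hh x).trans (hs0 s hs x))
  set G := {x | (∃ s, 3 * t < gE A d s h x) ∧ Φ x ≤ ε * t} with hG
  have hcell : ∀ s, ∀ m ∈ gp A d s '' gS A d h t s,
      volume (G ∩ gp A d s ⁻¹' {m}) ≤ ε * ENNReal.ofReal (2 * 2 ^ d) * volume (gp A d s ⁻¹' {m}) := by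
    intro s m hm
    rcases (G ∩ gp A d s ⁻¹' {m}).eq_empty_or_nonempty with hemp | ⟨x0, hx0, hx0m⟩
    · rw [hemp]; simp
    obtain ⟨x1, hx1, hx1m⟩ := hm
    rw [Set.mem_preimage, Set.mem_singleton_iff] at hx0m
    have hx0S : x0 ∈ gS A d h t s := gS_congr (hx1m.trans hx0m.symm) hx1
    obtain ⟨c, e, hem, hce, heΦ⟩ := hloc (s - 1) (gp A d (s - 1) x0)
    set Q := gp A d (s - 1) ⁻¹' {gp A d (s - 1) x0} with hQ
    have hQm : MeasurableSet Q := gp_meas_set _ _ _ _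
    have hv0 := gv_ne_zero hA d (s - 1)
    have hvt := gv_ne_top A d (s - 1)
    have he : gE A d (s - 1) e x0 ≤ ε * t := (heΦ x0 rfl).trans hx0.2
    have hc : c ≤ 2 * t := by
      have h1 : c = gE A d (s - 1) (fun _ => c) x0 := by
        have := gE_add_const_le hA d (s - 1) (fun _ => 0) c x0
        simp only [add_zero] at this
        rw [this]; simp [gE]
      have h2 : gE A d (s - 1) (fun _ => c) x0 ≤ gE A d (s - 1) h x0 + gE A d (s - 1) e x0 := by
        unfold gE
        rw [← mul_add, ← lintegral_add_left hh]
        gcongr (gv A d (s - 1))⁻¹ * ?_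
        exact setLIntegral_mono' hQm (fun x hx => (hce x hx).2)
      rw [h1, two_mul]
      refine h2.trans (add_le_add (hx0S.2 _ (by omega)) (he.trans ?_))
      exact mul_le_of_le_one_left zero_le hε
    have hsub : G ∩ gp A d s ⁻¹' {m} ⊆ {x | ∃ s, t < gE A d s (Q.indicator e) (gT A d s 0 x)} := by
      rintro x ⟨⟨⟨s', hs'⟩, _⟩, hxm⟩
      rw [Set.mem_preimage, Set.mem_singleton_iff] at hxm
      have hxS : x ∈ gS A d h t s := gS_congr (hx1m.trans hxm.symm) hx1
      have hss : s ≤ s' := by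
        by_contra hlt
        have h1 := hxS.2 s' (by omega)
        have : t ≤ 3 * t := le_mul_of_one_le_left zero_le (by norm_num)
        exact absurd hs' (not_lt.2 (h1.trans this))
      refine ⟨s', ?_⟩
      rw [gT_zero]
      have h1 : gE A d s' h x ≤ c + gE A d s' (Q.indicator e) x := by
        rw [← gE_add_const_le hA]
        unfold gE
        gcongr (gv A d s')⁻¹ * ?_
        refine setLIntegral_mono' (gp_meas_set _ _ _ _) (fun y hy => ?_)
        have hyQ : y ∈ Q := by
          rw [hQ, Set.mem_preimage, Set.mem_singleton_iff]
          rw [Set.mem_preimage, Set.mem_singleton_iff] at hy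
          rw [gp_nest A d (show s - 1 ≤ s' by omega) hy]
          exact gp_nest A d (show s - 1 ≤ s by omega) (hxm.trans hx0m.symm)
        rw [Set.indicator_of_mem hyQ]
        exact (hce y hyQ).1
      by_contra hcon
      rw [not_lt] at hcon
      have : gE A d s' h x ≤ 3 * t := by
        calc _ ≤ 2 * t + t := h1.trans (add_le_add hc hcon)
          _ = 3 * t := by ring
      exact absurd hs' (not_lt.2 this)
    have hwk := gweak hA d (Q.indicator e) ht0 0
    rw [gN_zero, one_mul, lintegral_indicator hQm] at hwk
    have hint : ∫⁻ y in Q, e y ≤ gv A d (s - 1) * (ε * t) := by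
      have : ∫⁻ y in Q, e y = gv A d (s - 1) * gE A d (s - 1) e x0 := by
        rw [gE, ← mul_assoc, ENNReal.mul_inv_cancel hv0 hvt, one_mul]
      rw [this]; gcongr
    rw [gp_volume hA]
    have hfin : t * volume (G ∩ gp A d s ⁻¹' {m}) ≤ t * (ε * ENNReal.ofReal (2 * 2 ^ d) * gv A d s) := by
      calc _ ≤ t * volume {x | ∃ s, t < gE A d s (Q.indicator e) (gT A d s 0 x)} := by gcongr
        _ ≤ _ := hwk.trans hint
        _ = _ := by rw [gv_step hA]; ring
    exact (ENNReal.mul_le_mul_iff_right ht0 ht).1 hfin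
  have hGsub : G ⊆ ⋃ s, G ∩ gS A d h t s := by
    intro x hx
    obtain ⟨s, hs⟩ := hx.1
    have : t ≤ 3 * t := le_mul_of_one_le_left zero_le (by norm_num)
    obtain ⟨s', _, h'⟩ := gS_exists hb (this.trans_lt hs)
    exact Set.mem_iUnion.2 ⟨s', hx, h'⟩
  calc volume G ≤ volume (⋃ s, G ∩ gS A d h t s) := measure_mono hGsub
    _ ≤ ∑' s, volume (G ∩ gS A d h t s) := measure_iUnion_le _
    _ ≤ ∑' s, ε * ENNReal.ofReal (2 * 2 ^ d) * volume (gS A d h t s) := by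
        apply ENNReal.tsum_le_tsum
        intro s
        have e1 : G ∩ gS A d h t s ⊆ ⋃ m : (gp A d s '' gS A d h t s), G ∩ gp A d s ⁻¹' {(m : ℤ × ℤ)} := by
          rintro x ⟨hx, hx'⟩
          exact Set.mem_iUnion.2 ⟨⟨gp A d s x, x, hx', rfl⟩, hx, rfl⟩
        have e2 := lintegral_cells A d s (gp A d s '' gS A d h t s) (fun _ => 1)
        simp only [setLIntegral_one, gS_sat] at e2
        rw [e2, ← ENNReal.tsum_mul_left]
        refine (measure_mono e1).trans ((measure_iUnion_le _).trans ?_)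
        exact ENNReal.tsum_le_tsum fun m => hcell s m m.2
    _ = _ := by
        rw [ENNReal.tsum_mul_left, gS_iUnion hb, measure_iUnion (gS_disj A d h t) (gS_meas A d h t)]

theorem FS {p : ℝ} (hp : 2 < p) (d : ℕ) : ∃ C : ℝ≥0∞, C ≠ ⊤ ∧ ∀ {A : ℝ} (_hA : 0 < A)
    {h Φ : ℝ × ℝ → ℝ≥0∞} (_hh : Measurable h) (_hΦ : Measurable Φ)
    (_hh2 : ∫⁻ x, h x ^ (2 : ℝ) ≠ ⊤)
    (_hlsc : ∀ x, h x ≤ ⨆ s, gE A d s h x)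
    (_hloc : ∀ s m, ∃ (c : ℝ≥0∞) (e : ℝ × ℝ → ℝ≥0∞), Measurable e ∧
      (∀ x, gp A d s x = m → h x ≤ c + e x ∧ c ≤ h x + e x) ∧
      (∀ x, gp A d s x = m → gE A d s e x ≤ Φ x)),
    ∫⁻ x, h x ^ p ≤ C * ∫⁻ x, Φ x ^ p := by
  have hp0 : 0 < p := by linarith
  set D : ℝ := 3 ^ p * (2 * 2 ^ d) with hD
  have hDpos : 1 ≤ D := by
    have h1 : (1 : ℝ) ≤ 3 ^ p := Real.one_le_rpow (by norm_num) hp0.le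
    have h2 : (1 : ℝ) ≤ 2 ^ d := one_le_pow₀ (by norm_num)
    rw [hD]; nlinarith
  set ε : ℝ := 1 / (2 * D) with hεd
  have hε0 : 0 < ε := by positivity
  have hε1 : ε ≤ 1 := by rw [hεd, div_le_one (by positivity)]; linarith
  refine ⟨2 * (3 ^ p * (ENNReal.ofReal ε)⁻¹ ^ p), ?_, ?_⟩
  · refine ENNReal.mul_ne_top (by simp) (ENNReal.mul_ne_top ?_ ?_)
    · exact ENNReal.rpow_ne_top_of_nonneg hp0.le (by simp)
    · exact ENNReal.rpow_ne_top_of_nonneg hp0.le (by simpa using hε0)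
  intro A hA h Φ hh hΦ hh2 hlsc hloc
  set H := gMm A d 0 h with hH
  have hHm : Measurable H := gMm_meas _ _ _ _
  have hHlt : ∀ (t : ℝ≥0∞) x, t < H x ↔ ∃ s, t < gE A d s h x := by
    intro t x; rw [hH, gMm, lt_iSup_iff]; simp_rw [gT_zero]
  have hH2 : ∫⁻ x, H x ^ (2 : ℝ) ≠ ⊤ := by
    refine ne_top_of_le_ne_top ?_ (gMm_strong hA d 0 hh (by norm_num : (1 : ℝ) < 2))
    rw [gN_zero, mul_one]
    exact ENNReal.mul_ne_top (KM_ne_top (by norm_num)) hh2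
  set J := ∫⁻ x, (Φ x) ^ p with hJ
  have main : ∀ n : ℕ, ∫⁻ x, (min (H x) n) ^ p ≤ 2 * (3 ^ p * (ENNReal.ofReal ε)⁻¹ ^ p) * J := by
    intro n
    set a := ∫⁻ x, (min (H x) n) ^ p with ha
    have hafin : a ≠ ⊤ := by
      have : ∀ x, (min (H x) n) ^ p ≤ (n : ℝ≥0∞) ^ (p - 2) * H x ^ (2 : ℝ) := by
        intro x
        rw [show p = (p - 2) + 2 by ring, ENNReal.rpow_add_of_nonneg _ _ (by linarith) (by norm_num)]
        rw [show p - 2 + 2 - 2 = p - 2 by ring]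
        have : 0 ≤ p - 2 := by linarith
        gcongr
        · exact min_le_right _ _
        · exact min_le_left _ _
      have hn : (n : ℝ≥0∞) ^ (p - 2) ≠ ⊤ := ENNReal.rpow_ne_top_of_nonneg (by linarith) (by simp)
      refine ne_top_of_le_ne_top ?_ (lintegral_mono this)
      rw [lintegral_const_mul' _ _ hn]
      exact ENNReal.mul_ne_top hn hH2
    set H3 : ℝ × ℝ → ℝ≥0∞ := fun x => min (H x / 3) n with hH3
    have hH3m : Measurable H3 := by fun_prop
    have hΦm : Measurable (fun x => (ENNReal.ofReal ε)⁻¹ * Φ x) := by fun_prop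
    have step1 : a ≤ 3 ^ p * ∫⁻ x, H3 x ^ p := by
      rw [← lintegral_const_mul' _ _ (ENNReal.rpow_ne_top_of_nonneg hp0.le (by simp))]
      apply lintegral_mono
      intro x
      dsimp only
      rw [← ENNReal.mul_rpow_of_nonneg _ _ hp0.le]
      gcongr
      rw [hH3]
      rcases le_total (H x / 3) n with h' | h'
      · simp only [min_eq_left h']
        rw [ENNReal.mul_div_cancel (by simp) (by simp)]
        exact min_le_left _ _
      · simp only [min_eq_right h']
        exact (min_le_right _ _).trans (le_mul_of_one_le_left zero_le (by norm_num))
    have step2 : ∫⁻ x, H3 x ^ p ≤ ENNReal.ofReal (ε * (2 * 2 ^ d)) * a + (ENNReal.ofReal ε)⁻¹ ^ p * J := by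
      have e1 : (ENNReal.ofReal ε)⁻¹ ^ p * J = ∫⁻ x, ((ENNReal.ofReal ε)⁻¹ * Φ x) ^ p := by
        rw [hJ, ← lintegral_const_mul _ (hΦ.pow_const p)]
        congr 1; ext x; rw [ENNReal.mul_rpow_of_nonneg _ _ hp0.le]
      rw [e1, ha, layercake _ hp0 hH3m, layercake _ hp0 (show Measurable fun x => min (H x) (n : ℝ≥0∞) by fun_prop), layercake _ hp0 hΦm]
      rw [mul_left_comm, ← mul_add]
      gcongr ENNReal.ofReal p * ?_
      rw [← lintegral_const_mul' _ _ ENNReal.ofReal_ne_top, ← lintegral_add_right']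
      · refine setLIntegral_mono' measurableSet_Ioi (fun t ht => ?_)
        rw [Set.mem_Ioi] at ht
        rw [mul_left_comm, ← mul_add]
        gcongr ENNReal.ofReal _ * ?_
        by_cases htn : ENNReal.ofReal t < n
        · have g := goodlam hA d (Φ := Φ) hh hh2 hloc (t := ENNReal.ofReal t) (ε := ENNReal.ofReal ε)
            (by simpa using ht) ENNReal.ofReal_ne_top (by simpa using hε1)
          have e2 : {x | ENNReal.ofReal t < min (H x) (n : ℝ≥0∞)} = {x | ∃ s, ENNReal.ofReal t < gE A d s h x} := by
            ext x; simp only [Set.mem_ofPred_eq, lt_min_iff, htn, and_true]; exact hHlt _ _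
          rw [e2, ENNReal.ofReal_mul hε0.le]
          have e3 : {x | ENNReal.ofReal t < H3 x} ⊆ {x | (∃ s, 3 * ENNReal.ofReal t < gE A d s h x) ∧ Φ x ≤ ENNReal.ofReal ε * ENNReal.ofReal t} ∪
              {x | ENNReal.ofReal t < (ENNReal.ofReal ε)⁻¹ * Φ x} := by
            intro x hx
            by_cases hx' : Φ x ≤ ENNReal.ofReal ε * ENNReal.ofReal t
            · left
              refine ⟨?_, hx'⟩
              rw [← hHlt]
              have hx2 : ENNReal.ofReal t < min (H x / 3) n := hx
              have := (lt_min_iff.1 hx2).1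
              rw [ENNReal.lt_div_iff_mul_lt (by simp) (by simp)] at this
              rwa [mul_comm]
            · right
              rw [not_le, mul_comm] at hx'
              rw [Set.mem_ofPred_eq, mul_comm, ← div_eq_mul_inv, ENNReal.lt_div_iff_mul_lt (by simpa using hε0) (by simp)]
              exact hx'
          exact (measure_mono e3).trans ((measure_union_le _ _).trans (add_le_add g le_rfl))
        · have : {x | ENNReal.ofReal t < H3 x} = ∅ := by
            ext x
            simp only [Set.mem_ofPred_eq, Set.mem_empty_iff_false, iff_false, not_lt]
            exact (min_le_right _ _).trans (not_lt.1 htn)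
          rw [this]; simp
      · apply Measurable.aemeasurable
        apply Measurable.mul (by fun_prop)
        have : Antitone (fun t : ℝ => volume {x | ENNReal.ofReal t < (ENNReal.ofReal ε)⁻¹ * Φ x}) := by
          intro t t' htt
          apply measure_mono
          intro x hx
          exact (ENNReal.ofReal_le_ofReal htt).trans_lt hx
        exact this.measurable
    have step3 : a ≤ a / 2 + 3 ^ p * ((ENNReal.ofReal ε)⁻¹ ^ p * J) := by
      calc a ≤ 3 ^ p * (ENNReal.ofReal (ε * (2 * 2 ^ d)) * a + (ENNReal.ofReal ε)⁻¹ ^ p * J) := step1.trans (by gcongr)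
        _ = (3 ^ p * ENNReal.ofReal (ε * (2 * 2 ^ d))) * a + 3 ^ p * ((ENNReal.ofReal ε)⁻¹ ^ p * J) := by ring
        _ = _ := by
          congr 1
          have : (3 : ℝ≥0∞) ^ p * ENNReal.ofReal (ε * (2 * 2 ^ d)) = 2⁻¹ := by
            rw [show (3 : ℝ≥0∞) = ENNReal.ofReal 3 by simp, ENNReal.ofReal_rpow_of_nonneg (by norm_num) hp0.le, ← ENNReal.ofReal_mul (by positivity),
              show (2 : ℝ≥0∞)⁻¹ = ENNReal.ofReal (2⁻¹) by rw [ENNReal.ofReal_inv_of_pos (by norm_num)]; simp]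
            congr 1
            rw [hεd, hD]; field_simp
          rw [this, mul_comm, div_eq_mul_inv]
    have ha2 : a / 2 ≤ 3 ^ p * ((ENNReal.ofReal ε)⁻¹ ^ p * J) := by
      have hfin2 : a / 2 ≠ ⊤ := ENNReal.div_ne_top hafin (by simp)
      have : a / 2 + a / 2 ≤ a / 2 + 3 ^ p * ((ENNReal.ofReal ε)⁻¹ ^ p * J) := by rwa [ENNReal.add_halves]
      exact (ENNReal.add_le_add_iff_left hfin2).1 this
    calc a = a / 2 + a / 2 := (ENNReal.add_halves a).symm
      _ ≤ _ := add_le_add ha2 ha2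
      _ = _ := by ring
  have hlim : ∀ x, h x ^ p ≤ ⨆ n : ℕ, (min (H x) n) ^ p := by
    intro x
    have h1 : h x ≤ H x := by
      refine (hlsc x).trans (le_of_eq ?_)
      rw [hH, gMm]; simp_rw [gT_zero]
    refine (ENNReal.rpow_le_rpow h1 hp0.le).trans ?_
    have : Tendsto (fun n : ℕ => (min (H x) (n : ℝ≥0∞)) ^ p) atTop (nhds ((min (H x) ⊤) ^ p)) :=
      (ENNReal.continuous_rpow_const.tendsto _).comp (tendsto_const_nhds.min ENNReal.tendsto_nat_nhds_top)
    rw [min_top_right] at this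
    exact le_of_tendsto' this (fun n => le_iSup (fun n : ℕ => (min (H x) (n : ℝ≥0∞)) ^ p) n)
  calc _ ≤ ∫⁻ x, ⨆ n : ℕ, (min (H x) n) ^ p := lintegral_mono hlim
    _ = ⨆ n : ℕ, ∫⁻ x, (min (H x) n) ^ p := by
        apply lintegral_iSup
        · intro n; fun_prop
        · intro n n' hnn x
          dsimp only
          gcongr
    _ ≤ _ := iSup_le main

noncomputable def gk (A : ℝ) (d : ℕ) (s : ℤ) (x y : ℝ × ℝ) : ℝ :=
  1 + gX A s * |x.1 - y.1| + gY d s * |x.2 - y.2|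
noncomputable def gK (A : ℝ) (d : ℕ) (s : ℤ) (w : ℝ × ℝ → ℝ≥0∞) (x : ℝ × ℝ) : ℝ≥0∞ :=
  (gv A d s)⁻¹ * ∫⁻ y, ENNReal.ofReal ((gk A d s x y)⁻¹ ^ 6) * w y

theorem gk_one_le {A : ℝ} (hA : 0 < A) (d : ℕ) (s : ℤ) (x y) : 1 ≤ gk A d s x y := by
  have h1 := gX_pos hA s
  have h2 := gY_pos d s
  unfold gk
  have : 0 ≤ gX A s * |x.1 - y.1| := by positivity
  have : 0 ≤ gY d s * |x.2 - y.2| := by positivity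
  linarith

theorem floor_far {c : ℝ} (hc : 0 < c) {a b : ℝ} {m : ℤ} (h : ⌊c * b⌋ = ⌊c * a⌋ + m) :
    1 + |(m : ℝ)| ≤ 2 * (1 + c * |a - b|) := by
  have e : c * |a - b| = |c * a - c * b| := by rw [← mul_sub, abs_mul, abs_of_pos hc]
  rw [e]
  have h1 := Int.floor_le (c * b)
  have h2 := Int.lt_floor_add_one (c * b)
  have h3 := Int.floor_le (c * a)
  have h4 := Int.lt_floor_add_one (c * a)
  have h5 : ((⌊c * b⌋ : ℤ) : ℝ) = ⌊c * a⌋ + m := by rw [h]; push_cast; ring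
  have h6 : |(m : ℝ)| ≤ |c * a - c * b| + 1 := by
    rcases abs_cases (c * a - c * b) with h | h <;> rcases abs_cases (m : ℝ) with h' | h' <;> linarith
  have := abs_nonneg (c * a - c * b)
  linarith

theorem kpt {a b R m n : ℝ} (ha : 0 ≤ a) (hb : 0 ≤ b) (hR : 0 < R) (hm : 0 < m) (hn : 0 < n)
    (h1 : m ≤ 2 * (1 + a)) (h2 : n ≤ 2 * (1 + b)) (h3 : R ≤ 1 + a + b) :
    (1 + a + b)⁻¹ ^ 6 ≤ R⁻¹ * 32 * (m ^ (-(5 / 2) : ℝ) * n ^ (-(5 / 2) : ℝ)) := by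
  have h4 : (1 + a + b)⁻¹ ^ 6 ≤ R⁻¹ * (1 + a + b)⁻¹ ^ 5 := by
    rw [pow_succ' _ 5]; gcongr
  have e : (1 + a + b)⁻¹ ^ 5 = (1 + a + b) ^ (-(5 / 2) : ℝ) * (1 + a + b) ^ (-(5 / 2) : ℝ) := by
    rw [← Real.rpow_add (by positivity)]; norm_num
  have h5 : ∀ {x y : ℝ}, 0 < y → 0 ≤ x → y ≤ 2 * (1 + a + b) → (1 + a + b) ^ (-(5 / 2) : ℝ) ≤ 2 ^ (5 / 2 : ℝ) * y ^ (-(5 / 2) : ℝ) := by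
    intro x y hy hx hxy
    have : (1 + a + b) ^ (-(5 / 2) : ℝ) ≤ (y / 2) ^ (-(5 / 2) : ℝ) :=
      Real.rpow_le_rpow_of_nonpos (by positivity) (by linarith) (by norm_num)
    refine this.trans (le_of_eq ?_)
    rw [Real.div_rpow hy.le (by norm_num), Real.rpow_neg (x := 2) (by norm_num)]; field_simp
  have e2 : (2 : ℝ) ^ (5 / 2 : ℝ) * 2 ^ (5 / 2 : ℝ) = 32 := by
    rw [← Real.rpow_add (by norm_num)]; norm_num
  calc _ ≤ R⁻¹ * (1 + a + b)⁻¹ ^ 5 := h4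
    _ ≤ R⁻¹ * ((2 ^ (5 / 2 : ℝ) * m ^ (-(5 / 2) : ℝ)) * (2 ^ (5 / 2 : ℝ) * n ^ (-(5 / 2) : ℝ))) := by
        rw [e]
        gcongr
        · exact h5 hm ha (by linarith)
        · exact h5 hn hb (by linarith)
    _ = R⁻¹ * (2 ^ (5 / 2 : ℝ) * 2 ^ (5 / 2 : ℝ)) * (m ^ (-(5 / 2) : ℝ) * n ^ (-(5 / 2) : ℝ)) := by ring
    _ = _ := by rw [e2]

theorem gK_le {A : ℝ} (hA : 0 < A) (d : ℕ) (s : ℤ) (w : ℝ × ℝ → ℝ≥0∞) (x : ℝ × ℝ) {R : ℝ} (hR : 0 < R)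
    (hw : ∀ y, w y ≠ 0 → R ≤ gk A d s x y) :
    gK A d s w x ≤ ENNReal.ofReal (R⁻¹ * 32) * gM A d w x := by
  have h0 : ∫⁻ y, ENNReal.ofReal ((gk A d s x y)⁻¹ ^ 6) * w y =
      ∑' m : ℤ × ℤ, ∫⁻ y in gp A d s ⁻¹' {gp A d s (gT A d s m x)}, ENNReal.ofReal ((gk A d s x y)⁻¹ ^ 6) * w y := by
    have := lintegral_cells A d s Set.univ (fun y => ENNReal.ofReal ((gk A d s x y)⁻¹ ^ 6) * w y)
    rw [Set.preimage_univ, Measure.restrict_univ, tsum_univ (fun m : ℤ × ℤ => ∫⁻ y in gp A d s ⁻¹' {m}, ENNReal.ofReal ((gk A d s x y)⁻¹ ^ 6) * w y)] at this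
    rw [this, ← (Equiv.addLeft (gp A d s x)).tsum_eq]
    simp only [gp_gT hA, Equiv.coe_addLeft]
  unfold gK gM
  rw [h0]
  refine le_trans ?_ (mul_le_mul_right (le_iSup (fun s => ∑' m, gW m * gE A d s w (gT A d s m x)) s) _)
  rw [← ENNReal.tsum_mul_left, ← ENNReal.tsum_mul_left]
  apply ENNReal.tsum_le_tsum
  intro m
  unfold gE
  rw [mul_left_comm (gW m), mul_left_comm _ ((gv A d s)⁻¹)]
  gcongr
  rw [← lintegral_const_mul' _ _ (by unfold gW gw; exact ENNReal.mul_ne_top (by simp) (by simp)),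
    ← lintegral_const_mul' _ _ (by simp)]
  refine setLIntegral_mono' (gp_meas_set _ _ _ _) (fun y hy => ?_)
  rw [Set.mem_preimage, Set.mem_singleton_iff, gp_gT hA] at hy
  by_cases hy0 : w y = 0
  · simp [hy0]
  rw [← mul_assoc]
  gcongr
  unfold gW gw
  rw [← ENNReal.ofReal_mul (by positivity), ← ENNReal.ofReal_mul (by positivity)]
  apply ENNReal.ofReal_le_ofReal
  have h1 := gX_pos hA s
  have h2 := gY_pos d s
  exact kpt (by positivity) (by positivity) hR (by positivity) (by positivity)
    (floor_far h1 (congrArg Prod.fst hy)) (floor_far h2 (congrArg Prod.snd hy)) (hw y hy0)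

theorem gK_le1 {A : ℝ} (hA : 0 < A) (d : ℕ) (s : ℤ) (w : ℝ × ℝ → ℝ≥0∞) (x : ℝ × ℝ) :
    gK A d s w x ≤ 32 * gM A d w x := by
  have := gK_le hA d s w x one_pos (fun y _ => gk_one_le hA d s x y)
  simpa using this

theorem gM_mono {A : ℝ} (d : ℕ) {w w' : ℝ × ℝ → ℝ≥0∞} (h : ∀ x, w x ≤ w' x) (x) :
    gM A d w x ≤ gM A d w' x := by
  unfold gM
  refine iSup_mono fun s => ENNReal.tsum_le_tsum fun m => ?_
  gcongr
  exact gE_mono _ _ _ h _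

structure OpFam (A : ℝ) (d : ℕ) (σ : ℤ → ℤ) (B F G : ℝ)
    (S : ℤ → SchwartzMap (ℝ × ℝ) ℂ → ℝ × ℝ → ℝ≥0∞) : Prop where
  sub : ∀ k f g x, S k f x ≤ S k g x + S k (f - g) x
  lsc : ∀ k f, LowerSemicontinuous (S k f)
  linf : ∀ k (f : SchwartzMap (ℝ × ℝ) ℂ) (M : ℝ), 0 ≤ M → (∀ x, ‖f x‖ ≤ M) →
    ∀ᵐ x, S k f x ≤ ENNReal.ofReal (F * M)
  l2 : ∀ f : SchwartzMap (ℝ × ℝ) ℂ, ∑' k, ∫⁻ x, S k f x ^ (2 : ℝ) ≤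
    ENNReal.ofReal (B * F ^ 2) * ∫⁻ x, ‖f x‖ₑ ^ (2 : ℝ)
  ker : ∀ k (f : SchwartzMap (ℝ × ℝ) ℂ) x, S k f x ≤
    ENNReal.ofReal (B * G) * gK A d (σ k) (fun y => ‖f y‖ₑ) x
  osc : ∀ k (f : SchwartzMap (ℝ × ℝ) ℂ) j x x', σ k ≤ j → gp A d j x = gp A d j x' →
    S k f x ≤ S k f x' + ENNReal.ofReal (B * G * 2 ^ (-(j - σ k))) * gK A d (σ k) (fun y => ‖f y‖ₑ) x ∧
    S k f x' ≤ S k f x + ENNReal.ofReal (B * G * 2 ^ (-(j - σ k))) * gK A d (σ k) (fun y => ‖f y‖ₑ) x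

theorem schwartz_trunc (f : SchwartzMap (ℝ × ℝ) ℂ) {t : ℝ} (ht : 0 < t) :
    ∃ g : SchwartzMap (ℝ × ℝ) ℂ, (∀ x, ‖g x‖ ≤ ‖f x‖) ∧ (∀ x, ‖f x‖ ≤ t → g x = 0) ∧
      ∀ x, ‖(f - g) x‖ ≤ 2 * t := by
  set θ : ℝ × ℝ → ℝ := fun x => Real.smoothTransition (‖f x‖ ^ 2 / t ^ 2 - 1) with hθ
  have hsm : ContDiff ℝ (⊤ : ℕ∞) (fun x => (θ x : ℂ) * f x) := by
    apply ContDiff.mul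
    · refine Complex.ofRealCLM.contDiff.comp ?_
      refine Real.smoothTransition.contDiff.comp ?_
      have := f.smooth ⊤
      exact ((this.norm_sq ℝ).div_const _).sub contDiff_const
    · exact f.smooth ⊤
  have hz : ∀ x, ‖f x‖ ≤ t → θ x = 0 := by
    intro x hx
    apply Real.smoothTransition.zero_of_nonpos
    rw [sub_nonpos, div_le_one (by positivity)]
    gcongr
  have hcs : HasCompactSupport (fun x => (θ x : ℂ) * f x) := by
    have h0 : Tendsto (fun x => ‖f x‖) (cocompact (ℝ × ℝ)) (nhds 0) := by
      have := (f.toZeroAtInfty).zero_at_infty'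
      simpa using this.norm
    have h1 := (h0.eventually (gt_mem_nhds ht))
    rw [Filter.eventually_iff, Filter.mem_cocompact] at h1
    obtain ⟨K, hK, hK'⟩ := h1
    refine HasCompactSupport.intro hK (fun x hx => ?_)
    have : ‖f x‖ < t := hK' hx
    rw [hz x this.le]; simp
  have h01 : ∀ x, 0 ≤ θ x ∧ θ x ≤ 1 := fun x => ⟨Real.smoothTransition.nonneg _, Real.smoothTransition.le_one _⟩
  refine ⟨hcs.toSchwartzMap hsm, fun x => ?_, fun x hx => ?_, fun x => ?_⟩
  · rw [HasCompactSupport.toSchwartzMap_toFun, norm_mul, Complex.norm_real, Real.norm_of_nonneg (h01 x).1]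
    exact mul_le_of_le_one_left (norm_nonneg _) (h01 x).2
  · rw [HasCompactSupport.toSchwartzMap_toFun, hz x hx]; simp
  · rw [_root_.sub_apply, HasCompactSupport.toSchwartzMap_toFun]
    rcases le_total (‖f x‖) (2 * t) with h | h
    · have e : f x - θ x * f x = ((1 - θ x : ℝ) : ℂ) * f x := by push_cast; ring
      rw [e, norm_mul, Complex.norm_real, Real.norm_of_nonneg (by linarith [(h01 x).2])]
      exact (mul_le_of_le_one_left (norm_nonneg _) (by linarith [(h01 x).1])).trans h
    · have : θ x = 1 := by
        apply Real.smoothTransition.one_of_one_le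
        rw [le_sub_iff_add_le, le_div_iff₀ (by positivity)]
        nlinarith
      rw [this]; simp; positivity

theorem interp {p : ℝ} (hp : 2 < p) {A : ℝ} {d : ℕ} {σ : ℤ → ℤ} {B F G : ℝ} (hB : 0 < B) (hF : 0 < F)
    {S : ℤ → SchwartzMap (ℝ × ℝ) ℂ → ℝ × ℝ → ℝ≥0∞} (H : OpFam A d σ B F G S) (f : SchwartzMap (ℝ × ℝ) ℂ) :
    ∑' k, ∫⁻ x, S k f x ^ p ≤ ENNReal.ofReal (p * (4 * B) * (p - 2)⁻¹ * 4 ^ (p - 2)) *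
      (ENNReal.ofReal F ^ p * ∫⁻ x, ‖f x‖ₑ ^ p) := by
  have hSm : ∀ k g, Measurable (S k g) := fun k g => (H.lsc k g).measurable
  have hfm : Measurable (fun x => ‖f x‖ₑ) := f.continuous.enorm.measurable
  have hp0 : 0 < p := by linarith
  have hanti : ∀ k, Measurable (fun t : ℝ => volume {x | ENNReal.ofReal t < S k f x}) := by
    intro k
    apply Antitone.measurable
    intro t t' htt
    apply measure_mono
    intro x hx
    exact (ENNReal.ofReal_le_ofReal htt).trans_lt hx
  have key : ∀ t ∈ Ioi (0 : ℝ), ∑' k, ENNReal.ofReal (t ^ (p - 1)) * volume {x | ENNReal.ofReal t < S k f x} ≤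
      ENNReal.ofReal (4 * (B * F ^ 2)) * (ENNReal.ofReal (t ^ ((p - 2) - 1)) *
        ∫⁻ x in {x | ENNReal.ofReal t < ENNReal.ofReal (4 * F) * ‖f x‖ₑ}, ‖f x‖ₑ ^ (2 : ℝ)) := by
    intro t ht
    rw [Set.mem_Ioi] at ht
    obtain ⟨g, hg1, hg2, hg3⟩ := schwartz_trunc f (show 0 < t / (4 * F) by positivity)
    have h1 : ∀ k, volume {x | ENNReal.ofReal t < S k f x} ≤ ENNReal.ofReal (4 / t ^ 2) * ∫⁻ x, S k g x ^ (2 : ℝ) := by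
      intro k
      have h2 := H.linf k (f - g) (2 * (t / (4 * F))) (by positivity) hg3
      have e : F * (2 * (t / (4 * F))) = t / 2 := by field_simp; norm_num
      rw [e] at h2
      have h3 : volume {x | ENNReal.ofReal t < S k f x} ≤ volume {x | ENNReal.ofReal (t / 2) ≤ S k g x} := by
        apply measure_mono_ae
        filter_upwards [h2] with x hx hx'
        have hx1 : ENNReal.ofReal t < S k f x := hx'
        show ENNReal.ofReal (t / 2) ≤ S k g x
        by_contra hc
        rw [not_le] at hc
        have := (H.sub k f g x).trans (add_le_add hc.le hx)
        rw [← ENNReal.ofReal_add (by positivity) (by positivity), add_halves] at this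
        exact absurd hx1 (not_lt.2 this)
      have h4 : {x | ENNReal.ofReal (t / 2) ≤ S k g x} = {x | ENNReal.ofReal (t / 2) ^ (2 : ℝ) ≤ S k g x ^ (2 : ℝ)} := by
        ext x; simp only [Set.mem_ofPred_eq]
        rw [ENNReal.rpow_le_rpow_iff (by norm_num)]
      rw [h4] at h3
      refine h3.trans ?_
      have hne : ENNReal.ofReal (t / 2) ^ (2 : ℝ) ≠ 0 := by
        rw [ENNReal.ofReal_rpow_of_nonneg (by positivity) (by norm_num)]; simp; positivity
      refine (meas_ge_le_lintegral_div ((hSm k g).pow_const _).aemeasurable hne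
        (ENNReal.rpow_ne_top_of_nonneg (by norm_num) (by simp))).trans ?_
      rw [div_eq_mul_inv, mul_comm, ENNReal.ofReal_rpow_of_nonneg (by positivity) (by norm_num), ← ENNReal.ofReal_inv_of_pos (by positivity)]
      gcongr
      norm_num
      rw [div_pow]; field_simp; norm_num
    have h5 : ∫⁻ x, ‖g x‖ₑ ^ (2 : ℝ) ≤ ∫⁻ x in {x | ENNReal.ofReal t < ENNReal.ofReal (4 * F) * ‖f x‖ₑ}, ‖f x‖ₑ ^ (2 : ℝ) := by
      rw [← lintegral_indicator (measurableSet_lt measurable_const (by fun_prop))]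
      apply lintegral_mono
      intro x
      by_cases hx : ENNReal.ofReal t < ENNReal.ofReal (4 * F) * ‖f x‖ₑ
      · dsimp only
        rw [Set.indicator_of_mem (by exact hx)]
        gcongr
        exact enorm_le_iff_norm_le.2 (hg1 x)
      · have : g x = 0 := by
          apply hg2
          rw [not_lt, ← ofReal_norm, ← ENNReal.ofReal_mul (by positivity), ENNReal.ofReal_le_ofReal_iff ht.le] at hx
          rw [le_div_iff₀ (by positivity)]; linarith
        simp [this]
    rw [ENNReal.tsum_mul_left]
    calc ENNReal.ofReal (t ^ (p - 1)) * ∑' k, volume {x | ENNReal.ofReal t < S k f x} ≤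
        ENNReal.ofReal (t ^ (p - 1)) * (ENNReal.ofReal (4 / t ^ 2) * (ENNReal.ofReal (B * F ^ 2) * 
          ∫⁻ x in {x | ENNReal.ofReal t < ENNReal.ofReal (4 * F) * ‖f x‖ₑ}, ‖f x‖ₑ ^ (2 : ℝ))) := by
          gcongr
          refine (ENNReal.tsum_le_tsum h1).trans ?_
          rw [ENNReal.tsum_mul_left]
          gcongr
          exact (H.l2 g).trans (by gcongr)
      _ = _ := by
          rw [← mul_assoc, ← mul_assoc, ← mul_assoc, ← ENNReal.ofReal_mul (by positivity), ← ENNReal.ofReal_mul (by positivity), ← ENNReal.ofReal_mul (by positivity)]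
          congr 2
          rw [show p - 1 = (p - 2 - 1) + 2 by ring, Real.rpow_add ht]
          norm_num
          field_simp
  calc ∑' k, ∫⁻ x, S k f x ^ p = ENNReal.ofReal p * ∑' k, ∫⁻ t in Ioi (0 : ℝ), ENNReal.ofReal (t ^ (p - 1)) * volume {x | ENNReal.ofReal t < S k f x} := by
        rw [← ENNReal.tsum_mul_left]
        congr 1; ext k
        rw [layercake _ hp0 (hSm k f)]
    _ = ENNReal.ofReal p * ∫⁻ t in Ioi (0 : ℝ), ∑' k, ENNReal.ofReal (t ^ (p - 1)) * volume {x | ENNReal.ofReal t < S k f x} := by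
        rw [lintegral_tsum]
        intro k
        exact (Measurable.mul (by fun_prop) (hanti k)).aemeasurable
    _ ≤ ENNReal.ofReal p * ∫⁻ t in Ioi (0 : ℝ), ENNReal.ofReal (4 * (B * F ^ 2)) * (ENNReal.ofReal (t ^ ((p - 2) - 1)) *
        ∫⁻ x in {x | ENNReal.ofReal t < ENNReal.ofReal (4 * F) * ‖f x‖ₑ}, ‖f x‖ₑ ^ (2 : ℝ)) := by
        gcongr ENNReal.ofReal p * ?_
        exact setLIntegral_mono' measurableSet_Ioi key
    _ = ENNReal.ofReal p * (ENNReal.ofReal (4 * (B * F ^ 2)) * ((ENNReal.ofReal (p - 2))⁻¹ * 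
          ∫⁻ x, ‖f x‖ₑ ^ (2 : ℝ) * (ENNReal.ofReal (4 * F) * ‖f x‖ₑ) ^ (p - 2))) := by
        rw [lintegral_const_mul' _ _ ENNReal.ofReal_ne_top, lcG volume (by linarith) (hfm.pow_const _) (hfm.const_mul _)]
    _ = _ := by
        have e : ∀ x, ‖f x‖ₑ ^ (2 : ℝ) * (ENNReal.ofReal (4 * F) * ‖f x‖ₑ) ^ (p - 2) = ENNReal.ofReal ((4 * F) ^ (p - 2)) * ‖f x‖ₑ ^ p := by
          intro x
          rw [ENNReal.mul_rpow_of_nonneg _ _ (by linarith), mul_left_comm, ← ENNReal.rpow_add_of_nonneg _ _ (by norm_num) (by linarith),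
            ENNReal.ofReal_rpow_of_nonneg (by positivity) (by linarith)]
          congr 2; ring
        simp_rw [e]
        rw [lintegral_const_mul' _ _ (by simp), ← ENNReal.ofReal_inv_of_pos (by linarith), ENNReal.ofReal_rpow_of_nonneg hF.le hp0.le]
        have hp2 : 0 < p - 2 := by linarith
        rw [← mul_assoc, ← mul_assoc, ← mul_assoc, ← ENNReal.ofReal_mul (by positivity), ← ENNReal.ofReal_mul (by positivity), ← ENNReal.ofReal_mul (by positivity),
          ← mul_assoc (ENNReal.ofReal _), ← ENNReal.ofReal_mul (by positivity)]
        congr 2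
        rw [Real.mul_rpow (by norm_num) hF.le]
        have : F ^ p = F ^ (p - 2) * F ^ 2 := by
          rw [← Real.rpow_natCast F 2, ← Real.rpow_add hF]; congr 1; push_cast; ring
        rw [this]; ring

theorem lintegral_shift {A : ℝ} (hA : 0 < A) (d : ℕ) (s : ℤ) (x : ℝ × ℝ) (w : ℝ × ℝ → ℝ≥0∞) :
    ∫⁻ y, w y = ∑' m : ℤ × ℤ, ∫⁻ y in gp A d s ⁻¹' {gp A d s (gT A d s m x)}, w y := by
  have := lintegral_cells A d s Set.univ w
  rw [Set.preimage_univ, Measure.restrict_univ, tsum_univ (fun m : ℤ × ℤ => ∫⁻ y in gp A d s ⁻¹' {m}, w y)] at this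
  rw [this, ← (Equiv.addLeft (gp A d s x)).tsum_eq]
  simp only [gp_gT hA, Equiv.coe_addLeft]

theorem near_int {A : ℝ} (hA : 0 < A) (d : ℕ) (s : ℤ) (x : ℝ × ℝ) (w v : ℝ × ℝ → ℝ≥0∞)
    (h1 : ∀ y, w y ≤ v y) (h2 : ∀ y, w y ≠ 0 → |(gp A d s y).1 - (gp A d s x).1| ≤ 2 ∧ |(gp A d s y).2 - (gp A d s x).2| ≤ 2) :
    (gv A d s)⁻¹ * ∫⁻ y, w y ≤ 243 * gM A d v x := by
  have hw : ∀ n : ℤ, |n| ≤ 2 → ENNReal.ofReal (3 ^ (-(5 / 2) : ℝ)) ≤ gw n := by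
    intro n hn
    unfold gw
    apply ENNReal.ofReal_le_ofReal
    apply Real.rpow_le_rpow_of_nonpos (by positivity) _ (by norm_num)
    have : (|n| : ℝ) ≤ 2 := by exact_mod_cast hn
    linarith
  have hcst : (243 : ℝ≥0∞) * (ENNReal.ofReal (3 ^ (-(5 / 2) : ℝ)) * ENNReal.ofReal (3 ^ (-(5 / 2) : ℝ))) = 1 := by
    rw [← ENNReal.ofReal_mul (by positivity), ← Real.rpow_add (by norm_num), show (243 : ℝ≥0∞) = ENNReal.ofReal 243 by simp, ← ENNReal.ofReal_mul (by norm_num)]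
    norm_num
  rw [lintegral_shift hA d s x]
  unfold gM
  refine le_trans ?_ (mul_le_mul_right (le_iSup (fun s => ∑' m, gW m * gE A d s v (gT A d s m x)) s) _)
  rw [← ENNReal.tsum_mul_left, ← ENNReal.tsum_mul_left]
  apply ENNReal.tsum_le_tsum
  intro m
  by_cases hm : |m.1| ≤ 2 ∧ |m.2| ≤ 2
  · calc _ ≤ 1 * gE A d s v (gT A d s m x) := by
          unfold gE; rw [one_mul]; gcongr; exact h1 _
      _ ≤ (243 * gW m) * gE A d s v (gT A d s m x) := by
          rw [← hcst]; unfold gW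
          gcongr
          · exact hw _ hm.1
          · exact hw _ hm.2
      _ = _ := by ring
  · have : ∫⁻ y in gp A d s ⁻¹' {gp A d s (gT A d s m x)}, w y = 0 := by
      rw [setLIntegral_congr_fun (g := fun _ => 0) (gp_meas_set _ _ _ _), lintegral_zero]
      intro y hy
      by_contra h0
      apply hm
      have := h2 y h0
      rw [Set.mem_preimage, Set.mem_singleton_iff, gp_gT hA] at hy
      rw [hy] at this
      simpa using this
    rw [this]; simp

theorem lsc_gE {A : ℝ} (hA : 0 < A) {d : ℕ} (hd : 1 ≤ d) {h : ℝ × ℝ → ℝ≥0∞} (hh : LowerSemicontinuous h) (x) :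
    h x ≤ ⨆ s, gE A d s h x := by
  apply le_of_forall_lt
  intro t ht
  obtain ⟨t', h1, h2⟩ := exists_between ht
  have hn := hh x t' h2
  obtain ⟨ε, hε, hball⟩ := Metric.eventually_nhds_iff.1 hn
  obtain ⟨n, hn⟩ := exists_pow_lt_of_lt_one (lt_min hε (mul_pos hε hA)) (show (1 / 2 : ℝ) < 1 by norm_num)
  refine h1.trans_le ?_
  refine le_trans ?_ (le_iSup _ (n : ℤ))
  have hc : gE A d n (fun _ => t') x = t' := by
    have := gE_add_const_le hA d n (fun _ => 0) t' x
    simp only [add_zero] at this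
    rw [this]; simp [gE]
  rw [← hc]
  unfold gE
  gcongr (gv A d n)⁻¹ * ?_
  refine setLIntegral_mono' (gp_meas_set _ _ _ _) (fun y hy => (hball ?_).le)
  rw [Set.mem_preimage, Set.mem_singleton_iff] at hy
  have hX := gX_pos hA n
  have hY := gY_pos d n
  have hfl : ∀ {c a b : ℝ}, 0 < c → ⌊c * a⌋ = ⌊c * b⌋ → |a - b| < 1 / c := by
    intro c a b hc hab
    rw [lt_div_iff₀ hc, mul_comm, ← abs_of_pos hc, ← abs_mul, mul_sub]
    exact Int.abs_sub_lt_one_of_floor_eq_floor hab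
  have e1 : 1 / gX A n < ε := by
    have := (lt_min_iff.1 hn).2
    unfold gX
    rw [div_lt_iff₀ (by positivity)]
    rw [div_pow, one_pow, div_lt_iff₀ (by positivity)] at this
    rw [zpow_natCast]; linarith
  have e2 : 1 / gY d n < ε := by
    have := (lt_min_iff.1 hn).1
    unfold gY
    refine lt_of_le_of_lt ?_ this
    rw [div_pow, one_pow, zpow_natCast]
    gcongr
    exact le_self_pow₀ (by norm_num) (by omega)
  rw [Prod.dist_eq, Real.dist_eq, Real.dist_eq]
  exact max_lt ((hfl hX (congrArg Prod.fst hy)).trans e1) ((hfl hY (congrArg Prod.snd hy)).trans e2)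

theorem tail_sum (N : ℕ) : ∑' s : ℤ, (if (N : ℤ) < s then ENNReal.ofReal ((2 : ℝ) ^ (-s)) else 0) ≤ ENNReal.ofReal ((2 : ℝ) ^ (-(N : ℤ))) := by
  have hinj : Function.Injective (fun i : ℕ => (N : ℤ) + 1 + i) := by intro i j h; simpa using h
  rw [← hinj.tsum_eq]
  · have : ∀ i : ℕ, (if (N : ℤ) < (N : ℤ) + 1 + i then ENNReal.ofReal ((2 : ℝ) ^ (-((N : ℤ) + 1 + i))) else 0) =
        ENNReal.ofReal ((2 : ℝ) ^ (-((N : ℤ) + 1))) * (ENNReal.ofReal (1 / 2)) ^ i := by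
      intro i
      rw [if_pos (by omega), ← ENNReal.ofReal_pow (by norm_num), ← ENNReal.ofReal_mul (by positivity)]
      congr 1
      rw [neg_add, zpow_add₀ (by norm_num)]
      simp
    simp_rw [this]
    rw [ENNReal.tsum_mul_left, ENNReal.tsum_geometric]
    have e : (1 : ℝ≥0∞) - ENNReal.ofReal (1 / 2) = ENNReal.ofReal (1 / 2) := by
      rw [← ENNReal.ofReal_one, ← ENNReal.ofReal_sub _ (by norm_num)]; norm_num
    rw [e, ← ENNReal.ofReal_inv_of_pos (by norm_num), ← ENNReal.ofReal_mul (by positivity)]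
    apply ENNReal.ofReal_le_ofReal
    rw [neg_add, zpow_add₀ (by norm_num)]
    norm_num
    apply le_of_eq; ring
  · intro s hs
    rw [Function.mem_support] at hs
    have : (N : ℤ) < s := by by_contra h; simp [h] at hs
    exact ⟨(s - N - 1).toNat, by simp only []; omega⟩

theorem fiber_sum {σ : ℤ → ℤ} {d : ℕ} (hσ : ∀ s (E : Finset ℤ), (E.filter (fun k => σ k = s)).card ≤ d) (E : Finset ℤ) (ψ : ℤ → ℝ≥0∞) :
    ∑ k ∈ E, ψ (σ k) ≤ d * ∑' s, ψ s := by
  rw [← Finset.sum_fiberwise_of_maps_to (t := E.image σ) (g := σ) (fun k hk => Finset.mem_image_of_mem _ hk)]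
  calc _ ≤ ∑ s ∈ E.image σ, d * ψ s := by
        apply Finset.sum_le_sum
        intro s _
        rw [Finset.sum_congr rfl (g := fun _ => ψ s) (by intro k hk; rw [(Finset.mem_filter.1 hk).2]), Finset.sum_const, nsmul_eq_mul]
        gcongr
        exact hσ s E
    _ = d * ∑ s ∈ E.image σ, ψ s := by rw [Finset.mul_sum]
    _ ≤ _ := by gcongr; exact ENNReal.sum_le_tsum _

theorem sq_le_sum {ι : Type*} (E : Finset ι) (a : ι → ℝ≥0∞) : (∑ k ∈ E, a k ^ (2 : ℝ)) ^ (1 / 2 : ℝ) ≤ ∑ k ∈ E, a k := by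
  have : ∑ k ∈ E, a k ^ (2 : ℝ) ≤ (∑ k ∈ E, a k) ^ (2 : ℝ) := by
    simp only [ENNReal.rpow_two]
    rw [sq, Finset.sum_mul]
    apply Finset.sum_le_sum
    intro k hk
    rw [sq]; gcongr; exact Finset.single_le_sum (fun _ _ => zero_le) hk
  calc _ ≤ ((∑ k ∈ E, a k) ^ (2 : ℝ)) ^ (1 / 2 : ℝ) := by gcongr
    _ = _ := by rw [← ENNReal.rpow_mul]; norm_num

theorem sq_add {ι : Type*} (E : Finset ι) (a b c : ι → ℝ≥0∞) (h : ∀ k ∈ E, c k ≤ a k + b k) :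
    (∑ k ∈ E, c k ^ (2 : ℝ)) ^ (1 / 2 : ℝ) ≤ (∑ k ∈ E, a k ^ (2 : ℝ)) ^ (1 / 2 : ℝ) + (∑ k ∈ E, b k ^ (2 : ℝ)) ^ (1 / 2 : ℝ) := by
  refine le_trans ?_ (ENNReal.Lp_add_le E a b (by norm_num))
  gcongr with k hk
  exact h k hk

theorem sq_holder {ι : Type*} (E : Finset ι) (a : ι → ℝ≥0∞) {p : ℝ} (hp : 2 < p) :
    (∑ k ∈ E, a k ^ (2 : ℝ)) ^ (1 / 2 : ℝ) ≤ (E.card : ℝ≥0∞) ^ (1 / 2 - 1 / p) * (∑ k ∈ E, a k ^ p) ^ (1 / p) := by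
  have h1 := ENNReal.rpow_sum_le_const_mul_sum_rpow E (fun k => a k ^ (2 : ℝ)) (p := p / 2) (by linarith)
  have e : ∀ k, (a k ^ (2 : ℝ)) ^ (p / 2) = a k ^ p := by
    intro k; rw [← ENNReal.rpow_mul]; congr 1; ring
  simp_rw [e] at h1
  have h2 := ENNReal.rpow_le_rpow h1 (show 0 ≤ 1 / p by positivity)
  rw [ENNReal.mul_rpow_of_nonneg _ _ (by positivity), ← ENNReal.rpow_mul, ← ENNReal.rpow_mul] at h2
  convert h2 using 2
  · field_simp
  · congr 1; field_simp

noncomputable def bmp : ContDiffBump (1 / 2 : ℝ) := ⟨3 / 2, 5 / 2, by norm_num, by norm_num⟩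

theorem bmp_one {t : ℝ} (h1 : -1 ≤ t) (h2 : t ≤ 2) : bmp t = 1 := by
  apply ContDiffBump.one_of_mem_closedBall
  rw [Metric.mem_closedBall, Real.dist_eq, abs_le]
  show -(3 / 2) ≤ _ ∧ _ ≤ (3 / 2 : ℝ)
  constructor <;> linarith

theorem bmp_ne {t : ℝ} (h : bmp t ≠ 0) : -2 < t ∧ t < 3 := by
  have : t ∈ Function.support bmp := h
  rw [ContDiffBump.support_eq, Metric.mem_ball, Real.dist_eq, abs_lt] at this
  have e : bmp.rOut = 5 / 2 := rfl
  rw [e] at this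
  constructor <;> linarith [this.1, this.2]

theorem floor_bmp {t : ℝ} {m : ℤ} (h : bmp (t - m) ≠ 0) : |⌊t⌋ - m| ≤ 2 := by
  obtain ⟨h1, h2⟩ := bmp_ne h
  rw [abs_le]
  have h3 : m - 2 ≤ ⌊t⌋ := by rw [Int.le_floor]; push_cast; linarith
  have h4 : ⌊t⌋ < m + 3 := by rw [Int.floor_lt]; push_cast; linarith
  constructor <;> omega

theorem far_bmp {c a b : ℝ} (hc : 0 < c) {m : ℤ} (ha : ⌊c * a⌋ = m) (h : bmp (c * b - m) ≠ 1) : 1 ≤ c * |a - b| := by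
  have e : c * |a - b| = |c * a - c * b| := by rw [← mul_sub, abs_mul, abs_of_pos hc]
  rw [e]
  rw [Int.floor_eq_iff] at ha
  by_contra hcon
  rw [not_le, abs_lt] at hcon
  exact h (bmp_one (by linarith [ha.1]) (by linarith [ha.2]))

theorem schwartz_cut (f : SchwartzMap (ℝ × ℝ) ℂ) {A : ℝ} (hA : 0 < A) {d : ℕ} (hd : 1 ≤ d) (j : ℤ) (m : ℤ × ℤ) :
    ∃ g : SchwartzMap (ℝ × ℝ) ℂ, (∀ x, ‖g x‖ ≤ ‖f x‖) ∧ (∀ x, ‖(f - g) x‖ ≤ ‖f x‖) ∧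
      (∀ y, g y ≠ 0 → |(gp A d j y).1 - m.1| ≤ 2 ∧ |(gp A d j y).2 - m.2| ≤ 2) ∧
      ∀ x y, gp A d j x = m → (f - g) y ≠ 0 → ∀ s, j ≤ s → (2 : ℝ) ^ (s - j) ≤ gk A d s x y := by
  have hX := gX_pos hA j
  have hY := gY_pos d j
  set θ : ℝ × ℝ → ℝ := fun x => bmp (gX A j * x.1 - m.1) * bmp (gY d j * x.2 - m.2) with hθ
  have hsm : ContDiff ℝ (⊤ : ℕ∞) (fun x => (θ x : ℂ) * f x) := by
    apply ContDiff.mul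
    · refine Complex.ofRealCLM.contDiff.comp ?_
      apply ContDiff.mul
      · exact bmp.contDiff.comp ((contDiff_const.mul contDiff_fst).sub contDiff_const)
      · exact bmp.contDiff.comp ((contDiff_const.mul contDiff_snd).sub contDiff_const)
    · exact f.smooth ⊤
  have hcs : HasCompactSupport (fun x => (θ x : ℂ) * f x) := by
    refine HasCompactSupport.intro (K := Icc ((m.1 - 2) / gX A j) ((m.1 + 3) / gX A j) ×ˢ Icc ((m.2 - 2) / gY d j) ((m.2 + 3) / gY d j))
      (isCompact_Icc.prod isCompact_Icc) (fun x hx => ?_)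
    by_contra hne
    apply hx
    have h1 : θ x ≠ 0 := by intro h0; rw [h0] at hne; simp at hne
    rw [hθ] at h1
    have h2 := bmp_ne (left_ne_zero_of_mul h1)
    have h3 := bmp_ne (right_ne_zero_of_mul h1)
    rw [Set.mem_prod, Set.mem_Icc, Set.mem_Icc, div_le_iff₀ hX, le_div_iff₀ hX, div_le_iff₀ hY, le_div_iff₀ hY]
    refine ⟨⟨?_, ?_⟩, ?_, ?_⟩ <;> linarith [h2.1, h2.2, h3.1, h3.2]
  have h01 : ∀ x, 0 ≤ θ x ∧ θ x ≤ 1 := fun x =>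
    ⟨mul_nonneg bmp.nonneg bmp.nonneg, mul_le_one₀ bmp.le_one bmp.nonneg bmp.le_one⟩
  have e : ∀ x, f x - θ x * f x = ((1 - θ x : ℝ) : ℂ) * f x := by intro x; push_cast; ring
  refine ⟨hcs.toSchwartzMap hsm, fun x => ?_, fun x => ?_, fun y hy => ?_, fun x y hx hy s hs => ?_⟩
  · rw [HasCompactSupport.toSchwartzMap_toFun, norm_mul, Complex.norm_real, Real.norm_of_nonneg (h01 x).1]
    exact mul_le_of_le_one_left (norm_nonneg _) (h01 x).2
  · rw [_root_.sub_apply, HasCompactSupport.toSchwartzMap_toFun]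
    rw [e, norm_mul, Complex.norm_real, Real.norm_of_nonneg (by linarith [(h01 x).2])]
    exact (mul_le_of_le_one_left (norm_nonneg _) (by linarith [(h01 x).1]))
  · rw [HasCompactSupport.toSchwartzMap_toFun] at hy
    have h1 : θ y ≠ 0 := by intro h0; rw [h0] at hy; simp at hy
    rw [hθ] at h1
    exact ⟨floor_bmp (left_ne_zero_of_mul h1), floor_bmp (right_ne_zero_of_mul h1)⟩
  · rw [_root_.sub_apply, HasCompactSupport.toSchwartzMap_toFun, e] at hy
    have h1 : θ y ≠ 1 := by intro h0; rw [h0] at hy; simp at hy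
    have hX' := gX_pos hA s
    have hY' := gY_pos d s
    have e0 : (2 : ℝ) ^ (s - j) = 2 ^ (s - j).toNat := by
      rw [← zpow_natCast, Int.toNat_of_nonneg (by omega)]
    have hp1 : 0 ≤ gX A s * |x.1 - y.1| := by positivity
    have hp2 : 0 ≤ gY d s * |x.2 - y.2| := by positivity
    unfold gk
    rw [e0]
    by_cases hb : bmp (gX A j * y.1 - m.1) = 1
    · have hb2 : bmp (gY d j * y.2 - m.2) ≠ 1 := by
        intro hb2; apply h1; rw [hθ]; simp [hb, hb2]
      have h2 := far_bmp hY (congrArg Prod.snd hx) hb2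
      have h3 : (2 : ℝ) ^ (s - j).toNat ≤ gY d s * |x.2 - y.2| := by
        rw [gY_shift d hs]; push_cast
        rw [mul_assoc]
        have h4 : (2 : ℝ) ^ (s - j).toNat ≤ (2 ^ d) ^ (s - j).toNat := by
          gcongr; exact le_self_pow₀ (by norm_num) (by omega)
        have h5 : (0 : ℝ) ≤ (2 ^ d) ^ (s - j).toNat := by positivity
        nlinarith
      linarith
    · have h2 := far_bmp hX (congrArg Prod.fst hx) hb
      have h3 : (2 : ℝ) ^ (s - j).toNat ≤ gX A s * |x.1 - y.1| := by
        rw [gX_shift A hs]; push_cast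
        rw [mul_assoc]
        have h5 : (0 : ℝ) ≤ 2 ^ (s - j).toNat := by positivity
        nlinarith
      linarith

theorem local_est {p : ℝ} (hp : 2 < p) {A : ℝ} (hA : 0 < A) {d : ℕ} (hd : 1 ≤ d) {σ : ℤ → ℤ}
    (hσ : ∀ s (E : Finset ℤ), (E.filter (fun k => σ k = s)).card ≤ d) {B F G : ℝ} (hB : 0 < B) (hF : 0 < F) (hG : 0 < G)
    {N : ℕ} (hN : G ≤ F * 2 ^ N)
    {S : ℤ → SchwartzMap (ℝ × ℝ) ℂ → ℝ × ℝ → ℝ≥0∞} (H : OpFam A d σ B F G S) (f : SchwartzMap (ℝ × ℝ) ℂ)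
    (E : Finset ℤ) (j : ℤ) (m : ℤ × ℤ) :
    ∃ (c : ℝ≥0∞) (e : ℝ × ℝ → ℝ≥0∞), Measurable e ∧
      (∀ x, gp A d j x = m → (∑ k ∈ E, S k f x ^ (2 : ℝ)) ^ (1 / 2 : ℝ) ≤ c + e x ∧
        c ≤ (∑ k ∈ E, S k f x ^ (2 : ℝ)) ^ (1 / 2 : ℝ) + e x) ∧
      (∀ x, gp A d j x = m → gE A d j e x ≤ 
        2 * ENNReal.ofReal (32 * B * d * F) * gM A d (gM A d (fun y => ‖f y‖ₑ)) x +
        ((d * (2 * N + 1) : ℕ) : ℝ≥0∞) ^ (1 / 2 - 1 / p) * gM A d (fun y => (∑' k, S k f y ^ p) ^ (1 / p)) x +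
        (ENNReal.ofReal (243 * B * F ^ 2) * gM A d (fun y => ‖f y‖ₑ ^ (2 : ℝ)) x) ^ (1 / 2 : ℝ)) := by
  have hSm : ∀ k g, Measurable (S k g) := fun k g => (H.lsc k g).measurable
  by_cases hne : ∃ xQ, gp A d j xQ = m
  swap
  · refine ⟨0, fun _ => 0, measurable_const, fun x hx => absurd ⟨x, hx⟩ hne, fun x hx => absurd ⟨x, hx⟩ hne⟩
  obtain ⟨xQ, hxQ⟩ := hne
  obtain ⟨g, hg1, hg2, hg3, hg4⟩ := schwartz_cut f hA hd j m
  set L := E.filter (fun k => σ k < j - N) with hL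
  set M := E.filter (fun k => j - N ≤ σ k ∧ σ k ≤ j + N) with hM
  set U := E.filter (fun k => j + N < σ k) with hU
  set D := ENNReal.ofReal (32 * B * d * F) with hD
  set mf := gM A d (fun y => ‖f y‖ₑ) with hmf
  set μ := ((d * (2 * N + 1) : ℕ) : ℝ≥0∞) ^ (1 / 2 - 1 / p) with hμ
  have hmfm : Measurable mf := gM_meas _ _ _
  have hp0 : 0 < p := by linarith
  have hexp : 0 ≤ 1 / 2 - 1 / p := by
    have : 1 / p ≤ 1 / 2 := by gcongr
    linarith
  have hTm : Measurable (fun y => (∑' k, S k f y ^ p) ^ (1 / p)) :=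
    (Measurable.tsum fun k => (hSm k f).pow_const _).pow_const _
  have hDle : ENNReal.ofReal (B * G * 32) * (d * ENNReal.ofReal ((2 : ℝ) ^ (-(N : ℤ)))) ≤ D := by
    rw [hD, show (d : ℝ≥0∞) = ENNReal.ofReal (d : ℝ) by simp, ← ENNReal.ofReal_mul (by positivity), ← ENNReal.ofReal_mul (by positivity)]
    apply ENNReal.ofReal_le_ofReal
    rw [zpow_neg, zpow_natCast]
    calc B * G * 32 * (d * (2 ^ N)⁻¹) ≤ B * (F * 2 ^ N) * 32 * (d * (2 ^ N)⁻¹) := by gcongr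
      _ = _ := by field_simp
  have tailL : ∑ k ∈ L, ENNReal.ofReal ((2 : ℝ) ^ (-(j - σ k))) ≤ d * ENNReal.ofReal ((2 : ℝ) ^ (-(N : ℤ))) := by
    have h1 := fiber_sum hσ L (fun s => if (N : ℤ) < j - s then ENNReal.ofReal ((2 : ℝ) ^ (-(j - s))) else 0)
    have h2 := (Equiv.subLeft j).tsum_eq (fun s : ℤ => if (N : ℤ) < s then ENNReal.ofReal ((2 : ℝ) ^ (-s)) else 0)
    simp only [Equiv.subLeft_apply] at h2
    rw [h2] at h1
    refine le_trans (le_of_eq ?_) (h1.trans (by gcongr; exact tail_sum N))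
    apply Finset.sum_congr rfl
    intro k hk
    have := (Finset.mem_filter.1 hk).2
    rw [if_pos (by omega)]
  have tailU : ∑ k ∈ U, ENNReal.ofReal ((2 : ℝ) ^ (-(σ k - j))) ≤ d * ENNReal.ofReal ((2 : ℝ) ^ (-(N : ℤ))) := by
    have h1 := fiber_sum hσ U (fun s => if (N : ℤ) < s - j then ENNReal.ofReal ((2 : ℝ) ^ (-(s - j))) else 0)
    have h2 := (Equiv.subRight j).tsum_eq (fun s : ℤ => if (N : ℤ) < s then ENNReal.ofReal ((2 : ℝ) ^ (-s)) else 0)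
    simp only [Equiv.subRight_apply] at h2
    rw [h2] at h1
    refine le_trans (le_of_eq ?_) (h1.trans (by gcongr; exact tail_sum N))
    apply Finset.sum_congr rfl
    intro k hk
    have := (Finset.mem_filter.1 hk).2
    rw [if_pos (by omega)]
  have oscsum : ∀ x, (∑ k ∈ L, (ENNReal.ofReal (B * G * 2 ^ (-(j - σ k))) * gK A d (σ k) (fun y => ‖f y‖ₑ) x) ^ (2 : ℝ)) ^ (1 / 2 : ℝ) ≤ D * mf x := by
    intro x
    refine (sq_le_sum _ _).trans ?_
    calc _ ≤ ∑ k ∈ L, (ENNReal.ofReal (B * G * 32) * mf x) * ENNReal.ofReal ((2 : ℝ) ^ (-(j - σ k))) := by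
          apply Finset.sum_le_sum
          intro k _
          calc _ ≤ ENNReal.ofReal (B * G * 2 ^ (-(j - σ k))) * (32 * mf x) := mul_le_mul_right (gK_le1 hA d _ _ x) _
            _ = _ := by
              rw [ENNReal.ofReal_mul (p := B * G) (by positivity), ENNReal.ofReal_mul (p := B * G) (q := 32) (by positivity),
                show ENNReal.ofReal 32 = 32 by simp]
              ring
      _ = (ENNReal.ofReal (B * G * 32) * ∑ k ∈ L, ENNReal.ofReal ((2 : ℝ) ^ (-(j - σ k)))) * mf x := by
          rw [← Finset.mul_sum]; ring
      _ ≤ (ENNReal.ofReal (B * G * 32) * (d * ENNReal.ofReal ((2 : ℝ) ^ (-(N : ℤ))))) * mf x := by gcongr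
      _ ≤ _ := by gcongr
  have farsum : ∀ x, gp A d j x = m → (∑ k ∈ U, S k (f - g) x ^ (2 : ℝ)) ^ (1 / 2 : ℝ) ≤ D * mf x := by
    intro x hx
    refine (sq_le_sum _ _).trans ?_
    calc _ ≤ ∑ k ∈ U, (ENNReal.ofReal (B * G * 32) * mf x) * ENNReal.ofReal ((2 : ℝ) ^ (-(σ k - j))) := by
          apply Finset.sum_le_sum
          intro k hk
          have hk' := (Finset.mem_filter.1 hk).2
          refine (H.ker k (f - g) x).trans ?_
          have h1 := gK_le hA d (σ k) (fun y => ‖(f - g) y‖ₑ) x (R := 2 ^ (σ k - j)) (by positivity)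
            (fun y hy => hg4 x y hx (by simpa using hy) _ (by omega))
          have h2 : gM A d (fun y => ‖(f - g) y‖ₑ) x ≤ mf x := gM_mono d (fun y => enorm_le_iff_norm_le.2 (hg2 y)) x
          calc _ ≤ ENNReal.ofReal (B * G) * (ENNReal.ofReal ((2 ^ (σ k - j))⁻¹ * 32) * mf x) := by gcongr; exact h1.trans (by gcongr)
            _ = _ := by
              rw [ENNReal.ofReal_mul (p := B * G) (q := 32) (by positivity), ENNReal.ofReal_mul (p := (2 ^ (σ k - j))⁻¹) (by positivity), zpow_neg]
              ring
      _ = (ENNReal.ofReal (B * G * 32) * ∑ k ∈ U, ENNReal.ofReal ((2 : ℝ) ^ (-(σ k - j)))) * mf x := by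
          rw [← Finset.mul_sum]; ring
      _ ≤ (ENNReal.ofReal (B * G * 32) * (d * ENNReal.ofReal ((2 : ℝ) ^ (-(N : ℤ))))) * mf x := by gcongr
      _ ≤ _ := by gcongr
  have hcardM : M.card ≤ d * (2 * N + 1) := by
    have h1 := fiber_sum hσ M (fun s => if s ∈ Finset.Icc (j - N) (j + N) then 1 else 0)
    rw [Finset.sum_congr rfl (g := fun _ => (1 : ℝ≥0∞)) (by
      intro k hk
      rw [if_pos]; rw [Finset.mem_Icc]; exact (Finset.mem_filter.1 hk).2)] at h1
    rw [tsum_eq_sum (s := Finset.Icc (j - N) (j + N)) (by intro s hs; rw [if_neg hs]),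
      Finset.sum_congr (s₁ := Finset.Icc (j - N) (j + N)) rfl (f := fun s => if s ∈ Finset.Icc (j - N) (j + N) then (1 : ℝ≥0∞) else 0) (g := fun _ => (1 : ℝ≥0∞)) (by intro k hk; rw [if_pos hk])] at h1
    rw [Finset.sum_const, Finset.sum_const, nsmul_eq_mul, nsmul_eq_mul, mul_one, mul_one, Int.card_Icc] at h1
    have h2 : M.card ≤ d * (j + N + 1 - (j - N)).toNat := by exact_mod_cast h1
    rwa [show (j + N + 1 - (j - N)).toNat = 2 * N + 1 by omega] at h2
  have midsum : ∀ x, (∑ k ∈ M, S k f x ^ (2 : ℝ)) ^ (1 / 2 : ℝ) ≤ μ * (∑' k, S k f x ^ p) ^ (1 / p) := by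
    intro x
    refine (sq_holder M _ hp).trans ?_
    rw [hμ]
    gcongr
    exact ENNReal.sum_le_tsum _
  set en : ℝ × ℝ → ℝ≥0∞ := fun x => (∑ k ∈ U, S k g x ^ (2 : ℝ)) ^ (1 / 2 : ℝ) with hen
  have henm : Measurable en := (Finset.measurable_sum _ (fun k _ => (hSm k g).pow_const _)).pow_const _
  have nearE : ∀ x, gp A d j x = m → gE A d j en x ≤ (ENNReal.ofReal (243 * B * F ^ 2) * gM A d (fun y => ‖f y‖ₑ ^ (2 : ℝ)) x) ^ (1 / 2 : ℝ) := by
    intro x hx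
    rw [← ENNReal.rpow_le_rpow_iff (show (0 : ℝ) < 2 by norm_num), ← ENNReal.rpow_mul, show (1 / 2 : ℝ) * 2 = 1 by norm_num, ENNReal.rpow_one]
    refine (gE_sq hA d j henm x).trans ?_
    have e1 : ∀ y, en y ^ (2 : ℝ) = ∑ k ∈ U, S k g y ^ (2 : ℝ) := by
      intro y; rw [hen]; dsimp only; rw [← ENNReal.rpow_mul]; norm_num
    simp_rw [e1]
    calc _ ≤ (gv A d j)⁻¹ * ∫⁻ y, ∑ k ∈ U, S k g y ^ (2 : ℝ) := gE_le_total _ _ _ _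
      _ = (gv A d j)⁻¹ * ∑ k ∈ U, ∫⁻ y, S k g y ^ (2 : ℝ) := by
          rw [lintegral_finsetSum _ (fun k _ => (hSm k g).pow_const _)]
      _ ≤ (gv A d j)⁻¹ * (ENNReal.ofReal (B * F ^ 2) * ∫⁻ y, ‖g y‖ₑ ^ (2 : ℝ)) := by
          gcongr
          exact (ENNReal.sum_le_tsum _).trans (H.l2 g)
      _ = ENNReal.ofReal (B * F ^ 2) * ((gv A d j)⁻¹ * ∫⁻ y, ‖g y‖ₑ ^ (2 : ℝ)) := by ring
      _ ≤ ENNReal.ofReal (B * F ^ 2) * (243 * gM A d (fun y => ‖f y‖ₑ ^ (2 : ℝ)) x) := by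
          refine mul_le_mul_right ?_ _
          apply near_int hA d j x
          · intro y; gcongr; exact enorm_le_iff_norm_le.2 (hg1 y)
          · intro y hy
            rw [hx]
            exact hg3 y (by simpa using hy)
      _ = _ := by
          rw [← mul_assoc, show (243 : ℝ≥0∞) = ENNReal.ofReal 243 by simp, ← ENNReal.ofReal_mul (by positivity)]
          congr 2; ring
  refine ⟨(∑ k ∈ L, S k f xQ ^ (2 : ℝ)) ^ (1 / 2 : ℝ), fun x => 2 * D * mf x + μ * (∑' k, S k f x ^ p) ^ (1 / p) + en x, ?_, ?_, ?_⟩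
  · exact ((hmfm.const_mul _).add (hTm.const_mul _)).add henm
  · intro x hx
    constructor
    · have hsplit : ∑ k ∈ E, S k f x ^ (2 : ℝ) = ∑ k ∈ L, S k f x ^ (2 : ℝ) + (∑ k ∈ M, S k f x ^ (2 : ℝ) + ∑ k ∈ U, S k f x ^ (2 : ℝ)) := by
        rw [← Finset.sum_filter_add_sum_filter_not E (fun k => σ k < j - N)]
        congr 1
        rw [← Finset.sum_filter_add_sum_filter_not _ (fun k => σ k ≤ j + N), Finset.filter_filter, Finset.filter_filter]
        congr 1
        · apply Finset.sum_congr _ (fun _ _ => rfl)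
          ext k; simp only [hM, Finset.mem_filter, not_lt]
        · apply Finset.sum_congr _ (fun _ _ => rfl)
          ext k; simp only [hU, Finset.mem_filter, not_lt, not_le]
          constructor
          · rintro ⟨h1, h2, h3⟩; exact ⟨h1, h3⟩
          · rintro ⟨h1, h2⟩; exact ⟨h1, by omega, h2⟩
      rw [hsplit]
      have hadd : ∀ a b : ℝ≥0∞, (a + b) ^ (1 / 2 : ℝ) ≤ a ^ (1 / 2 : ℝ) + b ^ (1 / 2 : ℝ) :=
        fun a b => ENNReal.rpow_add_le_add_rpow a b (by norm_num) (by norm_num)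
      have h1 : (∑ k ∈ L, S k f x ^ (2 : ℝ)) ^ (1 / 2 : ℝ) ≤ (∑ k ∈ L, S k f xQ ^ (2 : ℝ)) ^ (1 / 2 : ℝ) + D * mf x :=
        (sq_add L (fun k => S k f xQ) _ _ (fun k hk => (H.osc k f j x xQ (by have := (Finset.mem_filter.1 hk).2; omega) (hx.trans hxQ.symm)).1)).trans
          (by gcongr; exact oscsum x)
      have h2 : (∑ k ∈ U, S k f x ^ (2 : ℝ)) ^ (1 / 2 : ℝ) ≤ en x + D * mf x :=
        (sq_add U (fun k => S k g x) _ _ (fun k hk => H.sub k f g x)).trans (by gcongr; exact farsum x hx)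
      calc _ ≤ (∑ k ∈ L, S k f x ^ (2 : ℝ)) ^ (1 / 2 : ℝ) + ((∑ k ∈ M, S k f x ^ (2 : ℝ)) ^ (1 / 2 : ℝ) + (∑ k ∈ U, S k f x ^ (2 : ℝ)) ^ (1 / 2 : ℝ)) :=
            (hadd _ _).trans (by gcongr; exact hadd _ _)
        _ ≤ ((∑ k ∈ L, S k f xQ ^ (2 : ℝ)) ^ (1 / 2 : ℝ) + D * mf x) + (μ * (∑' k, S k f x ^ p) ^ (1 / p) + (en x + D * mf x)) := by
            gcongr; exact midsum x
        _ = _ := by ring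
    · have h1 : (∑ k ∈ L, S k f xQ ^ (2 : ℝ)) ^ (1 / 2 : ℝ) ≤ (∑ k ∈ L, S k f x ^ (2 : ℝ)) ^ (1 / 2 : ℝ) + D * mf x :=
        (sq_add L (fun k => S k f x) _ _ (fun k hk => (H.osc k f j x xQ (by have := (Finset.mem_filter.1 hk).2; omega) (hx.trans hxQ.symm)).2)).trans
          (by gcongr; exact oscsum x)
      refine h1.trans ?_
      gcongr
      · exact Finset.filter_subset _ _
      · calc D * mf x ≤ 2 * D * mf x := by gcongr; exact le_mul_of_one_le_left zero_le (by norm_num)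
          _ ≤ _ := by dsimp only; rw [add_assoc]; exact le_self_add
  · intro x hx
    have e1 : gE A d j (fun x => 2 * D * mf x + μ * (∑' k, S k f x ^ p) ^ (1 / p) + en x) x =
        2 * D * gE A d j mf x + μ * gE A d j (fun x => (∑' k, S k f x ^ p) ^ (1 / p)) x + gE A d j en x := by
      unfold gE
      rw [lintegral_add_right _ henm, lintegral_add_right _ (hTm.const_mul _), lintegral_const_mul _ hmfm, lintegral_const_mul _ hTm]
      ring
    rw [e1]
    gcongr
    · exact gE_le_gM d j _ x
    · exact gE_le_gM d j _ x
    · exact nearE x hx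

theorem three_pow {p : ℝ} (hp : 0 ≤ p) (a b c : ℝ≥0∞) : (a + b + c) ^ p ≤ 3 ^ p * (a ^ p + b ^ p + c ^ p) := by
  have h1 : a + b + c ≤ 3 * max a (max b c) := by
    calc a + b + c ≤ max a (max b c) + max a (max b c) + max a (max b c) := by
          gcongr
          · exact le_max_left _ _
          · exact (le_max_left _ _).trans (le_max_right _ _)
          · exact (le_max_right _ _).trans (le_max_right _ _)
      _ = _ := by ring
  calc (a + b + c) ^ p ≤ (3 * max a (max b c)) ^ p := by gcongr
    _ = 3 ^ p * (max a (max b c)) ^ p := ENNReal.mul_rpow_of_nonneg _ _ hp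
    _ ≤ _ := by
      gcongr
      rcases max_choice a (max b c) with h | h
      · rw [h, add_assoc]; exact le_self_add
      · rw [h]
        rcases max_choice b c with h | h
        · rw [h, add_comm (a ^ p), add_assoc]; exact le_self_add
        · rw [h]; exact le_add_self

theorem schwartz_l2 (f : SchwartzMap (ℝ × ℝ) ℂ) : ∫⁻ x, ‖f x‖ₑ ^ (2 : ℝ) ≠ ⊤ := by
  have h := (f.memLp 2 (volume)).2
  have := lintegral_rpow_enorm_lt_top_of_eLpNorm_lt_top (by norm_num) (by norm_num) h
  simpa using this.ne

theorem abstract_fin {p : ℝ} (hp : 2 < p) {d : ℕ} (hd : 1 ≤ d) {B : ℝ} (hB : 0 < B) :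
    ∃ C : ℝ≥0∞, C ≠ ⊤ ∧ ∀ {A : ℝ} (_ : 0 < A) {σ : ℤ → ℤ}
    (_ : ∀ s (E : Finset ℤ), (E.filter (fun k => σ k = s)).card ≤ d) {F G : ℝ} (_ : 0 < F) (_ : 0 < G)
    {N : ℕ} (_ : G ≤ F * 2 ^ N)
    {S : ℤ → SchwartzMap (ℝ × ℝ) ℂ → ℝ × ℝ → ℝ≥0∞} (_ : OpFam A d σ B F G S) (f : SchwartzMap (ℝ × ℝ) ℂ)
    (E : Finset ℤ), ∫⁻ x, ((∑ k ∈ E, S k f x ^ (2 : ℝ)) ^ (1 / 2 : ℝ)) ^ p ≤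
      C * (((1 + N : ℕ) : ℝ≥0∞) ^ (p / 2 - 1) * (ENNReal.ofReal F ^ p * ∫⁻ x, ‖f x‖ₑ ^ p)) := by
  have hp0 : 0 < p := by linarith
  obtain ⟨C0, hC0, h0⟩ := FS hp d
  obtain ⟨C1, hC1, h1⟩ := gM_strong (q := p) (by linarith)
  obtain ⟨C2, hC2, h2⟩ := gM_strong (q := p / 2) (by linarith)
  set Ci := ENNReal.ofReal (p * (4 * B) * (p - 2)⁻¹ * 4 ^ (p - 2)) with hCi
  have hne : ∀ {a : ℝ≥0∞} {q : ℝ}, 0 ≤ q → a ≠ ⊤ → a ^ q ≠ ⊤ := fun h h' => ENNReal.rpow_ne_top_of_nonneg h h'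
  refine ⟨C0 * (3 ^ p * ((2 * ENNReal.ofReal (32 * B * d)) ^ p * (C1 * C1) + ((2 * d : ℕ) : ℝ≥0∞) ^ (p / 2 - 1) * (C1 * Ci) +
    ENNReal.ofReal (243 * B) ^ (p / 2) * C2)), ?_, ?_⟩
  · have hx : (0 : ℝ) ≤ p / 2 - 1 := by linarith
    have hCi' : Ci ≠ ⊤ := ENNReal.ofReal_ne_top
    refine ENNReal.mul_ne_top hC0 (ENNReal.mul_ne_top (hne hp0.le (by norm_num)) (ENNReal.add_ne_top.2 ⟨ENNReal.add_ne_top.2 ⟨?_, ?_⟩, ?_⟩))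
    · exact ENNReal.mul_ne_top (hne hp0.le (ENNReal.mul_ne_top (by norm_num) ENNReal.ofReal_ne_top)) (ENNReal.mul_ne_top hC1 hC1)
    · exact ENNReal.mul_ne_top (hne hx (ENNReal.natCast_ne_top _)) (ENNReal.mul_ne_top hC1 hCi')
    · exact ENNReal.mul_ne_top (hne (by linarith) ENNReal.ofReal_ne_top) hC2
  intro A hA σ hσ F G hF hG N hN S H f E
  have hSm : ∀ k g, Measurable (S k g) := fun k g => (H.lsc k g).measurable
  have hfm : Measurable (fun x => ‖f x‖ₑ) := f.continuous.enorm.measurable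
  have hTm : Measurable (fun y => (∑' k, S k f y ^ p) ^ (1 / p)) :=
    (Measurable.tsum fun k => (hSm k f).pow_const _).pow_const _
  set J := ∫⁻ x, ‖f x‖ₑ ^ p with hJ
  have hlscpow : ∀ {q : ℝ} (_ : 0 < q) {g : ℝ × ℝ → ℝ≥0∞}, LowerSemicontinuous g → LowerSemicontinuous (fun x => g x ^ q) := by
    intro q hq g hg
    exact (ENNReal.continuous_rpow_const (y := q)).comp_lowerSemicontinuous hg (ENNReal.monotone_rpow_of_nonneg hq.le)
  have hlsc : LowerSemicontinuous (fun x => (∑ k ∈ E, S k f x ^ (2 : ℝ)) ^ (1 / 2 : ℝ)) := by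
    apply hlscpow (by norm_num)
    exact lowerSemicontinuous_sum (fun k _ => hlscpow (by norm_num) (H.lsc k f))
  have key := h0 hA (h := fun x => (∑ k ∈ E, S k f x ^ (2 : ℝ)) ^ (1 / 2 : ℝ))
    (Φ := fun x => 2 * ENNReal.ofReal (32 * B * d * F) * gM A d (gM A d (fun y => ‖f y‖ₑ)) x +
        ((d * (2 * N + 1) : ℕ) : ℝ≥0∞) ^ (1 / 2 - 1 / p) * gM A d (fun y => (∑' k, S k f y ^ p) ^ (1 / p)) x +
        (ENNReal.ofReal (243 * B * F ^ 2) * gM A d (fun y => ‖f y‖ₑ ^ (2 : ℝ)) x) ^ (1 / 2 : ℝ))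
    hlsc.measurable
    ((((gM_meas _ _ _).const_mul _).add ((gM_meas _ _ _).const_mul _)).add (((gM_meas _ _ _).const_mul _).pow_const _))
    (by
      have e1 : ∀ y, ((∑ k ∈ E, S k f y ^ (2 : ℝ)) ^ (1 / 2 : ℝ)) ^ (2 : ℝ) = ∑ k ∈ E, S k f y ^ (2 : ℝ) := by
        intro y; rw [← ENNReal.rpow_mul]; norm_num
      simp_rw [e1]
      rw [lintegral_finsetSum _ (fun k _ => (hSm k f).pow_const _)]
      exact ne_top_of_le_ne_top (ENNReal.mul_ne_top ENNReal.ofReal_ne_top (schwartz_l2 f)) ((ENNReal.sum_le_tsum _).trans (H.l2 f)))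
    (lsc_gE hA hd hlsc) (fun s m => local_est hp hA hd hσ hB hF hG hN H f E s m)
  refine key.trans ?_
  rw [mul_assoc C0]
  refine mul_le_mul_right ?_ _
  rw [mul_assoc (3 ^ p)]
  have ha : ∫⁻ x, (2 * ENNReal.ofReal (32 * B * d * F) * gM A d (gM A d (fun y => ‖f y‖ₑ)) x) ^ p ≤
      (2 * ENNReal.ofReal (32 * B * d)) ^ p * (C1 * C1) * (ENNReal.ofReal F ^ p * J) := by
    simp_rw [ENNReal.mul_rpow_of_nonneg _ _ hp0.le]
    rw [lintegral_const_mul _ ((gM_meas _ _ _).pow_const _), ENNReal.ofReal_mul (q := F) (by positivity), ENNReal.mul_rpow_of_nonneg _ _ hp0.le]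
    calc _ ≤ 2 ^ p * (ENNReal.ofReal (32 * B * d) ^ p * ENNReal.ofReal F ^ p) * (C1 * (C1 * J)) := by
          gcongr
          exact (h1 hA d (gM_meas _ _ _)).trans (mul_le_mul_right (h1 hA d hfm) _)
      _ = _ := by ring
  have hb : ∫⁻ x, (((d * (2 * N + 1) : ℕ) : ℝ≥0∞) ^ (1 / 2 - 1 / p) * gM A d (fun y => (∑' k, S k f y ^ p) ^ (1 / p)) x) ^ p ≤
      ((2 * d : ℕ) : ℝ≥0∞) ^ (p / 2 - 1) * (C1 * Ci) * (((1 + N : ℕ) : ℝ≥0∞) ^ (p / 2 - 1) * (ENNReal.ofReal F ^ p * J)) := by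
    have hx : (0 : ℝ) ≤ p / 2 - 1 := by linarith
    simp_rw [ENNReal.mul_rpow_of_nonneg _ _ hp0.le]
    rw [lintegral_const_mul _ ((gM_meas _ _ _).pow_const _), ← ENNReal.rpow_mul, show (1 / 2 - 1 / p) * p = p / 2 - 1 by field_simp]
    calc _ ≤ (((2 * d : ℕ) : ℝ≥0∞) * ((1 + N : ℕ) : ℝ≥0∞)) ^ (p / 2 - 1) * (C1 * (Ci * (ENNReal.ofReal F ^ p * J))) := by
          gcongr
          · rw [← Nat.cast_mul]
            have : d * (2 * N + 1) ≤ 2 * d * (1 + N) := by nlinarith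
            exact_mod_cast this
          · refine (h1 hA d hTm).trans (mul_le_mul_right ?_ _)
            refine le_trans (le_of_eq ?_) (interp hp hB hF H f)
            rw [← lintegral_tsum (fun k => ((hSm k f).pow_const _).aemeasurable)]
            congr 1; ext y
            rw [← ENNReal.rpow_mul, one_div_mul_cancel hp0.ne', ENNReal.rpow_one]
      _ = _ := by rw [ENNReal.mul_rpow_of_nonneg _ _ hx]; ring
  have hc : ∫⁻ x, ((ENNReal.ofReal (243 * B * F ^ 2) * gM A d (fun y => ‖f y‖ₑ ^ (2 : ℝ)) x) ^ (1 / 2 : ℝ)) ^ p ≤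
      ENNReal.ofReal (243 * B) ^ (p / 2) * C2 * (ENNReal.ofReal F ^ p * J) := by
    have hx : (0 : ℝ) ≤ p / 2 := by linarith
    simp_rw [← ENNReal.rpow_mul, show 1 / 2 * p = p / 2 by ring, ENNReal.mul_rpow_of_nonneg _ _ hx]
    rw [lintegral_const_mul _ ((gM_meas _ _ _).pow_const _), ENNReal.ofReal_mul (by positivity), ENNReal.mul_rpow_of_nonneg _ _ hx,
      ENNReal.ofReal_pow hF.le, ← ENNReal.rpow_natCast (ENNReal.ofReal F), ← ENNReal.rpow_mul,
      show ((2 : ℕ) : ℝ) * (p / 2) = p by push_cast; ring]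
    calc _ ≤ ENNReal.ofReal (243 * B) ^ (p / 2) * ENNReal.ofReal F ^ p * (C2 * J) := by
          gcongr
          refine (h2 hA d (hfm.pow_const _)).trans (le_of_eq ?_)
          congr 2; ext y
          rw [← ENNReal.rpow_mul]; congr 1; ring
      _ = _ := by ring
  have hone : (1 : ℝ≥0∞) ≤ ((1 + N : ℕ) : ℝ≥0∞) ^ (p / 2 - 1) := by
    apply ENNReal.one_le_rpow
    · exact_mod_cast Nat.le_add_right 1 N
    · linarith
  calc _ ≤ ∫⁻ x, 3 ^ p * ((2 * ENNReal.ofReal (32 * B * d * F) * gM A d (gM A d (fun y => ‖f y‖ₑ)) x) ^ p +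
        (((d * (2 * N + 1) : ℕ) : ℝ≥0∞) ^ (1 / 2 - 1 / p) * gM A d (fun y => (∑' k, S k f y ^ p) ^ (1 / p)) x) ^ p +
        ((ENNReal.ofReal (243 * B * F ^ 2) * gM A d (fun y => ‖f y‖ₑ ^ (2 : ℝ)) x) ^ (1 / 2 : ℝ)) ^ p) :=
        lintegral_mono fun x => three_pow hp0.le _ _ _
    _ = 3 ^ p * ((∫⁻ x, (2 * ENNReal.ofReal (32 * B * d * F) * gM A d (gM A d (fun y => ‖f y‖ₑ)) x) ^ p) +
        (∫⁻ x, (((d * (2 * N + 1) : ℕ) : ℝ≥0∞) ^ (1 / 2 - 1 / p) * gM A d (fun y => (∑' k, S k f y ^ p) ^ (1 / p)) x) ^ p) +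
        ∫⁻ x, ((ENNReal.ofReal (243 * B * F ^ 2) * gM A d (fun y => ‖f y‖ₑ ^ (2 : ℝ)) x) ^ (1 / 2 : ℝ)) ^ p) := by
        have m1 := ((gM_meas A d (gM A d (fun y => ‖f y‖ₑ))).const_mul (2 * ENNReal.ofReal (32 * B * d * F))).pow_const p
        have m2 := ((gM_meas A d (fun y => (∑' k, S k f y ^ p) ^ (1 / p))).const_mul (((d * (2 * N + 1) : ℕ) : ℝ≥0∞) ^ (1 / 2 - 1 / p))).pow_const p
        have m3 := (((gM_meas A d (fun y => ‖f y‖ₑ ^ (2 : ℝ))).const_mul (ENNReal.ofReal (243 * B * F ^ 2))).pow_const (1 / 2 : ℝ)).pow_const p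
        rw [lintegral_const_mul' _ _ (hne hp0.le (by norm_num)), lintegral_add_right _ m3, lintegral_add_right _ m2]
    _ ≤ 3 ^ p * ((2 * ENNReal.ofReal (32 * B * d)) ^ p * (C1 * C1) * (ENNReal.ofReal F ^ p * J) +
        ((2 * d : ℕ) : ℝ≥0∞) ^ (p / 2 - 1) * (C1 * Ci) * (((1 + N : ℕ) : ℝ≥0∞) ^ (p / 2 - 1) * (ENNReal.ofReal F ^ p * J)) +
        ENNReal.ofReal (243 * B) ^ (p / 2) * C2 * (ENNReal.ofReal F ^ p * J)) := mul_le_mul_right (add_le_add (add_le_add ha hb) hc) _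
    _ ≤ 3 ^ p * ((2 * ENNReal.ofReal (32 * B * d)) ^ p * (C1 * C1) * (((1 + N : ℕ) : ℝ≥0∞) ^ (p / 2 - 1) * (ENNReal.ofReal F ^ p * J)) +
        ((2 * d : ℕ) : ℝ≥0∞) ^ (p / 2 - 1) * (C1 * Ci) * (((1 + N : ℕ) : ℝ≥0∞) ^ (p / 2 - 1) * (ENNReal.ofReal F ^ p * J)) +
        ENNReal.ofReal (243 * B) ^ (p / 2) * C2 * (((1 + N : ℕ) : ℝ≥0∞) ^ (p / 2 - 1) * (ENNReal.ofReal F ^ p * J))) := by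
        have hX : ENNReal.ofReal F ^ p * J ≤ ((1 + N : ℕ) : ℝ≥0∞) ^ (p / 2 - 1) * (ENNReal.ofReal F ^ p * J) := le_mul_of_one_le_left zero_le hone
        exact mul_le_mul_right (add_le_add (add_le_add (mul_le_mul_right hX _) le_rfl) (mul_le_mul_right hX _)) _
    _ = _ := by ring

theorem abstract_main {p : ℝ} (hp : 2 < p) {d : ℕ} (hd : 1 ≤ d) {B : ℝ} (hB : 0 < B) :
    ∃ C : ℝ≥0∞, C ≠ ⊤ ∧ ∀ {A : ℝ} (_ : 0 < A) {σ : ℤ → ℤ}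
    (_ : ∀ s (E : Finset ℤ), (E.filter (fun k => σ k = s)).card ≤ d) {F G : ℝ} (_ : 0 < F) (_ : 0 < G)
    {N : ℕ} (_ : G ≤ F * 2 ^ N)
    {S : ℤ → SchwartzMap (ℝ × ℝ) ℂ → ℝ × ℝ → ℝ≥0∞} (_ : OpFam A d σ B F G S) (f : SchwartzMap (ℝ × ℝ) ℂ),
    ∫⁻ x, ((∑' k, S k f x ^ (2 : ℝ)) ^ (1 / 2 : ℝ)) ^ p ≤
      C * (((1 + N : ℕ) : ℝ≥0∞) ^ (p / 2 - 1) * (ENNReal.ofReal F ^ p * ∫⁻ x, ‖f x‖ₑ ^ p)) := by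
  obtain ⟨C, hC, h⟩ := abstract_fin hp hd hB
  refine ⟨C, hC, ?_⟩
  intro A hA σ hσ F G hF hG N hN S H f
  have hSm : ∀ k g, Measurable (S k g) := fun k g => (H.lsc k g).measurable
  have e1 : ∀ x, ((∑' k, S k f x ^ (2 : ℝ)) ^ (1 / 2 : ℝ)) ^ p = ⨆ E : Finset ℤ, ((∑ k ∈ E, S k f x ^ (2 : ℝ)) ^ (1 / 2 : ℝ)) ^ p := by
    intro x
    rw [ENNReal.tsum_eq_iSup_sum]
    simp_rw [← ENNReal.rpow_mul]
    exact (ENNReal.orderIsoRpow (1 / 2 * p) (by linarith)).map_iSup _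
  simp_rw [e1]
  rw [lintegral_iSup_directed_of_measurable]
  · exact iSup_le fun E => h hA hσ hF hG hN H f E
  · intro E
    exact ((Finset.measurable_sum _ (fun k _ => (hSm k f).pow_const _)).pow_const _).pow_const _
  · apply directed_of_isDirected_le
    intro E E' hE x
    dsimp only
    gcongr

theorem gamma_pow (γ : ℝ → ℝ) (hγ0 : γ 0 = 0)
    (hsmooth : ContDiffOn ℝ (⊤ : ℕ∞) γ (Set.Icc (-1 : ℝ) 1))
    (hγ1 : γ 1 = 1)
    (hext : ∀ t : ℝ, 1 ≤ t → γ t = (γ t⁻¹)⁻¹)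
    (hmono2 : StrictMonoOn γ (Set.Ici (0 : ℝ)))
    (C0U : ℝ) (hC0U : 1 < C0U)
    (hdouble : ∀ t : ℝ, 0 < t → γ (2 * t) / γ t ≤ C0U) :
    ∃ d : ℕ, 1 ≤ d ∧ ∃ c C : ℝ, 0 < c ∧ 0 < C ∧ ∀ t, 0 < t → c * t ^ d ≤ γ t ∧ γ t ≤ C * t ^ d := by
  have hpos : ∀ t, 0 < t → 0 < γ t := fun t ht => by
    have := hmono2 (mem_Ici.2 le_rfl) (mem_Ici.2 ht.le) ht
    rwa [hγ0] at this
  have hs : ContDiffOn ℝ (⊤ : ℕ∞) γ (Icc (0 : ℝ) 1) := hsmooth.mono (Icc_subset_Icc (by norm_num) le_rfl)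
  have hlow : ∀ n : ℕ, (C0U ^ n)⁻¹ ≤ γ ((2 ^ n)⁻¹) := by
    intro n
    induction n with
    | zero => simp [hγ1]
    | succ n ih =>
      have h := hdouble ((2 ^ (n + 1))⁻¹) (by positivity)
      rw [div_le_iff₀ (hpos _ (by positivity)), show (2 : ℝ) * (2 ^ (n + 1))⁻¹ = (2 ^ n)⁻¹ by rw [pow_succ]; field_simp] at h
      have h2 := ih.trans h
      rw [pow_succ, mul_inv]
      rw [← div_eq_mul_inv, div_le_iff₀ (by linarith)]
      linarith
  set D : ℕ → ℝ := fun j => iteratedDerivWithin j γ (Icc 0 1) 0 with hD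
  have htay : ∀ n : ℕ, (∀ j < n, D j = 0) → ∀ t, taylorWithinEval γ n (Icc 0 1) 0 t = (n.factorial : ℝ)⁻¹ * t ^ n * D n := by
    intro n
    induction n with
    | zero => intro _ t; simp [hD]
    | succ n ih =>
      intro h t
      rw [taylorWithinEval_succ, ih (fun j hj => h j (by omega)), h n (by omega)]
      rw [hD, Nat.factorial_succ]; simp
  have hrem : ∀ n : ℕ, (∀ j < n, D j = 0) → ∃ M : ℝ, 0 < M ∧ ∀ t ∈ Icc (0 : ℝ) 1, |γ t - (n.factorial : ℝ)⁻¹ * t ^ n * D n| ≤ M * t ^ (n + 1) := by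
    intro n hn
    obtain ⟨M, hM⟩ := exists_taylor_mean_remainder_bound (f := γ) (a := 0) (b := 1) (n := n) (by norm_num) (hs.of_le (by exact_mod_cast le_top))
    refine ⟨max M 1, by positivity, fun t ht => ?_⟩
    have := hM t ht
    rw [htay n hn, sub_zero, Real.norm_eq_abs] at this
    have h0 := ht.1
    exact this.trans (by gcongr; exact le_max_left _ _)
  have hex : ∃ j, D j ≠ 0 := by
    by_contra! hcon
    obtain ⟨n, hn⟩ := pow_unbounded_of_one_lt C0U (show (1 : ℝ) < 2 by norm_num)
    obtain ⟨M, hM0, hM⟩ := hrem n (fun j _ => hcon j)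
    have hr : 1 < 2 ^ n / C0U := by rw [one_lt_div (by linarith)]; exact hn
    obtain ⟨m, hm⟩ := pow_unbounded_of_one_lt M hr
    have h1 := hM ((2 ^ m)⁻¹) ⟨by positivity, inv_le_one_of_one_le₀ (one_le_pow₀ (by norm_num))⟩
    rw [hcon n, mul_zero, sub_zero, abs_of_pos (hpos _ (by positivity))] at h1
    have h2 := (hlow m).trans h1
    have h3 : ((2 : ℝ) ^ m)⁻¹ ^ (n + 1) ≤ ((2 ^ n) ^ m)⁻¹ := by
      rw [inv_pow, ← pow_mul, ← pow_mul]
      exact inv_anti₀ (by positivity) (pow_le_pow_right₀ (by norm_num) (by nlinarith))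
    have h4 : (C0U ^ m)⁻¹ ≤ M * ((2 ^ n) ^ m)⁻¹ := h2.trans (by gcongr)
    rw [div_pow, lt_div_iff₀ (by positivity)] at hm
    rw [← div_eq_mul_inv, le_div_iff₀ (by positivity), inv_mul_eq_div, div_le_iff₀ (by positivity)] at h4
    linarith
  classical
  set d := Nat.find hex with hd
  have hd0 : D d ≠ 0 := Nat.find_spec hex
  have hdm : ∀ j < d, D j = 0 := fun j hj => by simpa using Nat.find_min hex hj
  have hd1 : 1 ≤ d := by
    rw [Nat.one_le_iff_ne_zero]; intro h
    rw [h] at hd0; apply hd0; simp [hD, hγ0]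
  obtain ⟨M, hM0, hM⟩ := hrem d hdm
  set e := (d.factorial : ℝ)⁻¹ * D d with he
  have hfac : (0 : ℝ) < (d.factorial : ℝ)⁻¹ := by positivity
  have hM' : ∀ t ∈ Icc (0 : ℝ) 1, |γ t - e * t ^ d| ≤ M * t * t ^ d := by
    intro t ht
    have := hM t ht
    rw [show (d.factorial : ℝ)⁻¹ * t ^ d * D d = e * t ^ d by rw [he]; ring] at this
    exact this.trans (le_of_eq (by ring))
  have he0 : 0 < |e| := abs_pos.2 (mul_ne_zero hfac.ne' hd0)
  set t0 := min 1 (|e| / (2 * M)) with ht0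
  have ht00 : 0 < t0 := by positivity
  have ht01 : t0 ≤ 1 := min_le_left _ _
  have hsm : ∀ t, 0 < t → t ≤ t0 → |γ t - e * t ^ d| ≤ |e| / 2 * t ^ d := by
    intro t h1 h2
    refine (hM' t ⟨h1.le, h2.trans ht01⟩).trans ?_
    gcongr
    have : t ≤ |e| / (2 * M) := h2.trans (min_le_right _ _)
    rw [le_div_iff₀ (by positivity)] at this
    linarith
  have hepos : 0 < e := by
    by_contra! hneg
    have h1 := abs_le.1 (hsm t0 ht00 le_rfl)
    rw [abs_of_nonpos hneg] at h1
    have h2 := hpos t0 ht00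
    have h3 : (0 : ℝ) < t0 ^ d := by positivity
    rw [abs_of_nonpos hneg] at he0
    nlinarith [h1.2]
  rw [abs_of_pos hepos] at hsm
  have hle1 : ∀ t, 0 < t → t ≤ 1 → γ t ≤ 1 := fun t h0 h1 => by
    have := hmono2.monotoneOn (mem_Ici.2 h0.le) (mem_Ici.2 zero_le_one) h1
    rwa [hγ1] at this
  obtain ⟨c, C, hc, hC, hcC⟩ : ∃ c C : ℝ, 0 < c ∧ 0 < C ∧ ∀ t, 0 < t → t ≤ 1 → c * t ^ d ≤ γ t ∧ γ t ≤ C * t ^ d := by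
    refine ⟨min (e / 2) (γ t0), max (2 * e) ((t0 ^ d)⁻¹), lt_min (by linarith) (hpos _ ht00), by positivity, ?_⟩
    intro t h0 h1
    rcases le_total t t0 with h | h
    · have h2 := abs_le.1 (hsm t h0 h)
      have h3 : (0 : ℝ) < t ^ d := by positivity
      constructor
      · calc _ ≤ e / 2 * t ^ d := by gcongr; exact min_le_left _ _
          _ ≤ _ := by nlinarith
      · calc _ ≤ 2 * e * t ^ d := by nlinarith
          _ ≤ _ := by gcongr; exact le_max_left _ _
    · have h3 : t0 ^ d ≤ t ^ d := by gcongr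
      have h4 : t ^ d ≤ 1 := pow_le_one₀ h0.le h1
      have h5 := hpos t0 ht00
      constructor
      · calc _ ≤ γ t0 * 1 := by gcongr; exact min_le_right _ _
          _ ≤ _ := by rw [mul_one]; exact hmono2.monotoneOn (mem_Ici.2 ht00.le) (mem_Ici.2 h0.le) h
      · calc _ ≤ 1 := hle1 t h0 h1
          _ = (t0 ^ d)⁻¹ * t0 ^ d := by field_simp
          _ ≤ _ := by gcongr; exact le_max_right _ _
  refine ⟨d, hd1, min c C⁻¹, max C c⁻¹, by positivity, by positivity, ?_⟩
  intro t ht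
  rcases le_total t 1 with h | h
  · have := hcC t ht h
    constructor
    · exact le_trans (by gcongr; exact min_le_left _ _) this.1
    · exact this.2.trans (by gcongr; exact le_max_left _ _)
  · have h1 := hcC t⁻¹ (by positivity) (inv_le_one_of_one_le₀ h)
    rw [hext t h]
    have hp := hpos t⁻¹ (by positivity)
    rw [inv_pow] at h1
    constructor
    · calc _ ≤ C⁻¹ * t ^ d := by gcongr; exact min_le_right _ _
        _ = (C * (t ^ d)⁻¹)⁻¹ := by rw [mul_inv, inv_inv]
        _ ≤ _ := by gcongr; exact h1.2
    · calc _ ≤ (c * (t ^ d)⁻¹)⁻¹ := by gcongr; exact h1.1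
        _ = c⁻¹ * t ^ d := by rw [mul_inv, inv_inv]
        _ ≤ _ := by gcongr; exact le_max_right _ _

theorem fiber_card {d : ℕ} (hd : 1 ≤ d) (s : ℤ) (E : Finset ℤ) : (E.filter (fun k => k / (d : ℤ) = s)).card ≤ d := by
  have h : E.filter (fun k => k / (d : ℤ) = s) ⊆ Finset.Ico (s * d) (s * d + d) := by
    intro k hk
    have h1 := (Finset.mem_filter.1 hk).2
    have hd' : (0 : ℤ) < d := by exact_mod_cast hd
    have h2 := Int.emod_nonneg k hd'.ne'
    have h3 := Int.emod_lt_of_pos k hd'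
    have h4 := Int.emod_add_mul_ediv k d
    rw [h1] at h4
    rw [Finset.mem_Ico]
    constructor <;> nlinarith
  refine (Finset.card_le_card h).trans ?_
  rw [Int.card_Ico]; omega

theorem beta_bd {d : ℕ} (hd : 1 ≤ d) (k : ℤ) : ((2 : ℝ) ^ d)⁻¹ ≤ gY d (k / (d : ℤ)) * 2 ^ (-k) ∧ gY d (k / (d : ℤ)) * 2 ^ (-k) ≤ 1 := by
  have hd' : (0 : ℤ) < d := by exact_mod_cast hd
  have h2 := Int.emod_nonneg k hd'.ne'
  have h3 := Int.emod_lt_of_pos k hd'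
  have h4 := Int.emod_add_mul_ediv k d
  have e : gY d (k / (d : ℤ)) * 2 ^ (-k) = (2 : ℝ) ^ (-(k % (d : ℤ))) := by
    unfold gY
    rw [← zpow_natCast, ← zpow_mul, ← zpow_add₀ (by norm_num)]
    congr 1; omega
  rw [e]
  constructor
  · rw [← zpow_natCast, ← zpow_neg]
    exact zpow_le_zpow_right₀ (by norm_num) (by omega)
  · exact zpow_le_one_of_nonpos₀ (by norm_num) (by omega)

theorem pow_bd_le {z b : ℝ} (hz : 0 ≤ z) {d : ℕ} (hd : 1 ≤ d) (h : z ^ d ≤ b) : z ≤ max 1 b := by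
  rcases le_total z 1 with h1 | h1
  · exact h1.trans (le_max_left _ _)
  · exact ((le_self_pow₀ h1 (by omega)).trans h).trans (le_max_right _ _)

theorem pow_bd_ge {z b : ℝ} (hz : 0 ≤ z) {d : ℕ} (hd : 1 ≤ d) (h : b ≤ z ^ d) : min 1 b ≤ z := by
  rcases le_total z 1 with h1 | h1
  · exact (min_le_right _ _).trans (h.trans (pow_le_of_le_one hz h1 (by omega)))
  · exact (min_le_left _ _).trans h1

theorem alpha_bd (γ : ℝ → ℝ) {d : ℕ} (hd : 1 ≤ d) {c C : ℝ} (hc : 0 < c) (hC : 0 < C)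
    (h : ∀ t, 0 < t → c * t ^ d ≤ γ t ∧ γ t ≤ C * t ^ d) {cγ Cγ : ℝ} (hcγ : 0 < cγ) (hCγ : 0 < Cγ) :
    ∃ b B : ℝ, 0 < b ∧ 0 < B ∧ ∀ (l : ℕ) (v : ℤ), ∃ A : ℝ, 0 < A ∧ ∀ l0 k : ℤ,
      cγ ≤ (2 : ℝ) ^ (k + v) * γ ((2 : ℝ) ^ (-l0)) → (2 : ℝ) ^ (k + v) * γ ((2 : ℝ) ^ (-l0)) ≤ Cγ →
      b ≤ gX A (k / (d : ℤ)) * ((2 : ℝ) ^ (-l0) * (gammaZ γ l0 (2 ^ l))⁻¹) ∧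
      gX A (k / (d : ℤ)) * ((2 : ℝ) ^ (-l0) * (gammaZ γ l0 (2 ^ l))⁻¹) ≤ B := by
  refine ⟨min 1 (cγ / C * (2 ^ d)⁻¹) * (c / C), max 1 (Cγ / c) * (C / c), by positivity, by positivity, ?_⟩
  intro l v
  set R : ℝ := 2 ^ ((v : ℝ) / d) with hR
  have hR0 : 0 < R := by positivity
  have hd0 : (d : ℝ) ≠ 0 := by positivity
  have hRd : R ^ d = 2 ^ v := by
    rw [hR, ← Real.rpow_natCast, ← Real.rpow_mul (by norm_num), div_mul_cancel₀ _ hd0, Real.rpow_intCast]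
  refine ⟨R * (2 ^ l) ^ d, by positivity, ?_⟩
  intro l0 k h1 h2
  set s := k / (d : ℤ) with hs
  set T : ℝ := 2 ^ (-l0) with hT
  have hT0 : 0 < T := by positivity
  set z := T * R * 2 ^ s with hz
  have hz0 : 0 < z := by positivity
  have hY := beta_bd hd k
  rw [← hs] at hY
  unfold gY at hY
  have hzd : z ^ d = T ^ d * 2 ^ (k + v) * ((2 ^ d) ^ s * 2 ^ (-k)) := by
    rw [hz, mul_pow, mul_pow, hRd, zpow_add₀ (by norm_num), zpow_neg, ← zpow_natCast ((2 : ℝ) ^ s) d, ← zpow_mul, ← zpow_natCast (2 : ℝ) d, ← zpow_mul, mul_comm s]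
    field_simp
  set q : ℝ := (2 ^ d) ^ s * 2 ^ (-k) with hq
  have hq0 : 0 < q := by positivity
  have hγT := h T hT0
  have hP : (0 : ℝ) < 2 ^ (k + v) := by positivity
  set P : ℝ := 2 ^ (k + v) with hPd
  have hz1 : z ^ d ≤ Cγ / c := by
    rw [hzd, le_div_iff₀ hc]
    calc T ^ d * P * q * c ≤ T ^ d * P * 1 * c := by gcongr; exact hY.2
      _ = P * (c * T ^ d) := by ring
      _ ≤ P * γ T := by gcongr; exact hγT.1
      _ ≤ _ := h2
  have hz2 : cγ / C * (2 ^ d)⁻¹ ≤ z ^ d := by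
    rw [hzd]
    gcongr
    · rw [div_le_iff₀ hC]
      calc cγ ≤ P * γ T := h1
        _ ≤ P * (C * T ^ d) := by gcongr; exact hγT.2
        _ = _ := by ring
    · exact hY.1
  have hzl := pow_bd_ge hz0.le hd hz2
  have hzu := pow_bd_le hz0.le hd hz1
  have hγp : ∀ t, 0 < t → 0 < γ t := fun t ht => lt_of_lt_of_le (by positivity) (h t ht).1
  set w : ℝ := (2 ^ l) ^ d * γ T / γ (T * 2 ^ l) with hw
  have e : gX (R * (2 ^ l) ^ d) s * (T * (gammaZ γ l0 (2 ^ l))⁻¹) = z * w := by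
    unfold gX gammaZ
    rw [inv_div, hw, hz]
    ring
  have hγl := h (T * 2 ^ l) (by positivity)
  rw [mul_pow] at hγl
  have hg1 := hγp T hT0
  have hg2 := hγp (T * 2 ^ l) (by positivity)
  have hw1 : w ≤ C / c := by
    rw [hw, div_le_div_iff₀ hg2 hc]
    calc (2 ^ l) ^ d * γ T * c ≤ (2 ^ l) ^ d * (C * T ^ d) * c := by gcongr; exact hγT.2
      _ = C * (c * (T ^ d * (2 ^ l) ^ d)) := by ring
      _ ≤ _ := by gcongr; exact hγl.1
  have hw2 : c / C ≤ w := by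
    rw [hw, div_le_div_iff₀ hC hg2]
    calc c * γ (T * 2 ^ l) ≤ c * (C * (T ^ d * (2 ^ l) ^ d)) := by gcongr; exact hγl.2
      _ = (2 ^ l) ^ d * (c * T ^ d) * C := by ring
      _ ≤ _ := by gcongr; exact hγT.1
  rw [e]
  constructor
  · gcongr
  · have : 0 < w := by positivity
    gcongr

noncomputable def dotL : (ℝ × ℝ) →L[ℝ] (ℝ × ℝ) →L[ℝ] ℝ :=
  -((ContinuousLinearMap.mul ℝ ℝ).bilinearComp (ContinuousLinearMap.fst ℝ ℝ ℝ) (ContinuousLinearMap.fst ℝ ℝ ℝ) +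
    (ContinuousLinearMap.mul ℝ ℝ).bilinearComp (ContinuousLinearMap.snd ℝ ℝ ℝ) (ContinuousLinearMap.snd ℝ ℝ ℝ))

theorem dotL_apply (v w : ℝ × ℝ) : dotL v w = -(v.1 * w.1 + v.2 * w.2) := by
  simp [dotL]

theorem ftInv_eq (b : ℝ × ℝ → ℂ) : ftInv b = VectorFourier.fourierIntegral Real.fourierChar volume dotL.toLinearMap₁₂ b := by
  ext x
  unfold ftInv VectorFourier.fourierIntegral
  congr 1; ext v
  rw [Circle.smul_def, Real.fourierChar_apply, smul_eq_mul]
  congr 2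
  rw [show dotL.toLinearMap₁₂ v x = dotL v x from rfl, dotL_apply]
  push_cast; ring

theorem ker_bound {K : Set (ℝ × ℝ)} (hK : IsCompact K) : ∃ C : ℝ, 0 < C ∧ ∀ (b : ℝ × ℝ → ℂ) (G : ℝ), 0 ≤ G →
    ContDiff ℝ (⊤ : ℕ∞) b → Function.support b ⊆ K →
    (∀ ξ ∈ K, ∀ n : ℕ, n ≤ 6 → ‖iteratedFDeriv ℝ n b ξ‖ ≤ G) →
    Differentiable ℝ (ftInv b) ∧ ∀ x : ℝ × ℝ, (1 + |x.1| + |x.2|) ^ 6 * ‖ftInv b x‖ ≤ C * G ∧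
      (1 + |x.1| + |x.2|) ^ 6 * ‖fderiv ℝ (ftInv b) x‖ ≤ C * G := by
  obtain ⟨R, hR1, hR⟩ : ∃ R : ℝ, 1 ≤ R ∧ ∀ v ∈ K, ‖v‖ ≤ R := by
    obtain ⟨R, hR⟩ := hK.isBounded.exists_norm_le
    exact ⟨max 1 R, le_max_left _ _, fun v hv => (hR v hv).trans (le_max_right _ _)⟩
  set V := (volume K).toReal with hV
  have hV0 : 0 ≤ V := ENNReal.toReal_nonneg
  set C0 := (2 * Real.pi * (‖dotL‖ + 1)) * 4 ^ 6 * (14 * (R * V)) with hC0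
  have hC00 : 0 ≤ C0 := by positivity
  refine ⟨729 * 3 * C0 + 1, by positivity, ?_⟩
  intro b G hG hb hsupp hbd
  have hts : ∀ n : ℕ, Function.support (iteratedFDeriv ℝ n b) ⊆ K := by
    intro n
    refine (support_iteratedFDeriv_subset n).trans ?_
    exact closure_minimal hsupp hK.isClosed
  have hcs : HasCompactSupport b := HasCompactSupport.intro hK (fun x hx => by
    by_contra h; exact hx (hsupp h))
  have hint : ∀ (k n : ℕ), Integrable (fun v : ℝ × ℝ => ‖v‖ ^ k * ‖iteratedFDeriv ℝ n b v‖) := by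
    intro k n
    apply Continuous.integrable_of_hasCompactSupport
    · exact (continuous_norm.pow k).mul (hb.continuous_iteratedFDeriv (by exact_mod_cast le_top)).norm
    · apply HasCompactSupport.mul_left
      exact (hcs.iteratedFDeriv n).norm
  have hintle : ∀ (k n : ℕ), k ≤ 1 → n ≤ 6 → ∫ v : ℝ × ℝ, ‖v‖ ^ k * ‖iteratedFDeriv ℝ n b v‖ ≤ R * V * G := by
    intro k n hk hn
    calc _ ≤ ∫ v : ℝ × ℝ, K.indicator (fun _ => R * G) v := by
          apply integral_mono (hint k n)
          · exact (integrable_indicator_iff hK.measurableSet).2 (integrableOn_const hK.measure_lt_top.ne)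
          · intro v
            dsimp only
            by_cases hv : v ∈ K
            · rw [indicator_of_mem hv]
              have h1 : ‖v‖ ^ k ≤ R := by
                interval_cases k
                · simpa using hR1
                · simpa using hR v hv
              have := hbd v hv n hn
              gcongr
            · rw [indicator_of_notMem hv]
              have : iteratedFDeriv ℝ n b v = 0 := by
                by_contra h; exact hv (hts n h)
              simp [this]
      _ = _ := by
          rw [integral_indicator hK.measurableSet, setIntegral_const, smul_eq_mul, Measure.real]; ring
  have hmain : ∀ (k : ℕ), k ≤ 1 → ∀ (n : ℕ), n ≤ 6 → ∀ v w : ℝ × ℝ, ‖v‖ ≤ 1 →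
      |dotL v w| ^ n * ‖iteratedFDeriv ℝ k (ftInv b) w‖ ≤ C0 * G := by
    intro k hk n hn v w hv
    have h := VectorFourier.pow_mul_norm_iteratedFDeriv_fourierIntegral_le (L := dotL) (μ := volume) (K := ⊤) (N := ⊤) (f := b)
      hb (fun k n _ _ => hint k n) (k := k) (n := n) le_top le_top v w
    rw [← ftInv_eq] at h
    refine h.trans ?_
    have hpi := Real.pi_gt_three
    have hX : 1 ≤ 2 * Real.pi * (‖dotL‖ + 1) := by nlinarith [norm_nonneg dotL]
    have a1 : (2 * Real.pi * ‖dotL‖) ^ k ≤ 2 * Real.pi * (‖dotL‖ + 1) := by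
      interval_cases k
      · simpa using hX
      · rw [pow_one]; gcongr; linarith
    have a2 : ‖v‖ ^ n ≤ 1 := pow_le_one₀ (norm_nonneg _) hv
    have a3 : (2 * (k : ℝ) + 2) ^ n ≤ 4 ^ 6 := by
      have : (k : ℝ) ≤ 1 := by exact_mod_cast hk
      calc (2 * (k : ℝ) + 2) ^ n ≤ 4 ^ n := by gcongr; linarith
        _ ≤ _ := pow_le_pow_right₀ (by norm_num) hn
    have a4 : ∑ p ∈ Finset.range (k + 1) ×ˢ Finset.range (n + 1), ∫ v : ℝ × ℝ, ‖v‖ ^ p.1 * ‖iteratedFDeriv ℝ p.2 b v‖ ≤ 14 * (R * V * G) := by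
      calc _ ≤ ∑ p ∈ Finset.range (k + 1) ×ˢ Finset.range (n + 1), R * V * G := by
            apply Finset.sum_le_sum
            intro p hp
            simp only [Finset.mem_product, Finset.mem_range] at hp
            exact hintle _ _ (by omega) (by omega)
        _ = ((k + 1) * (n + 1) : ℕ) * (R * V * G) := by simp
        _ ≤ _ := by
          gcongr
          have : (k + 1) * (n + 1) ≤ 2 * 7 := Nat.mul_le_mul (by omega) (by omega)
          exact_mod_cast this
    have a0 : 0 ≤ ∑ p ∈ Finset.range (k + 1) ×ˢ Finset.range (n + 1), ∫ v : ℝ × ℝ, ‖v‖ ^ p.1 * ‖iteratedFDeriv ℝ p.2 b v‖ :=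
      Finset.sum_nonneg fun p _ => integral_nonneg fun v => by positivity
    calc _ ≤ 1 * (2 * Real.pi * (‖dotL‖ + 1)) * 4 ^ 6 * (14 * (R * V * G)) := by gcongr
      _ = _ := by rw [hC0]; ring
  have hcomb : ∀ (k : ℕ), k ≤ 1 → ∀ x : ℝ × ℝ, (1 + |x.1| + |x.2|) ^ 6 * ‖iteratedFDeriv ℝ k (ftInv b) x‖ ≤ (729 * 3 * C0 + 1) * G := by
    intro k hk x
    have h0 := hmain k hk 0 (by norm_num) 0 x (by simp)
    have h1 := hmain k hk 6 le_rfl (1, 0) x (by simp [Prod.norm_def])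
    have h2 := hmain k hk 6 le_rfl (0, 1) x (by simp [Prod.norm_def])
    rw [dotL_apply] at h1 h2
    simp only [pow_zero, one_mul, zero_mul, add_zero, zero_add, abs_neg] at h0 h1 h2
    have h3 : (1 + |x.1| + |x.2|) ^ 6 ≤ 729 * (1 + |x.1| ^ 6 + |x.2| ^ 6) := by
      set m := max 1 (max |x.1| |x.2|) with hm
      have m1 : 1 ≤ m := le_max_left _ _
      have m2 : |x.1| ≤ m := (le_max_left _ _).trans (le_max_right _ _)
      have m3 : |x.2| ≤ m := (le_max_right _ _).trans (le_max_right _ _)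
      calc (1 + |x.1| + |x.2|) ^ 6 ≤ (3 * m) ^ 6 := by gcongr; linarith
        _ = 729 * m ^ 6 := by ring
        _ ≤ _ := by
          gcongr
          have p1 : 0 ≤ |x.1| ^ 6 := by positivity
          have p2 : 0 ≤ |x.2| ^ 6 := by positivity
          rcases max_choice 1 (max |x.1| |x.2|) with h | h
          · rw [hm, h]; linarith
          · rw [hm, h]
            rcases max_choice |x.1| |x.2| with h | h
            · rw [h]; linarith
            · rw [h]; linarith
    calc _ ≤ 729 * (1 + |x.1| ^ 6 + |x.2| ^ 6) * ‖iteratedFDeriv ℝ k (ftInv b) x‖ := by gcongr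
      _ = 729 * (‖iteratedFDeriv ℝ k (ftInv b) x‖ + |x.1| ^ 6 * ‖iteratedFDeriv ℝ k (ftInv b) x‖ + |x.2| ^ 6 * ‖iteratedFDeriv ℝ k (ftInv b) x‖) := by ring
      _ ≤ 729 * (C0 * G + C0 * G + C0 * G) := by gcongr
      _ ≤ _ := by nlinarith
  refine ⟨?_, fun x => ⟨?_, ?_⟩⟩
  · rw [ftInv_eq]
    apply VectorFourier.differentiable_fourierIntegral
    · simpa using (hb.continuous.integrable_of_hasCompactSupport hcs)
    · simpa using hint 1 0
  · simpa using hcomb 0 (by norm_num) x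
  · have := hcomb 1 le_rfl x
    rwa [norm_iteratedFDeriv_one] at this

noncomputable def dil (α β : ℝ) (x : ℝ × ℝ) : ℝ × ℝ := (α * x.1, β * x.2)

noncomputable def dilE {α β : ℝ} (hα : α ≠ 0) (hβ : β ≠ 0) : (ℝ × ℝ) ≃L[ℝ] (ℝ × ℝ) :=
  (ContinuousLinearEquiv.smulLeft (Units.mk0 α hα)).prodCongr (ContinuousLinearEquiv.smulLeft (Units.mk0 β hβ))

theorem dilE_apply {α β : ℝ} (hα : α ≠ 0) (hβ : β ≠ 0) (x) : dilE hα hβ x = dil α β x := by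
  simp [dilE, dil, Units.smul_def]

theorem dil_cont (α β : ℝ) : Continuous (dil α β) := by unfold dil; fun_prop

theorem dil_map {α β : ℝ} (hα : 0 < α) (hβ : 0 < β) :
    Measure.map (dil α β) volume = ENNReal.ofReal ((α * β)⁻¹) • (volume : Measure (ℝ × ℝ)) := by
  have h := Measure.map_linearMap_addHaar_eq_smul_addHaar (μ := (volume : Measure (ℝ × ℝ)))
    (f := LinearMap.prodMap (α • (LinearMap.id : ℝ →ₗ[ℝ] ℝ)) (β • (LinearMap.id : ℝ →ₗ[ℝ] ℝ)))
  rw [LinearMap.det_prodMap] at h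
  have e1 : ∀ c : ℝ, LinearMap.det (c • (LinearMap.id : ℝ →ₗ[ℝ] ℝ)) = c := by intro c; simp
  rw [e1, e1] at h
  have := h (by positivity)
  rw [abs_of_pos (by positivity)] at this
  rw [← this]
  congr 1

theorem dil_emb {α β : ℝ} (hα : 0 < α) (hβ : 0 < β) : MeasurableEmbedding (dil α β) := by
  have : dil α β = ((dilE hα.ne' hβ.ne').toHomeomorph.toMeasurableEquiv) := by
    ext x <;> simp [← dilE_apply hα.ne' hβ.ne']
  rw [this]; exact MeasurableEquiv.measurableEmbedding _

theorem lintegral_dil {α β : ℝ} (hα : 0 < α) (hβ : 0 < β) (g : ℝ × ℝ → ℝ≥0∞) :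
    ∫⁻ x, g (dil α β x) = ENNReal.ofReal ((α * β)⁻¹) * ∫⁻ x, g x := by
  rw [← (dil_emb hα hβ).lintegral_map, dil_map hα hβ, lintegral_smul_measure, smul_eq_mul]

theorem integral_dil {α β : ℝ} (hα : 0 < α) (hβ : 0 < β) (g : ℝ × ℝ → ℂ) :
    ∫ x, g (dil α β x) = ((α * β)⁻¹ : ℝ) * ∫ x, g x := by
  rw [← (dil_emb hα hβ).integral_map, dil_map hα hβ, integral_smul_measure, ENNReal.toReal_ofReal (by positivity)]
  simp

theorem ae_dil {α β : ℝ} (hα : 0 < α) (hβ : 0 < β) {P : ℝ × ℝ → Prop} (h : ∀ᵐ x, P x) : ∀ᵐ x, P (dil α β x) := by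
  have hq : Measure.QuasiMeasurePreserving (dil α β) volume volume := by
    refine ⟨(dil_cont α β).measurable, ?_⟩
    rw [dil_map hα hβ]
    exact Measure.smul_absolutelyContinuous
  exact hq.ae h

theorem dil_inv {α β : ℝ} (hα : α ≠ 0) (hβ : β ≠ 0) (x) : dil α⁻¹ β⁻¹ (dil α β x) = x := by
  unfold dil; ext <;> simp [hα, hβ]
theorem dil_inv' {α β : ℝ} (hα : α ≠ 0) (hβ : β ≠ 0) (x) : dil α β (dil α⁻¹ β⁻¹ x) = x := by
  unfold dil; ext <;> simp [hα, hβ]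
theorem dil_sub (α β : ℝ) (x y) : dil α β (x - y) = dil α β x - dil α β y := by
  unfold dil; ext <;> simp [mul_sub]

theorem norm_e (a b c d : ℝ) : ‖Complex.exp (2 * Real.pi * Complex.I * (a * b + c * d))‖ = 1 := by
  have := Complex.norm_exp_ofReal_mul_I (2 * Real.pi * (a * b + c * d))
  rw [← this]; congr 2; push_cast; ring

theorem norm_e' (a b c d : ℝ) : ‖Complex.exp (-2 * Real.pi * Complex.I * (a * b + c * d))‖ = 1 := by
  have := Complex.norm_exp_ofReal_mul_I (-2 * Real.pi * (a * b + c * d))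
  rw [← this]; congr 2; push_cast; ring

theorem ft_norm_le (f : ℝ × ℝ → ℂ) (ξ) : ‖ft f ξ‖ ≤ ∫ x, ‖f x‖ := by
  unfold ft
  refine (norm_integral_le_integral_norm _).trans (le_of_eq ?_)
  congr 1; ext x; rw [norm_mul, norm_e', one_mul]

theorem ftInv_norm_le (f : ℝ × ℝ → ℂ) (ξ) : ‖ftInv f ξ‖ ≤ ∫ x, ‖f x‖ := by
  unfold ftInv
  refine (norm_integral_le_integral_norm _).trans (le_of_eq ?_)
  congr 1; ext x; rw [norm_mul, norm_e, one_mul]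

theorem ft_cont {f : ℝ × ℝ → ℂ} (hf : Integrable f) : Continuous (ft f) := by
  unfold ft
  apply continuous_of_dominated (bound := fun x => ‖f x‖)
  · intro ξ
    exact (Continuous.aestronglyMeasurable (by fun_prop)).mul hf.1
  · intro ξ; exact ae_of_all _ fun x => by rw [norm_mul, norm_e', one_mul]
  · exact hf.norm
  · exact ae_of_all _ fun x => by fun_prop

theorem ftInv_cont {f : ℝ × ℝ → ℂ} (hf : Integrable f) : Continuous (ftInv f) := by
  unfold ftInv
  apply continuous_of_dominated (bound := fun x => ‖f x‖)
  · intro ξ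
    exact (Continuous.aestronglyMeasurable (by fun_prop)).mul hf.1
  · intro ξ; exact ae_of_all _ fun x => by rw [norm_mul, norm_e, one_mul]
  · exact hf.norm
  · exact ae_of_all _ fun x => by fun_prop

theorem ft_sub {f g : ℝ × ℝ → ℂ} (hf : Integrable f) (hg : Integrable g) (ξ) : ft (fun x => f x - g x) ξ = ft f ξ - ft g ξ := by
  unfold ft
  rw [← integral_sub]
  · congr 1; ext x; ring
  · exact hf.bdd_mul (c := 1) (Continuous.aestronglyMeasurable (by fun_prop)) (ae_of_all _ fun x => by rw [norm_e'])
  · exact hg.bdd_mul (c := 1) (Continuous.aestronglyMeasurable (by fun_prop)) (ae_of_all _ fun x => by rw [norm_e'])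

theorem ftInv_sub {f g : ℝ × ℝ → ℂ} (hf : Integrable f) (hg : Integrable g) (ξ) : ftInv (fun x => f x - g x) ξ = ftInv f ξ - ftInv g ξ := by
  unfold ftInv
  rw [← integral_sub]
  · congr 1; ext x; ring
  · exact hf.bdd_mul (c := 1) (Continuous.aestronglyMeasurable (by fun_prop)) (ae_of_all _ fun x => by rw [norm_e])
  · exact hg.bdd_mul (c := 1) (Continuous.aestronglyMeasurable (by fun_prop)) (ae_of_all _ fun x => by rw [norm_e])

theorem sym_int {b : ℝ × ℝ → ℂ} (hb : Continuous b) (hcs : HasCompactSupport b) {f : ℝ × ℝ → ℂ} (hf : Integrable f) :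
    Integrable (fun ξ => b ξ * ft f ξ) :=
  (hb.mul (ft_cont hf)).integrable_of_hasCompactSupport hcs.mul_right

theorem op_sub {b : ℝ × ℝ → ℂ} (hb : Continuous b) (hcs : HasCompactSupport b) {f g : ℝ × ℝ → ℂ} (hf : Integrable f) (hg : Integrable g) (x) :
    op b (fun y => f y - g y) x = op b f x - op b g x := by
  unfold op
  rw [← ftInv_sub (sym_int hb hcs hf) (sym_int hb hcs hg)]
  congr 1; ext ξ; rw [ft_sub hf hg]; ring

theorem op_cont {b : ℝ × ℝ → ℂ} (hb : Continuous b) (hcs : HasCompactSupport b) {f : ℝ × ℝ → ℂ} (hf : Integrable f) :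
    Continuous (op b f) := ftInv_cont (sym_int hb hcs hf)

theorem op_conv {b : ℝ × ℝ → ℂ} (hb : Continuous b) (hcs : HasCompactSupport b) {f : ℝ × ℝ → ℂ} (hf : Integrable f) (x : ℝ × ℝ) :
    op b f x = ∫ y, ftInv b (x - y) * f y := by
  have hbi : Integrable b := hb.integrable_of_hasCompactSupport hcs
  set H : ℝ × ℝ → ℝ × ℝ → ℂ := fun ξ y => Complex.exp (2 * Real.pi * Complex.I * (((x.1 - y.1 : ℝ) : ℂ) * ξ.1 + ((x.2 - y.2 : ℝ) : ℂ) * ξ.2)) * (b ξ * f y) with hH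
  have hint : Integrable (Function.uncurry H) (volume.prod volume) := by
    have h := hbi.mul_prod hf
    apply h.bdd_mul (c := 1)
    · apply Continuous.aestronglyMeasurable; fun_prop
    · exact ae_of_all _ fun z => by rw [norm_e]
  have h1 : op b f x = ∫ ξ, ∫ y, H ξ y := by
    unfold op ftInv ft
    congr 1; ext ξ
    dsimp only
    rw [← integral_const_mul, ← integral_const_mul]
    congr 1; ext y
    rw [hH]; dsimp only
    rw [show Complex.exp (2 * Real.pi * Complex.I * (((x.1 - y.1 : ℝ) : ℂ) * ξ.1 + ((x.2 - y.2 : ℝ) : ℂ) * ξ.2)) =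
      Complex.exp (2 * Real.pi * Complex.I * (x.1 * ξ.1 + x.2 * ξ.2)) * Complex.exp (-2 * Real.pi * Complex.I * (y.1 * ξ.1 + y.2 * ξ.2)) by
        rw [← Complex.exp_add]; congr 1; push_cast; ring]
    ring
  rw [h1, integral_integral_swap hint]
  congr 1; ext y
  unfold ftInv
  rw [← integral_mul_const]
  congr 1; ext ξ
  rw [hH]; simp only [Prod.fst_sub, Prod.snd_sub]; ring

theorem ftInv_dil {α β : ℝ} (hα : 0 < α) (hβ : 0 < β) (b : ℝ × ℝ → ℂ) (x) :
    ftInv (fun ξ => b (dil α β ξ)) x = ((α * β)⁻¹ : ℝ) * ftInv b (dil α⁻¹ β⁻¹ x) := by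
  unfold ftInv
  rw [← integral_dil hα hβ]
  congr 1; ext ξ
  congr 3
  unfold dil
  have h1 : (α : ℂ) ≠ 0 := by exact_mod_cast hα.ne'
  have h2 : (β : ℂ) ≠ 0 := by exact_mod_cast hβ.ne'
  push_cast; field_simp

theorem dil_cs {α β : ℝ} (hα : 0 < α) (hβ : 0 < β) {b : ℝ × ℝ → ℂ} (hcs : HasCompactSupport b) : HasCompactSupport (fun ξ => b (dil α β ξ)) := by
  have := hcs.comp_homeomorph (dilE hα.ne' hβ.ne').toHomeomorph
  convert this using 1
  ext x; simp [dilE_apply]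

theorem op_dil_conv {α β : ℝ} (hα : 0 < α) (hβ : 0 < β) {b : ℝ × ℝ → ℂ} (hb : Continuous b) (hcs : HasCompactSupport b) {f : ℝ × ℝ → ℂ} (hf : Integrable f) (x : ℝ × ℝ) :
    op (fun ξ => b (dil α β ξ)) f x = ((α * β)⁻¹ : ℝ) * ∫ y, ftInv b (dil α⁻¹ β⁻¹ (x - y)) * f y := by
  rw [op_conv (b := fun ξ => b (dil α β ξ)) (hb.comp (dil_cont α β)) (dil_cs hα hβ hcs) hf, ← integral_const_mul]
  congr 1; ext y
  rw [ftInv_dil hα hβ]; ring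

theorem int_dil {α β : ℝ} (hα : 0 < α) (hβ : 0 < β) {f : ℝ × ℝ → ℂ} (hf : Integrable f) : Integrable (fun y => f (dil α β y)) := by
  have : Integrable f (Measure.map (dil α β) volume) := by
    rw [dil_map hα hβ]; exact hf.smul_measure ENNReal.ofReal_ne_top
  exact (dil_emb hα hβ).integrable_map_iff.1 this

theorem op_dil {α β : ℝ} (hα : 0 < α) (hβ : 0 < β) {b : ℝ × ℝ → ℂ} (hb : Continuous b) (hcs : HasCompactSupport b) {f : ℝ × ℝ → ℂ} (hf : Integrable f) (x : ℝ × ℝ) :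
    op (fun ξ => b (dil α β ξ)) f x = op b (fun y => f (dil α β y)) (dil α⁻¹ β⁻¹ x) := by
  rw [op_dil_conv hα hβ hb hcs hf, op_conv hb hcs (int_dil hα hβ hf), ← integral_dil hα hβ]
  congr 1; ext y
  rw [dil_sub, dil_inv hα.ne' hβ.ne']

theorem gv_inv {A : ℝ} (hA : 0 < A) (d : ℕ) (s : ℤ) : (gv A d s)⁻¹ = ENNReal.ofReal (gX A s * gY d s) := by
  have := gX_pos hA s
  have := gY_pos d s
  unfold gv
  rw [ENNReal.ofReal_inv_of_pos (by positivity), inv_inv]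

theorem ker_to_gK {A : ℝ} (hA : 0 < A) (d : ℕ) (s : ℤ) (x : ℝ × ℝ) {q : ℝ × ℝ → ℂ} {D : ℝ} (hD : 0 ≤ D)
    (hq : ∀ y, ‖q y‖ ≤ D * (gX A s * gY d s) * (gk A d s x y)⁻¹ ^ 6) (f : ℝ × ℝ → ℂ) :
    ‖∫ y, q y * f y‖ₑ ≤ ENNReal.ofReal D * gK A d s (fun y => ‖f y‖ₑ) x := by
  have h1 := gX_pos hA s
  have h2 := gY_pos d s
  refine (enorm_integral_le_lintegral_enorm _).trans ?_
  unfold gK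
  rw [gv_inv hA, ← mul_assoc, ← ENNReal.ofReal_mul hD, ← lintegral_const_mul' _ _ ENNReal.ofReal_ne_top]
  apply lintegral_mono
  intro y
  dsimp only
  rw [enorm_mul, ← mul_assoc, ← ENNReal.ofReal_mul (by positivity)]
  gcongr
  rw [← ofReal_norm_eq_enorm]
  exact ENNReal.ofReal_le_ofReal (hq y)

structure ScOK (A : ℝ) (d : ℕ) (s : ℤ) (α β b B : ℝ) : Prop where
  hα : 0 < α
  hβ : 0 < β
  xl : b ≤ gX A s * α
  xu : gX A s * α ≤ B
  yl : b ≤ gY d s * β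
  yu : gY d s * β ≤ B

theorem sc_inv {A : ℝ} (hA : 0 < A) {d : ℕ} {s : ℤ} {α β b B : ℝ} (hb : 0 < b) (h : ScOK A d s α β b B) :
    (α * β)⁻¹ ≤ b⁻¹ ^ 2 * (gX A s * gY d s) := by
  have h1 := gX_pos hA s
  have h2 := gY_pos d s
  have h3 := h.hα
  have h4 := h.hβ
  rw [inv_pow, inv_mul_eq_div, le_div_iff₀ (by positivity), inv_mul_le_iff₀ (by positivity)]
  calc b ^ 2 = b * b := by ring
    _ ≤ (gX A s * α) * (gY d s * β) := by gcongr; exact h.xl; exact h.yl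
    _ = _ := by ring

theorem sc_gk {A : ℝ} (hA : 0 < A) {d : ℕ} {s : ℤ} {α β b B : ℝ} (hB : 1 ≤ B) (h : ScOK A d s α β b B) (x y : ℝ × ℝ) :
    gk A d s x y ≤ B * (1 + |(dil α⁻¹ β⁻¹ (x - y)).1| + |(dil α⁻¹ β⁻¹ (x - y)).2|) := by
  have h3 := h.hα
  have h4 := h.hβ
  unfold gk dil
  simp only [Prod.fst_sub, Prod.snd_sub, abs_mul, abs_inv, abs_of_pos h3, abs_of_pos h4]
  have e1 : gX A s * |x.1 - y.1| = gX A s * α * (α⁻¹ * |x.1 - y.1|) := by field_simp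
  have e2 : gY d s * |x.2 - y.2| = gY d s * β * (β⁻¹ * |x.2 - y.2|) := by field_simp
  rw [e1, e2, mul_add, mul_add, mul_one]
  gcongr
  · exact h.xu
  · exact h.yu

theorem sc_pow {A : ℝ} (hA : 0 < A) {d : ℕ} {s : ℤ} {α β b B : ℝ} (hB : 1 ≤ B) (h : ScOK A d s α β b B) (x y : ℝ × ℝ) {n M : ℝ}
    (hM : 0 ≤ M) (hn : (1 + |(dil α⁻¹ β⁻¹ (x - y)).1| + |(dil α⁻¹ β⁻¹ (x - y)).2|) ^ 6 * n ≤ M) :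
    n ≤ M * B ^ 6 * (gk A d s x y)⁻¹ ^ 6 := by
  have hg := gk_one_le hA d s x y
  have h1 := sc_gk hA hB h x y
  set W := 1 + |(dil α⁻¹ β⁻¹ (x - y)).1| + |(dil α⁻¹ β⁻¹ (x - y)).2| with hW
  have hW0 : 0 < W := by positivity
  rw [inv_pow, ← div_eq_mul_inv, le_div_iff₀ (by positivity)]
  rcases le_total n 0 with hn0 | hn0
  · exact (mul_nonpos_of_nonpos_of_nonneg hn0 (by positivity)).trans (by positivity)
  calc n * gk A d s x y ^ 6 ≤ n * (B * W) ^ 6 := by gcongr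
    _ = W ^ 6 * n * B ^ 6 := by ring
    _ ≤ _ := by gcongr

theorem ker_one {A : ℝ} (hA : 0 < A) {d : ℕ} {s : ℤ} {α β b B : ℝ} (hb0 : 0 < b) (hB : 1 ≤ B) (h : ScOK A d s α β b B)
    {a : ℝ × ℝ → ℂ} (ha : Continuous a) (hcs : HasCompactSupport a) {M : ℝ} (hM : 0 ≤ M)
    (hκ : ∀ x : ℝ × ℝ, (1 + |x.1| + |x.2|) ^ 6 * ‖ftInv a x‖ ≤ M) {f : ℝ × ℝ → ℂ} (hf : Integrable f) (x : ℝ × ℝ) :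
    ‖op (fun ξ => a (dil α β ξ)) f x‖ₑ ≤ ENNReal.ofReal (b⁻¹ ^ 2 * B ^ 6 * M) * gK A d s (fun y => ‖f y‖ₑ) x := by
  have h1 := gX_pos hA s
  have h2 := gY_pos d s
  have h3 := h.hα
  have h4 := h.hβ
  rw [op_dil_conv h.hα h.hβ ha hcs hf, ← integral_const_mul]
  simp_rw [← mul_assoc]
  apply ker_to_gK hA d s x (by positivity)
  intro y
  have hg := gk_one_le hA d s x y
  rw [norm_mul, Complex.norm_real, Real.norm_of_nonneg (by positivity)]
  calc _ ≤ (b⁻¹ ^ 2 * (gX A s * gY d s)) * (M * B ^ 6 * (gk A d s x y)⁻¹ ^ 6) := by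
        gcongr
        · exact sc_inv hA hb0 h
        · exact sc_pow hA hB h x y hM (hκ _)
    _ = _ := by ring

theorem gp_gap {A : ℝ} (hA : 0 < A) {d : ℕ} (hd : 1 ≤ d) {s j : ℤ} (hj : s ≤ j) {α β b B : ℝ} (hb0 : 0 < b) (h : ScOK A d s α β b B)
    {x x' : ℝ × ℝ} (hx : gp A d j x = gp A d j x') :
    |(dil α⁻¹ β⁻¹ x').1 - (dil α⁻¹ β⁻¹ x).1| ≤ b⁻¹ * 2 ^ (-(j - s)) ∧ |(dil α⁻¹ β⁻¹ x').2 - (dil α⁻¹ β⁻¹ x).2| ≤ b⁻¹ * 2 ^ (-(j - s)) := by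
  have h1 := gX_pos hA s
  have h2 := gY_pos d s
  have h3 := h.hα
  have h4 := h.hβ
  have h5 := gX_pos hA j
  have h6 := gY_pos d j
  unfold gp at hx
  rw [Prod.mk.injEq] at hx
  have g1 := (Int.abs_sub_lt_one_of_floor_eq_floor hx.1).le
  have g2 := (Int.abs_sub_lt_one_of_floor_eq_floor hx.2).le
  rw [← mul_sub, abs_mul, abs_of_pos (by assumption), abs_sub_comm] at g1 g2
  unfold dil
  simp only [← mul_sub, abs_mul, abs_inv, abs_of_pos h3, abs_of_pos h4]
  have r1 : gX A s = gX A j * 2 ^ (-(j - s)) := by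
    unfold gX; rw [mul_assoc, ← zpow_add₀ (by norm_num)]; congr 2; ring
  have r2 : gY d s ≤ gY d j * 2 ^ (-(j - s)) := by
    unfold gY
    rw [show (2 : ℝ) ^ d = (2 : ℝ) ^ (d : ℤ) by rw [zpow_natCast], ← zpow_mul, ← zpow_mul, ← zpow_add₀ (by norm_num)]
    apply zpow_le_zpow_right₀ (by norm_num)
    have : (1 : ℤ) ≤ d := by exact_mod_cast hd
    nlinarith
  constructor
  · rw [inv_mul_eq_div, inv_mul_eq_div, div_le_div_iff₀ h3 hb0]
    calc |x'.1 - x.1| * b ≤ |x'.1 - x.1| * (gX A s * α) := by gcongr; exact h.xl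
      _ = (gX A j * |x'.1 - x.1|) * (2 ^ (-(j - s)) * α) := by rw [r1]; ring
      _ ≤ 1 * (2 ^ (-(j - s)) * α) := by gcongr
      _ = _ := by ring
  · rw [inv_mul_eq_div, inv_mul_eq_div, div_le_div_iff₀ h4 hb0]
    calc |x'.2 - x.2| * b ≤ |x'.2 - x.2| * (gY d s * β) := by gcongr; exact h.yl
      _ ≤ |x'.2 - x.2| * ((gY d j * 2 ^ (-(j - s))) * β) := by gcongr
      _ = (gY d j * |x'.2 - x.2|) * (2 ^ (-(j - s)) * β) := by ring
      _ ≤ 1 * (2 ^ (-(j - s)) * β) := by gcongr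
      _ = _ := by ring

theorem mean_dec {κ : ℝ × ℝ → ℂ} (hd : Differentiable ℝ κ) {M : ℝ} (hM : 0 ≤ M)
    (hκ : ∀ x : ℝ × ℝ, (1 + |x.1| + |x.2|) ^ 6 * ‖fderiv ℝ κ x‖ ≤ M) {r : ℝ} (hr : 0 < r) {w w' : ℝ × ℝ} {θ : ℝ}
    (hθ : θ ≤ r) (h1 : |w'.1 - w.1| ≤ θ) (h2 : |w'.2 - w.2| ≤ θ) :
    (1 + |w.1| + |w.2|) ^ 6 * ‖κ w' - κ w‖ ≤ M * (1 + 2 * r) ^ 6 * θ := by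
  have hθ0 : 0 ≤ θ := (abs_nonneg _).trans h1
  have hn : ‖w' - w‖ ≤ θ := by
    rw [Prod.norm_def]; exact max_le h1 h2
  set W := 1 + |w.1| + |w.2| with hW
  have hW0 : 0 < W := by positivity
  have hb : ∀ z ∈ Metric.closedBall w r, ‖fderiv ℝ κ z‖ ≤ M * (1 + 2 * r) ^ 6 / W ^ 6 := by
    intro z hz
    rw [Metric.mem_closedBall, dist_eq_norm, Prod.norm_def] at hz
    have z1 : |z.1 - w.1| ≤ r := (le_max_left _ _).trans hz
    have z2 : |z.2 - w.2| ≤ r := (le_max_right _ _).trans hz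
    have z3 : |w.1| ≤ |z.1| + r := by
      have := abs_sub_abs_le_abs_sub w.1 z.1
      rw [abs_sub_comm] at this; linarith
    have z4 : |w.2| ≤ |z.2| + r := by
      have := abs_sub_abs_le_abs_sub w.2 z.2
      rw [abs_sub_comm] at this; linarith
    have z5 : W ≤ (1 + 2 * r) * (1 + |z.1| + |z.2|) := by
      rw [hW]; nlinarith [mul_nonneg hr.le (abs_nonneg z.1), mul_nonneg hr.le (abs_nonneg z.2)]
    rw [le_div_iff₀ (by positivity)]
    calc _ ≤ ‖fderiv ℝ κ z‖ * ((1 + 2 * r) * (1 + |z.1| + |z.2|)) ^ 6 := by gcongr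
      _ = ((1 + |z.1| + |z.2|) ^ 6 * ‖fderiv ℝ κ z‖) * (1 + 2 * r) ^ 6 := by ring
      _ ≤ _ := by gcongr; exact hκ z
  have := (convex_closedBall w r).norm_image_sub_le_of_norm_fderiv_le (fun z _ => hd z) hb (Metric.mem_closedBall_self hr.le)
    (show w' ∈ Metric.closedBall w r by rw [Metric.mem_closedBall, dist_eq_norm]; exact hn.trans hθ)
  calc W ^ 6 * ‖κ w' - κ w‖ ≤ W ^ 6 * (M * (1 + 2 * r) ^ 6 / W ^ 6 * θ) := by gcongr; exact this.trans (by gcongr)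
    _ = _ := by field_simp

theorem osc_one {A : ℝ} (hA : 0 < A) {d : ℕ} (hd : 1 ≤ d) {s j : ℤ} (hj : s ≤ j) {α β b B : ℝ} (hb0 : 0 < b) (hB : 1 ≤ B) (h : ScOK A d s α β b B)
    {a : ℝ × ℝ → ℂ} (ha : Continuous a) (hcs : HasCompactSupport a) {M : ℝ} (hM : 0 ≤ M)
    (hdiff : Differentiable ℝ (ftInv a))
    (hκ : ∀ x : ℝ × ℝ, (1 + |x.1| + |x.2|) ^ 6 * ‖fderiv ℝ (ftInv a) x‖ ≤ M) {f : ℝ × ℝ → ℂ} (hf : Integrable f) {x x' : ℝ × ℝ}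
    (hx : gp A d j x = gp A d j x') :
    ‖op (fun ξ => a (dil α β ξ)) f x' - op (fun ξ => a (dil α β ξ)) f x‖ₑ ≤
      ENNReal.ofReal (b⁻¹ ^ 3 * B ^ 6 * (1 + 2 * b⁻¹) ^ 6 * M * 2 ^ (-(j - s))) * gK A d s (fun y => ‖f y‖ₑ) x := by
  have h1 := gX_pos hA s
  have h2 := gY_pos d s
  have h3 := h.hα
  have h4 := h.hβ
  have hai := ha.integrable_of_hasCompactSupport (μ := volume) hcs
  have hi : ∀ x, Integrable (fun y => ftInv a (dil α⁻¹ β⁻¹ (x - y)) * f y) := by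
    intro x
    apply hf.bdd_mul (c := ∫ ξ, ‖a ξ‖)
    · exact ((ftInv_cont hai).comp ((dil_cont _ _).comp (continuous_const.sub continuous_id))).aestronglyMeasurable
    · exact ae_of_all _ fun y => ftInv_norm_le _ _
  rw [op_dil_conv h.hα h.hβ ha hcs hf, op_dil_conv h.hα h.hβ ha hcs hf, ← mul_sub, ← integral_sub (hi x') (hi x), ← integral_const_mul]
  simp_rw [← sub_mul, ← mul_assoc]
  apply ker_to_gK hA d s x (by positivity)
  intro y
  have hg := gk_one_le hA d s x y
  have hgap := gp_gap hA hd hj hb0 h hx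
  have hle : b⁻¹ * (2 : ℝ) ^ (-(j - s)) ≤ b⁻¹ := by
    apply mul_le_of_le_one_right (by positivity)
    exact zpow_le_one_of_nonpos₀ (by norm_num) (by omega)
  have hm := mean_dec hdiff hM hκ (r := b⁻¹) (by positivity) (w := dil α⁻¹ β⁻¹ (x - y)) (w' := dil α⁻¹ β⁻¹ (x' - y)) hle
    (by rw [dil_sub, dil_sub, Prod.fst_sub, Prod.fst_sub, sub_sub_sub_cancel_right]; exact hgap.1)
    (by rw [dil_sub, dil_sub, Prod.snd_sub, Prod.snd_sub, sub_sub_sub_cancel_right]; exact hgap.2)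
  rw [norm_mul, Complex.norm_real, Real.norm_of_nonneg (by positivity)]
  calc _ ≤ (b⁻¹ ^ 2 * (gX A s * gY d s)) * (M * (1 + 2 * b⁻¹) ^ 6 * (b⁻¹ * 2 ^ (-(j - s))) * B ^ 6 * (gk A d s x y)⁻¹ ^ 6) := by
        gcongr
        · exact sc_inv hA hb0 h
        · exact sc_pow hA hB h x y (by positivity) hm
    _ = _ := by ring

section FTE
open scoped FourierTransform SchwartzMap

noncomputable def eL : WithLp 2 (ℝ × ℝ) ≃L[ℝ] ℝ × ℝ := WithLp.prodContinuousLinearEquiv 2 ℝ ℝ ℝ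

noncomputable def toE (f : 𝓢(ℝ × ℝ, ℂ)) : 𝓢(WithLp 2 (ℝ × ℝ), ℂ) := SchwartzMap.compCLMOfContinuousLinearEquiv ℂ eL f
noncomputable def ofE (f : 𝓢(WithLp 2 (ℝ × ℝ), ℂ)) : 𝓢(ℝ × ℝ, ℂ) := SchwartzMap.compCLMOfContinuousLinearEquiv ℂ eL.symm f

theorem toE_apply (f : 𝓢(ℝ × ℝ, ℂ)) (w : WithLp 2 (ℝ × ℝ)) : toE f w = f (WithLp.ofLp w) := rfl
theorem ofE_apply (f : 𝓢(WithLp 2 (ℝ × ℝ), ℂ)) (w : ℝ × ℝ) : ofE f w = f (WithLp.toLp 2 w) := rfl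

theorem lint_E (g : ℝ × ℝ → ℝ≥0∞) : ∫⁻ w : WithLp 2 (ℝ × ℝ), g (WithLp.ofLp w) = ∫⁻ x, g x :=
  (WithLp.volume_preserving_symm_measurableEquiv_toLp_prod ℝ ℝ).lintegral_comp_emb (MeasurableEquiv.measurableEmbedding _) g

theorem int_E (g : ℝ × ℝ → ℂ) : ∫ w : WithLp 2 (ℝ × ℝ), g (WithLp.ofLp w) = ∫ x, g x :=
  (WithLp.volume_preserving_symm_measurableEquiv_toLp_prod ℝ ℝ).integral_comp (MeasurableEquiv.measurableEmbedding _) g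

theorem fourier_toE (f : 𝓢(ℝ × ℝ, ℂ)) (w : WithLp 2 (ℝ × ℝ)) : 𝓕 (toE f) w = ft f (WithLp.ofLp w) := by
  rw [SchwartzMap.fourier_coe, Real.fourier_eq']
  unfold ft
  rw [← int_E]
  congr 1; ext v
  rw [smul_eq_mul, toE_apply, WithLp.prod_inner_apply]
  congr 2
  simp only [RCLike.inner_apply, conj_trivial]
  push_cast
  ring

theorem schwartz_plancherel_E (f : 𝓢(WithLp 2 (ℝ × ℝ), ℂ)) : ∫⁻ w, ‖𝓕 f w‖ₑ ^ (2 : ℝ) = ∫⁻ w, ‖f w‖ₑ ^ (2 : ℝ) := by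
  have h := SchwartzMap.integral_norm_sq_fourier f
  have h1 : ∀ g : 𝓢(WithLp 2 (ℝ × ℝ), ℂ), ∫⁻ w, ‖g w‖ₑ ^ (2 : ℝ) = ENNReal.ofReal (∫ w, ‖g w‖ ^ 2) := by
    intro g
    rw [ofReal_integral_eq_lintegral_ofReal ((g.memLp 2 volume).integrable_norm_pow (by norm_num)) (ae_of_all _ fun x => by positivity)]
    congr 1; ext w
    rw [← ofReal_norm_eq_enorm, ENNReal.ofReal_pow (norm_nonneg _)]
    norm_cast
  rw [h1, h1, h]

theorem plancherel (f : 𝓢(ℝ × ℝ, ℂ)) : ∫⁻ ξ, ‖ft f ξ‖ₑ ^ (2 : ℝ) = ∫⁻ x, ‖f x‖ₑ ^ (2 : ℝ) := by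
  rw [← lint_E, ← lint_E (fun x => ‖f x‖ₑ ^ (2 : ℝ))]
  have := schwartz_plancherel_E (toE f)
  simp_rw [fourier_toE, toE_apply] at this
  exact this

theorem lp_piece (f : 𝓢(ℝ × ℝ, ℂ)) (χ : ℝ × ℝ → ℂ) (hχ : ContDiff ℝ (⊤ : ℕ∞) χ) (hc : HasCompactSupport χ) :
    ∃ g : 𝓢(ℝ × ℝ, ℂ), ∀ ξ, ft g ξ = χ ξ * ft f ξ := by
  have hft : ft f = ofE (𝓕 (toE f)) := by
    ext ξ; rw [ofE_apply, fourier_toE]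
  have hsm : ContDiff ℝ (⊤ : ℕ∞) (fun ξ => χ ξ * ft f ξ) := by
    rw [hft]; exact hχ.mul ((ofE (𝓕 (toE f))).smooth ⊤)
  let h : 𝓢(ℝ × ℝ, ℂ) := HasCompactSupport.toSchwartzMap (hc.mul_right (f' := ft f)) hsm
  have hh : ∀ ξ, h ξ = χ ξ * ft f ξ := fun ξ => rfl
  refine ⟨ofE (𝓕⁻ (toE h)), fun ξ => ?_⟩
  have h1 : toE (ofE (𝓕⁻ (toE h))) = 𝓕⁻ (toE h) := by ext w; rfl
  have := fourier_toE (ofE (𝓕⁻ (toE h))) (WithLp.toLp 2 ξ)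
  rw [h1, FourierTransform.fourier_fourierInv_eq] at this
  rw [← hh]
  exact this.symm

end FTE

theorem bump_exists {K₁ K₂ : Set ℝ} (hK₁ : IsCompact K₁) (hK₂ : IsCompact K₂) (hK₂0 : (0 : ℝ) ∉ K₂) :
    ∃ χ : ℝ × ℝ → ℂ, ∃ r R : ℝ, 0 < r ∧ r ≤ R ∧ ContDiff ℝ (⊤ : ℕ∞) χ ∧ HasCompactSupport χ ∧ (∀ ξ, ‖χ ξ‖ ≤ 1) ∧
      (∀ ξ ∈ K₁ ×ˢ K₂, χ ξ = 1) ∧ ∀ ξ, χ ξ ≠ 0 → r ≤ |ξ.2| ∧ |ξ.2| ≤ R := by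
  obtain ⟨R, hR0, hR⟩ : ∃ R : ℝ, 0 < R ∧ ∀ ξ ∈ K₁ ×ˢ K₂, ‖ξ‖ < R := by
    obtain ⟨R, h0, hR⟩ := ((hK₁.prod hK₂).isBounded).exists_pos_norm_lt
    exact ⟨R, h0, hR⟩
  obtain ⟨r, hr0, hr⟩ : ∃ r : ℝ, 0 < r ∧ ∀ y ∈ K₂, r < |y| := by
    have : K₂ᶜ ∈ nhds (0 : ℝ) := hK₂.isClosed.isOpen_compl.mem_nhds hK₂0
    obtain ⟨ε, hε, hb⟩ := Metric.mem_nhds_iff.1 this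
    refine ⟨ε / 2, by positivity, fun y hy => ?_⟩
    by_contra hc
    push Not at hc
    exact hb (by rw [Metric.mem_ball, dist_zero_right, Real.norm_eq_abs]; linarith) hy
  have hU : IsOpen {ξ : ℝ × ℝ | ‖ξ‖ < R ∧ r < |ξ.2|} := by
    apply IsOpen.inter
    · exact isOpen_lt continuous_norm continuous_const
    · exact isOpen_lt continuous_const (continuous_snd.abs)
  obtain ⟨g, h0, h1, h2⟩ := exists_contMDiffMap_zero_one_of_isClosed (n := (⊤ : ℕ∞)) (modelWithCornersSelf ℝ (ℝ × ℝ)) hU.isClosed_compl (hK₁.prod hK₂).isClosed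
    (by
      rw [Set.disjoint_left]
      intro ξ h1 h2
      exact h1 ⟨hR ξ h2, hr _ h2.2⟩)
  have hz : ∀ ξ, g ξ ≠ 0 → ‖ξ‖ < R ∧ r < |ξ.2| := by
    intro ξ hξ
    by_contra hc
    exact hξ (h0 hc)
  refine ⟨fun ξ => (g ξ : ℂ), r, max r R, hr0, le_max_left _ _, ?_, ?_, ?_, ?_, ?_⟩
  · exact Complex.ofRealCLM.contDiff.comp g.contMDiff.contDiff
  · apply HasCompactSupport.intro (isCompact_closedBall (0 : ℝ × ℝ) R)
    intro x hx
    by_contra hc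
    have := hz x (by simpa using hc)
    apply hx
    rw [Metric.mem_closedBall, dist_zero_right]
    exact this.1.le
  · intro ξ
    rw [Complex.norm_real, Real.norm_of_nonneg (h2 ξ).1]
    exact (h2 ξ).2
  · intro ξ hξ
    show ((g ξ : ℝ) : ℂ) = 1
    rw [h1 hξ]; simp
  · intro ξ hξ
    have := hz ξ (by simpa using hξ)
    exact ⟨this.2.le, ((norm_snd_le ξ).trans this.1.le).trans (le_max_right _ _)⟩

theorem overlap {r R : ℝ} (hr : 0 < r) (hR : r ≤ R) : ∃ n : ℕ, 1 ≤ n ∧ ∀ y : ℝ, ∀ c : ℤ → ℝ≥0∞, (∀ k, c k ≤ 1) →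
    (∀ k, c k ≠ 0 → r ≤ |(2 : ℝ) ^ (-k) * y| ∧ |(2 : ℝ) ^ (-k) * y| ≤ R) → ∑' k, c k ≤ n := by
  obtain ⟨m, hm⟩ := pow_unbounded_of_one_lt (R / r) (one_lt_two)
  refine ⟨2 * m + 1, by omega, ?_⟩
  intro y c hc1 hc
  by_cases h : ∃ k0, c k0 ≠ 0
  swap
  · push Not at h
    simp [h]
  obtain ⟨k0, hk0⟩ := h
  have key : ∀ k k', c k ≠ 0 → c k' ≠ 0 → k ≤ k' + m := by
    intro k k' h1 h2
    by_contra hlt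
    push Not at hlt
    have a1 := (hc k h1).1
    have a2 := (hc k' h2).2
    rw [abs_mul, abs_of_pos (by positivity)] at a1 a2
    have hy : 0 < |y| := by
      by_contra hy
      have : |y| = 0 := le_antisymm (not_lt.1 hy) (abs_nonneg y)
      rw [this] at a1; linarith
    have e : (2 : ℝ) ^ (-k') = 2 ^ (-k) * 2 ^ (k - k') := by
      rw [← zpow_add₀ (by norm_num)]; congr 1; ring
    have e2 : (2 : ℝ) ^ m ≤ 2 ^ (k - k') := by
      rw [← zpow_natCast]; exact zpow_le_zpow_right₀ (by norm_num) (by omega)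
    have : R < R := by
      calc R < 2 ^ m * r := by rwa [div_lt_iff₀ hr] at hm
        _ ≤ 2 ^ (k - k') * (2 ^ (-k) * |y|) := by gcongr
        _ = 2 ^ (-k') * |y| := by rw [e]; ring
        _ ≤ R := a2
    exact lt_irrefl _ this
  have : ∑' k, c k = ∑ k ∈ Finset.Icc (k0 - m) (k0 + m), c k := by
    apply tsum_eq_sum
    intro k hk
    by_contra hne
    apply hk
    rw [Finset.mem_Icc]
    exact ⟨by have := key k0 k hk0 hne; omega, by have := key k k0 hne hk0; omega⟩
  rw [this]
  refine (Finset.sum_le_card_nsmul _ _ 1 (fun k _ => hc1 k)).trans ?_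
  rw [Int.card_Icc, nsmul_eq_mul, mul_one]
  norm_cast
  omega

theorem eLp_pow {p : ℝ} (hp : 0 < p) {E : Type*} [NormedAddCommGroup E] (h : ℝ × ℝ → E) :
    eLpNorm h (ENNReal.ofReal p) volume ^ p = ∫⁻ x, ‖h x‖ₑ ^ p := by
  rw [eLpNorm_eq_lintegral_rpow_enorm_toReal (by simpa using hp) ENNReal.ofReal_ne_top, ENNReal.toReal_ofReal hp.le,
    ← ENNReal.rpow_mul, one_div, inv_mul_cancel₀ hp.ne', ENNReal.rpow_one]

noncomputable def SS (I : Set ℝ) (b : ℝ → ℝ × ℝ → ℂ) (f : ℝ × ℝ → ℂ) (x : ℝ × ℝ) : ℝ≥0∞ :=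
  ⨆ u : I, ‖op (b u) f x‖ₑ

theorem SS_le_real {I : Set ℝ} {b : ℝ → ℝ × ℝ → ℂ} {f : ℝ × ℝ → ℂ} {M : ℝ} (hM : ∀ u : I, ∀ x, ‖op (b u) f x‖ ≤ M) (x : ℝ × ℝ) :
    SS I b f x ≤ ‖⨆ u : I, ‖op (b u) f x‖‖ₑ := by
  unfold SS
  apply iSup_le
  intro u
  rw [enorm_le_iff_norm_le]
  refine le_trans ?_ (le_abs_self _)
  refine le_ciSup (f := fun u : I => ‖op (b u) f x‖) ⟨M, ?_⟩ u
  rintro _ ⟨u, rfl⟩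
  exact hM u x

theorem op_bdd {b : ℝ × ℝ → ℂ} (hb : Continuous b) (hcs : HasCompactSupport b) {M : ℝ} (hM : ∀ x, ‖ftInv b x‖ ≤ M)
    {f : ℝ × ℝ → ℂ} (hf : Integrable f) (x : ℝ × ℝ) : ‖op b f x‖ ≤ M * ∫ y, ‖f y‖ := by
  rw [op_conv hb hcs hf, ← integral_const_mul]
  apply norm_integral_le_of_norm_le (hf.norm.const_mul M)
  refine ae_of_all _ fun y => ?_
  rw [norm_mul]
  exact mul_le_mul_of_nonneg_right (hM _) (norm_nonneg _)

noncomputable def dilS {α β : ℝ} (hα : 0 < α) (hβ : 0 < β) (f : SchwartzMap (ℝ × ℝ) ℂ) : SchwartzMap (ℝ × ℝ) ℂ :=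
  SchwartzMap.compCLMOfContinuousLinearEquiv ℂ (dilE hα.ne' hβ.ne') f

theorem dilS_apply {α β : ℝ} (hα : 0 < α) (hβ : 0 < β) (f : SchwartzMap (ℝ × ℝ) ℂ) (x) : dilS hα hβ f x = f (dil α β x) := by
  unfold dilS
  rw [SchwartzMap.compCLMOfContinuousLinearEquiv_apply, Function.comp_apply, dilE_apply]

section one
variable {I : Set ℝ} {b : ℝ → ℝ × ℝ → ℂ} {M F : ℝ} {α β : ℝ}

theorem SS_dil (hα : 0 < α) (hβ : 0 < β) (hb : ∀ u, Continuous (b u)) (hcs : ∀ u, HasCompactSupport (b u))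
    (f : SchwartzMap (ℝ × ℝ) ℂ) (x) :
    SS I (fun u ξ => b u (dil α β ξ)) f x = SS I b (dilS hα hβ f) (dil α⁻¹ β⁻¹ x) := by
  unfold SS
  congr 1; ext u
  rw [op_dil hα hβ (hb u) (hcs u) f.integrable]
  congr 3

theorem SS_linf (hα : 0 < α) (hβ : 0 < β) (hF : 0 ≤ F) (hb : ∀ u, Continuous (b u)) (hcs : ∀ u, HasCompactSupport (b u))
    (hM : ∀ u : I, ∀ x, ‖ftInv (b u) x‖ ≤ M)
    (hyp : ∀ f : SchwartzMap (ℝ × ℝ) ℂ, eLpNorm (fun x => ⨆ u : I, ‖op (b u) f x‖) ⊤ volume ≤ ENNReal.ofReal F * eLpNorm f ⊤ volume)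
    (f : SchwartzMap (ℝ × ℝ) ℂ) {L : ℝ} (hL : ∀ x, ‖f x‖ ≤ L) :
    ∀ᵐ x, SS I (fun u ξ => b u (dil α β ξ)) f x ≤ ENNReal.ofReal (F * L) := by
  have h1 := hyp (dilS hα hβ f)
  rw [eLpNorm_exponent_top, eLpNorm_exponent_top] at h1
  have h2 : eLpNormEssSup (dilS hα hβ f) volume ≤ ENNReal.ofReal L := by
    apply eLpNormEssSup_le_of_ae_bound
    exact ae_of_all _ fun x => by rw [dilS_apply]; exact hL _
  have h3 : ∀ᵐ x, SS I b (dilS hα hβ f) x ≤ ENNReal.ofReal (F * L) := by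
    filter_upwards [ae_le_eLpNormEssSup (f := fun x => ⨆ u : I, ‖op (b u) (dilS hα hβ f) x‖) (μ := volume)] with x hx
    refine (SS_le_real (fun u x => op_bdd (hb u) (hcs u) (hM u) (dilS hα hβ f).integrable x) x).trans (hx.trans (h1.trans ?_))
    rw [ENNReal.ofReal_mul hF]
    exact mul_le_mul_right h2 _
  filter_upwards [ae_dil (inv_pos.2 hα) (inv_pos.2 hβ) h3] with x hx
  rw [SS_dil hα hβ hb hcs]
  exact hx

theorem SS_l2 (hα : 0 < α) (hβ : 0 < β) (hb : ∀ u, Continuous (b u)) (hcs : ∀ u, HasCompactSupport (b u))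
    (hM : ∀ u : I, ∀ x, ‖ftInv (b u) x‖ ≤ M)
    (hyp : ∀ f : SchwartzMap (ℝ × ℝ) ℂ, eLpNorm (fun x => ⨆ u : I, ‖op (b u) f x‖) 2 volume ≤ ENNReal.ofReal F * eLpNorm f 2 volume)
    (f : SchwartzMap (ℝ × ℝ) ℂ) :
    ∫⁻ x, SS I (fun u ξ => b u (dil α β ξ)) f x ^ (2 : ℝ) ≤ ENNReal.ofReal F ^ (2 : ℝ) * ∫⁻ x, ‖f x‖ₑ ^ (2 : ℝ) := by
  have h1 := ENNReal.rpow_le_rpow (hyp (dilS hα hβ f)) (zero_le_two (α := ℝ))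
  rw [ENNReal.mul_rpow_of_nonneg _ _ zero_le_two, show (2 : ℝ≥0∞) = ENNReal.ofReal 2 by simp, eLp_pow two_pos, eLp_pow two_pos] at h1
  have e : ∀ x, SS I (fun u ξ => b u (dil α β ξ)) f x = SS I b (dilS hα hβ f) (dil α⁻¹ β⁻¹ x) := fun x => SS_dil hα hβ hb hcs f x
  simp_rw [e]
  rw [lintegral_dil (inv_pos.2 hα) (inv_pos.2 hβ) (fun x => SS I b (dilS hα hβ f) x ^ (2 : ℝ))]
  have h2 : ∫⁻ x, SS I b (dilS hα hβ f) x ^ (2 : ℝ) ≤ ENNReal.ofReal F ^ (2 : ℝ) * ∫⁻ x, ‖dilS hα hβ f x‖ₑ ^ (2 : ℝ) := by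
    refine le_trans (lintegral_mono fun x => ?_) h1
    exact ENNReal.rpow_le_rpow (SS_le_real (fun u x => op_bdd (hb u) (hcs u) (hM u) (dilS hα hβ f).integrable x) x) zero_le_two
  simp_rw [dilS_apply] at h2
  rw [lintegral_dil hα hβ (fun x => ‖f x‖ₑ ^ (2 : ℝ))] at h2
  refine (mul_le_mul_right h2 _).trans (le_of_eq ?_)
  rw [mul_left_comm, ← mul_assoc (ENNReal.ofReal _) (ENNReal.ofReal ((α * β)⁻¹)), ← ENNReal.ofReal_mul (by positivity)]
  rw [show (α⁻¹ * β⁻¹)⁻¹ * (α * β)⁻¹ = 1 by field_simp, ENNReal.ofReal_one, one_mul]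

theorem SS_sub (hb : ∀ u, Continuous (b u)) (hcs : ∀ u, HasCompactSupport (b u)) (f g : SchwartzMap (ℝ × ℝ) ℂ) (x) :
    SS I b f x ≤ SS I b g x + SS I b (f - g : SchwartzMap (ℝ × ℝ) ℂ) x := by
  unfold SS
  apply iSup_le
  intro u
  have e : op (b u) (⇑(f - g)) x = op (b u) f x - op (b u) g x := op_sub (hb u) (hcs u) f.integrable g.integrable x
  have h : ‖op (b u) f x‖ₑ ≤ ‖op (b u) g x‖ₑ + ‖op (b u) (⇑(f - g)) x‖ₑ := by
    rw [e]
    calc _ = ‖op (b u) g x + (op (b u) f x - op (b u) g x)‖ₑ := by congr 1; ring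
      _ ≤ _ := enorm_add_le _ _
  exact h.trans (add_le_add (le_iSup (fun u : I => ‖op (b u) g x‖ₑ) u) (le_iSup (fun u : I => ‖op (b u) (⇑(f - g)) x‖ₑ) u))

theorem SS_lsc (hb : ∀ u, Continuous (b u)) (hcs : ∀ u, HasCompactSupport (b u)) (f : SchwartzMap (ℝ × ℝ) ℂ) :
    LowerSemicontinuous (SS I b f) := by
  unfold SS
  apply lowerSemicontinuous_iSup
  intro u
  exact ((op_cont (hb u) (hcs u) f.integrable).enorm).lowerSemicontinuous

theorem SS_piece {χ : ℝ × ℝ → ℂ} (h : ∀ u ξ, b u ξ * χ ξ = b u ξ) (f g : ℝ × ℝ → ℂ) (hg : ∀ ξ, ft g ξ = χ ξ * ft f ξ) (x) :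
    SS I b f x = SS I b g x := by
  unfold SS op
  congr 1; ext u
  congr 3; ext ξ
  rw [hg, ← mul_assoc, h]

theorem SS_osc {f : ℝ × ℝ → ℂ} {x x' : ℝ × ℝ} {D : ℝ≥0∞} (h : ∀ u : I, ‖op (b u) f x' - op (b u) f x‖ₑ ≤ D) :
    SS I b f x ≤ SS I b f x' + D ∧ SS I b f x' ≤ SS I b f x + D := by
  constructor
  · apply iSup_le
    intro u
    calc ‖op (b u) f x‖ₑ = ‖op (b u) f x' - (op (b u) f x' - op (b u) f x)‖ₑ := by congr 1; ring
      _ ≤ ‖op (b u) f x'‖ₑ + ‖op (b u) f x' - op (b u) f x‖ₑ := enorm_sub_le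
      _ ≤ _ := add_le_add (le_iSup (fun u : I => ‖op (b u) f x'‖ₑ) u) (h u)
  · apply iSup_le
    intro u
    calc ‖op (b u) f x'‖ₑ = ‖op (b u) f x + (op (b u) f x' - op (b u) f x)‖ₑ := by congr 1; ring
      _ ≤ ‖op (b u) f x‖ₑ + ‖op (b u) f x' - op (b u) f x‖ₑ := enorm_add_le _ _
      _ ≤ _ := add_le_add (le_iSup (fun u : I => ‖op (b u) f x‖ₑ) u) (h u)

end one

theorem opfam {I K₁ K₂ : Set ℝ} (hK₁ : IsCompact K₁) (hK₂ : IsCompact K₂) (hK₂0 : (0 : ℝ) ∉ K₂) {d : ℕ} (hd : 1 ≤ d)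
    {b1 B1 : ℝ} (hb1 : 0 < b1) (hB1 : 1 ≤ B1) :
    ∃ B : ℝ, 0 < B ∧ ∀ {A : ℝ} (_ : 0 < A) (σ : ℤ → ℤ) (α : ℤ → ℝ) (_ : ∀ k, ScOK A d (σ k) (α k) (2 ^ (-k)) b1 B1)
      {F G : ℝ} (_ : 0 < F) (_ : 0 < G) (a : ℤ → ℝ × ℝ × ℝ → ℂ),
        (∀ k : ℤ, ContDiff ℝ (⊤ : ℕ∞) (a k)) →
        (∀ k : ℤ, Function.support (a k) ⊆ I ×ˢ K₁ ×ˢ K₂) →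
        (∀ (k : ℤ) (f : SchwartzMap (ℝ × ℝ) ℂ) (q : ℝ≥0∞), q = 2 ∨ q = ⊤ →
          eLpNorm (fun x : ℝ × ℝ =>
              ⨆ u : I, ‖op (fun ξ => a k (↑u, ξ.1, ξ.2)) (⇑f) x‖) q volume ≤
            ENNReal.ofReal F * eLpNorm (⇑f) q volume) →
        (∀ (k : ℤ) (u : ℝ), u ∈ I → ∀ ξ ∈ K₁ ×ˢ K₂, ∀ n : ℕ, n ≤ 6 →
          ‖iteratedFDeriv ℝ n (fun ζ : ℝ × ℝ => a k (u, ζ.1, ζ.2)) ξ‖ ≤ G) →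
        OpFam A d σ B F G (fun k f x => SS I (fun u ξ => a k (u, α k * ξ.1, 2 ^ (-k) * ξ.2)) f x) := by
  obtain ⟨C, hC0, hC⟩ := ker_bound (hK₁.prod hK₂)
  obtain ⟨χ, r, R, hr, hrR, hχs, hχc, hχ1, hχK, hχr⟩ := bump_exists hK₁ hK₂ hK₂0
  obtain ⟨n, hn1, hn⟩ := overlap hr hrR
  set B := max (n : ℝ) (max (b1⁻¹ ^ 2 * B1 ^ 6 * C) (b1⁻¹ ^ 3 * B1 ^ 6 * (1 + 2 * b1⁻¹) ^ 6 * C)) with hB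
  have hBn : (n : ℝ) ≤ B := le_max_left _ _
  have hBk : b1⁻¹ ^ 2 * B1 ^ 6 * C ≤ B := (le_max_left _ _).trans (le_max_right _ _)
  have hBo : b1⁻¹ ^ 3 * B1 ^ 6 * (1 + 2 * b1⁻¹) ^ 6 * C ≤ B := (le_max_right _ _).trans (le_max_right _ _)
  have hn0 : (1 : ℝ) ≤ n := by exact_mod_cast hn1
  refine ⟨B, by linarith, ?_⟩
  intro A hA σ α hsc F G hF hG a ha hsupp hyp hder
  have hα : ∀ k, 0 < α k := fun k => (hsc k).hα
  have hβ : ∀ k : ℤ, 0 < (2 : ℝ) ^ (-k) := fun k => (hsc k).hβ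
  set b : ℤ → ℝ → ℝ × ℝ → ℂ := fun k u ξ => a k (u, ξ.1, ξ.2) with hb
  have hbs : ∀ k u, ContDiff ℝ (⊤ : ℕ∞) (b k u) := fun k u => (ha k).comp (by fun_prop)
  have hbc : ∀ k u, Continuous (b k u) := fun k u => (hbs k u).continuous
  have hbsup : ∀ k u, Function.support (b k u) ⊆ K₁ ×ˢ K₂ := fun k u ξ hξ => (hsupp k hξ).2
  have hbcs : ∀ k u, HasCompactSupport (b k u) := fun k u =>
    HasCompactSupport.intro (hK₁.prod hK₂) (fun x hx => by
      by_contra hne; exact hx (hbsup k u hne))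
  have hker : ∀ k (u : I), Differentiable ℝ (ftInv (b k u)) ∧ ∀ x : ℝ × ℝ, (1 + |x.1| + |x.2|) ^ 6 * ‖ftInv (b k u) x‖ ≤ C * G ∧
      (1 + |x.1| + |x.2|) ^ 6 * ‖fderiv ℝ (ftInv (b k u)) x‖ ≤ C * G :=
    fun k u => hC (b k u) G hG.le (hbs k u) (hbsup k u) (fun ξ hξ m hm => hder k u u.2 ξ hξ m hm)
  have hM : ∀ k (u : I), ∀ x, ‖ftInv (b k u) x‖ ≤ C * G := by
    intro k u x
    refine le_trans ?_ ((hker k u).2 x).1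
    apply le_mul_of_one_le_left (norm_nonneg _)
    apply one_le_pow₀
    have := abs_nonneg x.1
    have := abs_nonneg x.2
    linarith
  have hdc : ∀ k u, Continuous (fun ξ => b k u (dil (α k) (2 ^ (-k)) ξ)) := fun k u => (hbc k u).comp (dil_cont _ _)
  have hdcs : ∀ k u, HasCompactSupport (fun ξ => b k u (dil (α k) (2 ^ (-k)) ξ)) := fun k u => dil_cs (hα k) (hβ k) (hbcs k u)
  change OpFam A d σ B F G (fun k f x => SS I (fun u ξ => b k u (dil (α k) (2 ^ (-k)) ξ)) f x)
  refine ⟨?_, ?_, ?_, ?_, ?_, ?_⟩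
  · intro k f g x
    exact SS_sub (hdc k) (hdcs k) f g x
  · intro k f
    exact SS_lsc (hdc k) (hdcs k) f
  · intro k f M _ hfM
    exact SS_linf (hα k) (hβ k) hF.le (hbc k) (hbcs k) (hM k) (fun f => hyp k f ⊤ (Or.inr rfl)) f hfM
  · intro f
    have hχd : ∀ k : ℤ, ∃ g : SchwartzMap (ℝ × ℝ) ℂ, ∀ ξ, ft g ξ = χ (dil (α k) (2 ^ (-k)) ξ) * ft f ξ := by
      intro k
      apply lp_piece f (fun ξ => χ (dil (α k) (2 ^ (-k)) ξ))
      · apply hχs.comp; unfold dil; fun_prop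
      · exact dil_cs (hα k) (hβ k) hχc
    choose g hg using hχd
    have hmul : ∀ k u ξ, b k u (dil (α k) (2 ^ (-k)) ξ) * χ (dil (α k) (2 ^ (-k)) ξ) = b k u (dil (α k) (2 ^ (-k)) ξ) := by
      intro k u ξ
      by_cases h : b k u (dil (α k) (2 ^ (-k)) ξ) = 0
      · rw [h, zero_mul]
      · rw [hχK _ (hbsup k u h), mul_one]
    have h1 : ∀ k, ∫⁻ x, SS I (fun u ξ => b k u (dil (α k) (2 ^ (-k)) ξ)) f x ^ (2 : ℝ) ≤
        ENNReal.ofReal F ^ (2 : ℝ) * ∫⁻ ξ, ‖χ (dil (α k) (2 ^ (-k)) ξ)‖ₑ ^ (2 : ℝ) * ‖ft f ξ‖ₑ ^ (2 : ℝ) := by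
      intro k
      have e : ∀ x, SS I (fun u ξ => b k u (dil (α k) (2 ^ (-k)) ξ)) f x = SS I (fun u ξ => b k u (dil (α k) (2 ^ (-k)) ξ)) (g k) x :=
        fun x => SS_piece (χ := fun ξ => χ (dil (α k) (2 ^ (-k)) ξ)) (fun u ξ => hmul k u ξ) f (g k) (hg k) x
      simp_rw [e]
      refine (SS_l2 (hα k) (hβ k) (hbc k) (hbcs k) (hM k) (fun f => hyp k f 2 (Or.inl rfl)) (g k)).trans ?_
      rw [← plancherel (g k)]
      simp_rw [hg, enorm_mul, ENNReal.mul_rpow_of_nonneg _ _ (zero_le_two (α := ℝ))]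
      exact le_rfl
    have hftm : Measurable fun ξ => ‖ft f ξ‖ₑ ^ (2 : ℝ) := ((ft_cont f.integrable).measurable.enorm).pow_const _
    have hχm : ∀ k : ℤ, Measurable fun ξ => ‖χ (dil (α k) (2 ^ (-k)) ξ)‖ₑ ^ (2 : ℝ) := fun k =>
      ((hχs.continuous.comp (dil_cont _ _)).measurable.enorm).pow_const _
    calc _ ≤ ∑' k, ENNReal.ofReal F ^ (2 : ℝ) * ∫⁻ ξ, ‖χ (dil (α k) (2 ^ (-k)) ξ)‖ₑ ^ (2 : ℝ) * ‖ft f ξ‖ₑ ^ (2 : ℝ) :=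
          ENNReal.tsum_le_tsum h1
      _ = ENNReal.ofReal F ^ (2 : ℝ) * ∫⁻ ξ, (∑' k : ℤ, ‖χ (dil (α k) (2 ^ (-k)) ξ)‖ₑ ^ (2 : ℝ)) * ‖ft f ξ‖ₑ ^ (2 : ℝ) := by
          rw [ENNReal.tsum_mul_left]
          simp_rw [← ENNReal.tsum_mul_right]
          congr 1
          exact (lintegral_tsum (fun k => ((hχm k).mul hftm).aemeasurable)).symm
      _ ≤ ENNReal.ofReal F ^ (2 : ℝ) * ∫⁻ ξ, (n : ℝ≥0∞) * ‖ft f ξ‖ₑ ^ (2 : ℝ) := by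
          apply mul_le_mul_right
          apply lintegral_mono
          intro ξ
          apply mul_le_mul_left
          apply hn ξ.2
          · intro k
            apply ENNReal.rpow_le_one _ zero_le_two
            rw [← ofReal_norm]
            exact ENNReal.ofReal_le_one.2 (hχ1 _)
          · intro k hk
            apply hχr (dil (α k) (2 ^ (-k)) ξ)
            intro h0
            apply hk
            rw [h0]; simp
      _ = ENNReal.ofReal F ^ (2 : ℝ) * ((n : ℝ≥0∞) * ∫⁻ x, ‖f x‖ₑ ^ (2 : ℝ)) := by
          rw [lintegral_const_mul _ hftm, plancherel]
      _ ≤ _ := by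
          rw [← mul_assoc]
          apply mul_le_mul_left
          rw [ENNReal.ofReal_mul (by linarith), mul_comm, ENNReal.ofReal_pow hF.le]
          have : (n : ℝ≥0∞) ≤ ENNReal.ofReal B := by
            rw [← ENNReal.ofReal_natCast]; exact ENNReal.ofReal_le_ofReal hBn
          refine (mul_le_mul_left this _).trans (le_of_eq ?_)
          norm_cast
  · intro k f x
    apply iSup_le
    intro u
    refine (ker_one hA hb1 hB1 (hsc k) (hbc k u) (hbcs k u) (by positivity) (fun x => ((hker k u).2 x).1) f.integrable x).trans ?_
    apply mul_le_mul_left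
    apply ENNReal.ofReal_le_ofReal
    rw [← mul_assoc]
    exact mul_le_mul_of_nonneg_right hBk hG.le
  · intro k f j x x' hj hx
    apply SS_osc
    intro u
    refine (osc_one hA hd hj hb1 hB1 (hsc k) (hbc k u) (hbcs k u) (by positivity) (hker k u).1 (fun x => ((hker k u).2 x).2) f.integrable hx).trans ?_
    apply mul_le_mul_left
    apply ENNReal.ofReal_le_ofReal
    have h2 : (0 : ℝ) < 2 ^ (-(j - σ k)) := by positivity
    apply mul_le_mul_of_nonneg_right _ h2.le
    rw [← mul_assoc]
    exact mul_le_mul_of_nonneg_right hBo hG.le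

theorem sup_sqrt_le {I : Set ℝ} (o : I → ℤ → ℂ) (S : ℤ → ℝ≥0∞) (h : ∀ u k, ‖o u k‖ₑ ≤ S k) :
    ‖⨆ u : I, Real.sqrt (∑' k : ℤ, ‖o u k‖ ^ 2)‖ₑ ≤ (∑' k, S k ^ (2 : ℝ)) ^ (1 / 2 : ℝ) := by
  by_cases hT : ∑' k, S k ^ (2 : ℝ) = ⊤
  · rw [hT, ENNReal.top_rpow_of_pos (by norm_num)]; exact le_top
  set T := ∑' k, S k ^ (2 : ℝ) with hTdef
  have h1 : ∀ u : I, Real.sqrt (∑' k : ℤ, ‖o u k‖ ^ 2) ≤ Real.sqrt T.toReal := by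
    intro u
    apply Real.sqrt_le_sqrt
    apply tsum_le_of_sum_le' ENNReal.toReal_nonneg
    intro E
    rw [← ENNReal.ofReal_le_iff_le_toReal hT, ENNReal.ofReal_sum_of_nonneg (fun _ _ => by positivity)]
    refine le_trans ?_ (ENNReal.sum_le_tsum E)
    apply Finset.sum_le_sum
    intro k _
    rw [ENNReal.ofReal_pow (norm_nonneg _), ofReal_norm]
    have := ENNReal.rpow_le_rpow (h u k) (zero_le_two (α := ℝ))
    exact_mod_cast this
  have h2 := Real.iSup_le h1 (Real.sqrt_nonneg _)
  have h3 : 0 ≤ ⨆ u : I, Real.sqrt (∑' k : ℤ, ‖o u k‖ ^ 2) := Real.iSup_nonneg fun u => Real.sqrt_nonneg _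
  rw [← ofReal_norm, Real.norm_of_nonneg h3]
  refine (ENNReal.ofReal_le_ofReal h2).trans (le_of_eq ?_)
  rw [Real.sqrt_eq_rpow, ← ENNReal.ofReal_rpow_of_nonneg ENNReal.toReal_nonneg (by norm_num), ENNReal.ofReal_toReal hT]

theorem num_final {p : ℝ} (hp : 2 < p) {Cm : ℝ≥0∞} (hCm : Cm ≠ ⊤) {N : ℕ} {L : ℝ} (hL : 0 ≤ L) (hN : (N : ℝ) ≤ L + 1) :
    Cm * ((1 + N : ℕ) : ℝ≥0∞) ^ (p / 2 - 1) ≤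
      ENNReal.ofReal (2 * (Cm.toReal ^ (1 / p) + 1) * (1 + L ^ ((1 : ℝ) / 2 - 1 / p))) ^ p := by
  have hp0 : 0 < p := by linarith
  set θ := (1 : ℝ) / 2 - 1 / p with hθ
  have hθ0 : 0 ≤ θ := by
    rw [hθ, sub_nonneg]; exact one_div_le_one_div_of_le two_pos hp.le
  have hθ1 : θ ≤ 1 := by
    have : 0 < 1 / p := by positivity
    rw [hθ]; linarith
  have e1 : p / 2 - 1 = θ * p := by rw [hθ]; field_simp
  have hx0 : (0 : ℝ) ≤ (1 + N : ℕ) := by positivity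
  have e2 : Cm * ((1 + N : ℕ) : ℝ≥0∞) ^ (p / 2 - 1) = ENNReal.ofReal (Cm.toReal ^ (1 / p) * ((1 + N : ℕ) : ℝ) ^ θ) ^ p := by
    rw [ENNReal.ofReal_mul (by positivity), ENNReal.mul_rpow_of_nonneg _ _ hp0.le, e1,
      ← ENNReal.ofReal_rpow_of_nonneg hx0 hθ0, ENNReal.ofReal_natCast, ← ENNReal.ofReal_rpow_of_nonneg ENNReal.toReal_nonneg (by positivity),
      ← ENNReal.rpow_mul, ← ENNReal.rpow_mul, one_div, inv_mul_cancel₀ hp0.ne', ENNReal.rpow_one, ENNReal.ofReal_toReal hCm]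
  rw [e2]
  apply ENNReal.rpow_le_rpow _ hp0.le
  apply ENNReal.ofReal_le_ofReal
  have h1 : ((1 + N : ℕ) : ℝ) ^ θ ≤ 2 * (1 + L ^ θ) := by
    have a0 : 0 ≤ L ^ θ := by positivity
    have a1 : (2 : ℝ) ^ θ ≤ 2 := by
      calc (2 : ℝ) ^ θ ≤ 2 ^ (1 : ℝ) := Real.rpow_le_rpow_of_exponent_le (by norm_num) hθ1
        _ = 2 := Real.rpow_one 2
    calc ((1 + N : ℕ) : ℝ) ^ θ ≤ (2 + L) ^ θ := by
          apply Real.rpow_le_rpow hx0 _ hθ0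
          push_cast; linarith
      _ ≤ 2 ^ θ + L ^ θ := Real.rpow_add_le_add_rpow (by norm_num) hL hθ0 hθ1
      _ ≤ _ := by linarith
  have h2 : 0 ≤ Cm.toReal ^ (1 / p) := by positivity
  have h3 : 0 ≤ L ^ θ := by positivity
  calc _ ≤ Cm.toReal ^ (1 / p) * (2 * (1 + L ^ θ)) := by gcongr
    _ ≤ _ := by nlinarith

/-- The key vector-valued estimate (Lemma 4.6). -/
theorem key_vector_valued_estimate
    (γ : ℝ → ℝ)
    (hγ0 : γ 0 = 0)
    (hsmooth : ContDiffOn ℝ (⊤ : ℕ∞) γ (Set.Icc (-1 : ℝ) 1))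
    (hparity : (∀ t, γ (-t) = γ t) ∨ (∀ t, γ (-t) = -γ t))
    (hmono : StrictMonoOn γ (Set.Icc (0 : ℝ) 1))
    (hyp1 : ∃ c > (0 : ℝ), ∀ t ∈ Set.Ioc (0 : ℝ) 1,
      c ≤ |deriv (fun s => deriv γ s / deriv (deriv γ) s) t|)
    (hyp2 : ∃ c > (0 : ℝ), ∀ j ∈ ({1, 2} : Set ℕ), ∀ t ∈ Set.Ioc (0 : ℝ) 1,
      c ≤ |t ^ j * iteratedDeriv j γ t / γ t|)
    (hyp3 : ∃ C : ℝ, ∀ j : ℕ, 1 ≤ j → j ≤ 1000 → ∀ t ∈ Set.Ioc (0 : ℝ) 1,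
      |t ^ j * iteratedDeriv j γ t / γ t| ≤ C)
    (hγ1 : γ 1 = 1)
    (hconv : ∀ t ∈ Set.Ioc (0 : ℝ) 1, 0 < iteratedDeriv 2 γ t)
    (hext : ∀ t : ℝ, 1 ≤ t → γ t = (γ t⁻¹)⁻¹)
    (hcont : ContinuousOn γ (Set.Ici (0 : ℝ)))
    (hmono2 : StrictMonoOn γ (Set.Ici (0 : ℝ)))
    (hsurj : γ '' Set.Ici (0 : ℝ) = Set.Ici (0 : ℝ))
    (C0L C0U : ℝ) (hC0L : 1 < C0L) (hC0U : 1 < C0U)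
    (hdouble : ∀ t : ℝ, 0 < t → C0L ≤ γ (2 * t) / γ t ∧ γ (2 * t) / γ t ≤ C0U)
    (p : ℝ) (hp : 2 < p)
    (I K₁ K₂ : Set ℝ) (hI : IsCompact I)
    (hK₁ : IsCompact K₁) (hK₂ : IsCompact K₂)
    (hK₁0 : (0 : ℝ) ∉ K₁) (hK₂0 : (0 : ℝ) ∉ K₂)
    (cγ Cγ : ℝ) (hcγ : 0 < cγ) (hcC : cγ ≤ Cγ) :
    ∃ C : ℝ, 0 < C ∧
      ∀ (l : ℕ) (v : ℤ) (F G : ℝ), 0 < F → F ≤ G →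
      ∀ a : ℤ → ℝ × ℝ × ℝ → ℂ,
        (∀ k : ℤ, ContDiff ℝ (⊤ : ℕ∞) (a k)) →
        (∀ k : ℤ, Function.support (a k) ⊆ I ×ˢ K₁ ×ˢ K₂) →
      ∀ l₀ : ℤ → ℤ,
        (∀ k : ℤ, cγ ≤ (2 : ℝ) ^ (k + v) * γ ((2 : ℝ) ^ (-(l₀ k))) ∧
          (2 : ℝ) ^ (k + v) * γ ((2 : ℝ) ^ (-(l₀ k))) ≤ Cγ) →
        (∀ (k : ℤ) (f : SchwartzMap (ℝ × ℝ) ℂ) (q : ℝ≥0∞), q = 2 ∨ q = ⊤ →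
          eLpNorm (fun x : ℝ × ℝ =>
              ⨆ u : I, ‖op (fun ξ => a k (↑u, ξ.1, ξ.2)) (⇑f) x‖) q volume ≤
            ENNReal.ofReal F * eLpNorm (⇑f) q volume) →
        (∀ (k : ℤ) (u : ℝ), u ∈ I → ∀ ξ ∈ K₁ ×ˢ K₂, ∀ n : ℕ, n ≤ 6 →
          ‖iteratedFDeriv ℝ n (fun ζ : ℝ × ℝ => a k (u, ζ.1, ζ.2)) ξ‖ ≤ G) →
      ∀ f : SchwartzMap (ℝ × ℝ) ℂ,
        eLpNorm (fun x : ℝ × ℝ =>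
            ⨆ u : I, Real.sqrt (∑' k : ℤ,
              ‖op (fun ξ => a k (↑u,
                  (2 : ℝ) ^ (-(l₀ k)) * (gammaZ γ (l₀ k) ((2 : ℝ) ^ (l : ℕ)))⁻¹ * ξ.1,
                  (2 : ℝ) ^ (-k) * ξ.2)) (⇑f) x‖ ^ 2))
          (ENNReal.ofReal p) volume ≤
        ENNReal.ofReal
            (C * (1 + Real.logb 2 (C0U ^ (l : ℕ) * G / F) ^ ((1 : ℝ)/2 - 1/p)) * F) *
          eLpNorm (⇑f) (ENNReal.ofReal p) volume := by
  have hp0 : 0 < p := by linarith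
  obtain ⟨d, hd, c, C, hc, hC, hγp⟩ := gamma_pow γ hγ0 hsmooth hγ1 hext hmono2 C0U hC0U (fun t ht => (hdouble t ht).2)
  obtain ⟨b, B0, hb, hB0, hαb⟩ := alpha_bd γ hd hc hC hγp hcγ (hcγ.trans_le hcC)
  have hb1 : 0 < min b ((2 : ℝ) ^ d)⁻¹ := lt_min hb (by positivity)
  obtain ⟨B, hB, hfam⟩ := opfam (I := I) hK₁ hK₂ hK₂0 hd hb1 (le_max_right B0 1)
  obtain ⟨Cm, hCm, hmain⟩ := abstract_main hp hd hB
  have hcm0 : 0 ≤ Cm.toReal ^ (1 / p) := Real.rpow_nonneg ENNReal.toReal_nonneg _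
  refine ⟨2 * (Cm.toReal ^ (1 / p) + 1), by linarith, ?_⟩
  intro l v F G hF hFG a ha hsupp l₀ hl₀ hyp hder f
  have hG : 0 < G := hF.trans_le hFG
  obtain ⟨A, hA, hAb⟩ := hαb l v
  set α : ℤ → ℝ := fun k => (2 : ℝ) ^ (-(l₀ k)) * (gammaZ γ (l₀ k) ((2 : ℝ) ^ (l : ℕ)))⁻¹ with hα
  have hsc : ∀ k, ScOK A d (k / (d : ℤ)) (α k) (2 ^ (-k)) (min b ((2 : ℝ) ^ d)⁻¹) (max B0 1) := by
    intro k
    obtain ⟨h1, h2⟩ := hAb (l₀ k) k (hl₀ k).1 (hl₀ k).2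
    obtain ⟨h3, h4⟩ := beta_bd hd k
    refine ⟨?_, by positivity, (min_le_left _ _).trans h1, h2.trans (le_max_left _ _), (min_le_right _ _).trans h3, h4.trans (le_max_right _ _)⟩
    exact pos_of_mul_pos_right (hb.trans_le h1) (gX_pos hA _).le
  have hF1 := hfam hA (fun k => k / (d : ℤ)) α hsc hF hG a ha hsupp hyp hder
  set N : ℕ := ⌈Real.logb 2 (G / F)⌉₊ with hN
  have hGF1 : 1 ≤ G / F := (one_le_div hF).2 hFG
  have hlog0 : 0 ≤ Real.logb 2 (G / F) := Real.logb_nonneg (by norm_num) hGF1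
  have hGN : G ≤ F * 2 ^ N := by
    have h1 : G / F ≤ 2 ^ N := by
      calc G / F = 2 ^ (Real.logb 2 (G / F)) := (Real.rpow_logb (by norm_num) (by norm_num) (by positivity)).symm
        _ ≤ 2 ^ (N : ℝ) := Real.rpow_le_rpow_of_exponent_le (by norm_num) (Nat.le_ceil _)
        _ = 2 ^ N := Real.rpow_natCast 2 N
    rwa [div_le_iff₀ hF, mul_comm] at h1
  have hL : Real.logb 2 (G / F) ≤ Real.logb 2 (C0U ^ (l : ℕ) * G / F) := by
    apply Real.logb_le_logb_of_le (by norm_num) (by positivity)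
    rw [mul_div_assoc]
    exact le_mul_of_one_le_left (by positivity) (one_le_pow₀ hC0U.le)
  have hNL : (N : ℝ) ≤ Real.logb 2 (C0U ^ (l : ℕ) * G / F) + 1 := by
    have := (Nat.ceil_lt_add_one hlog0).le
    linarith
  have hnum := num_final hp hCm (hlog0.trans hL) hNL
  have hm := hmain hA (fun s E => fiber_card hd s E) hF hG hGN hF1 f
  rw [← ENNReal.rpow_le_rpow_iff hp0, ENNReal.mul_rpow_of_nonneg _ _ hp0.le, eLp_pow hp0, eLp_pow hp0,
    ENNReal.ofReal_mul (by have := Real.rpow_nonneg (hlog0.trans hL) ((1 : ℝ)/2 - 1/p); positivity), ENNReal.mul_rpow_of_nonneg _ _ hp0.le]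
  refine le_trans (lintegral_mono fun x => ?_) (hm.trans ?_)
  · apply ENNReal.rpow_le_rpow _ hp0.le
    apply sup_sqrt_le (fun (u : I) k => op (fun ξ => a k (↑u, α k * ξ.1, (2 : ℝ) ^ (-k) * ξ.2)) f x)
    intro u k
    exact le_iSup (fun u : I => ‖op (fun ξ => a k (↑u, α k * ξ.1, (2 : ℝ) ^ (-k) * ξ.2)) f x‖ₑ) u
  · rw [← mul_assoc, mul_assoc (ENNReal.ofReal _ ^ p) (ENNReal.ofReal F ^ p)]
    exact mul_le_mul_left hnum _
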